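/- arXiv:2511.02001 — 3 statements merged into one kernel-verified Lean document; each statement's English description precedes it below -/
import Mathlib

section
/- Let m ∈ ℕ and a, b ∈ ℝ∖{0}, and let Φ, Ψ be the linear flows on ℝ^{2m} generated by J_m(a+ib) and by aI_{2m}, respectively. Then Φ and Ψ are all-Hölder equivalent (Φ ~^{1⁻} Ψ). -/
noncomputable section
namespace LF

open Filter Topology

/-- `ℝ^d` with the Euclidean norm. -/
abbrev Euc (d : ℕ) := EuclideanSpace ℝ (Fin d)

variable {d : ℕ}

/-- The time-`t` map of the linear flow on `ℝ^d` generated by the matrix `A`,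
i.e. `x ↦ exp (t A) x`. -/
def linFlow (A : Matrix (Fin d) (Fin d) ℝ) (t : ℝ) (x : Euc d) : Euc d :=
  Matrix.toEuclideanLin (NormedSpace.exp (t • A)) x

/-- The orbit `{Φ_t x : t ∈ ℝ}` of `x` under the linear flow generated by `A`. -/
def flowOrbit (A : Matrix (Fin d) (Fin d) ℝ) (x : Euc d) : Set (Euc d) :=
  Set.range fun t : ℝ => linFlow A t x

/-- `Φ` is `h`-related to `Ψ`: the homeomorphism `h` maps every orbit of the flow
generated by `A` onto an orbit of the flow generated by `B`. -/
def IsOrbitEquiv (A B : Matrix (Fin d) (Fin d) ℝ) (h : Euc d ≃ₜ Euc d) : Prop :=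
  ∀ x : Euc d, h '' flowOrbit A x = flowOrbit B (h x)

/-- `f` satisfies a `β`-Hölder condition on some ball centred at `0`. -/
def HolderNearZero (β : ℝ) (f : Euc d → Euc d) : Prop :=
  ∃ r > (0 : ℝ), ∃ K : ℝ, ∀ x ∈ Metric.ball (0 : Euc d) r, ∀ y ∈ Metric.ball (0 : Euc d) r,
    dist (f x) (f y) ≤ K * dist x y ^ β

/-- `h ∈ 𝓗_β`: `h 0 = 0` and `h`, `h⁻¹` both satisfy a `β`-Hölder condition near `0`. -/
def MemHolderClass (β : ℝ) (h : Euc d ≃ₜ Euc d) : Prop :=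
  h 0 = 0 ∧ HolderNearZero β ⇑h ∧ HolderNearZero β ⇑h.symm

/-- `h ∈ 𝓗_0`: homeomorphisms fixing `0`. -/
def MemH0 (h : Euc d ≃ₜ Euc d) : Prop := h 0 = 0

/-- `h ∈ 𝓗_{0⁺} = ⋃_{γ>0} 𝓗_γ`. -/
def MemH0plus (h : Euc d ≃ₜ Euc d) : Prop := ∃ γ : ℝ, 0 < γ ∧ MemHolderClass γ h

/-- `h ∈ 𝓗_{1⁻} = ⋂_{0<γ<1} 𝓗_γ`. -/
def MemH1minus (h : Euc d ≃ₜ Euc d) : Prop := ∀ γ : ℝ, 0 < γ → γ < 1 → MemHolderClass γ h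

/-- `h ∈ 𝓗_{β⁻} = ⋂_{0<γ<β} 𝓗_γ`. -/
def MemHBelow (β : ℝ) (h : Euc d ≃ₜ Euc d) : Prop :=
  ∀ γ : ℝ, 0 < γ → γ < β → MemHolderClass γ h

/-- `h ∈ 𝓗_{β⁺} = ⋃_{γ>β} 𝓗_γ`. -/
def MemHAbove (β : ℝ) (h : Euc d ≃ₜ Euc d) : Prop :=
  ∃ γ : ℝ, β < γ ∧ MemHolderClass γ h

/-- `φ ~^⋆ ψ`: `φ` is `h`-related to `ψ` for some `h` in the class `P`. -/
def RelEquivWith (P : (Euc d ≃ₜ Euc d) → Prop) (A B : Matrix (Fin d) (Fin d) ℝ) : Prop :=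
  ∃ h : Euc d ≃ₜ Euc d, P h ∧ IsOrbitEquiv A B h

/-- `φ ≃^⋆ ψ`: there are `h` in the class `P` and `α ≠ 0` with
`h (φ t x) = ψ (α t) (h x)` for all `t`, `x`. -/
def SimEquivWith (P : (Euc d ≃ₜ Euc d) → Prop) (A B : Matrix (Fin d) (Fin d) ℝ) : Prop :=
  ∃ (h : Euc d ≃ₜ Euc d) (α : ℝ), α ≠ 0 ∧ P h ∧
    ∀ (t : ℝ) (x : Euc d), h (linFlow A t x) = linFlow B (α * t) (h x)

/-- The stable set `X_S^Φ = {x : Φ_t x → 0 as t → ∞}`. -/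
def stableSet (A : Matrix (Fin d) (Fin d) ℝ) : Set (Euc d) :=
  {x | Tendsto (fun t : ℝ => linFlow A t x) atTop (𝓝 0)}

/-- The unstable set `X_U^Φ = {x : Φ_t x → 0 as t → -∞}`. -/
def unstableSet (A : Matrix (Fin d) (Fin d) ℝ) : Set (Euc d) :=
  {x | Tendsto (fun t : ℝ => linFlow A t x) atBot (𝓝 0)}

/-- The central set `X_C^Φ = {x : e^{-ε|t|} Φ_t x → 0 as |t| → ∞, for every ε > 0}`. -/
def centralSet (A : Matrix (Fin d) (Fin d) ℝ) : Set (Euc d) :=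
  {x | ∀ ε > (0 : ℝ),
    Tendsto (fun t : ℝ => Real.exp (-(ε * |t|)) • linFlow A t x) (atBot ⊔ atTop) (𝓝 0)}

/-- The stable subspace of the flow generated by `A` (the stable set is a subspace,
so taking its span is innocuous). -/
def XS (A : Matrix (Fin d) (Fin d) ℝ) : Submodule ℝ (Euc d) := Submodule.span ℝ (stableSet A)

/-- The unstable subspace. -/
def XU (A : Matrix (Fin d) (Fin d) ℝ) : Submodule ℝ (Euc d) := Submodule.span ℝ (unstableSet A)

/-- The central subspace. -/
def XC (A : Matrix (Fin d) (Fin d) ℝ) : Submodule ℝ (Euc d) := Submodule.span ℝ (centralSet A)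

/-- The hyperbolic subspace `X_H^Φ = X_S^Φ ⊕ X_U^Φ`. -/
def XH (A : Matrix (Fin d) (Fin d) ℝ) : Submodule ℝ (Euc d) := XS A ⊔ XU A

def dimS (A : Matrix (Fin d) (Fin d) ℝ) : ℕ := Module.finrank ℝ (XS A)
def dimU (A : Matrix (Fin d) (Fin d) ℝ) : ℕ := Module.finrank ℝ (XU A)
def dimHyp (A : Matrix (Fin d) (Fin d) ℝ) : ℕ := Module.finrank ℝ (XH A)

/-- The central-part generators `A^{Φ_C}` and `α A^{Ψ_C}` are similar, i.e.
`Q A_C = (α B_C) Q` for some linear isomorphism `Q : X_C^Φ → X_C^Ψ`. -/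
def IsCentralSimilar (A B : Matrix (Fin d) (Fin d) ℝ) (α : ℝ) : Prop :=
  ∃ (hA : ∀ x ∈ XC A, Matrix.toEuclideanLin A x ∈ XC A)
    (hB : ∀ x ∈ XC B, Matrix.toEuclideanLin B x ∈ XC B)
    (Q : XC A ≃ₗ[ℝ] XC B),
    ∀ x : XC A, Q ((Matrix.toEuclideanLin A).restrict hA x)
      = α • (Matrix.toEuclideanLin B).restrict hB (Q x)

/-- The forward Lyapunov exponent `λ_+^Φ(x) = lim_{t→∞} log ‖Φ_t x‖ / t`
(the limit exists for `x ≠ 0`, so it equals the `limsup` used here). -/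
def lyap (A : Matrix (Fin d) (Fin d) ℝ) (x : Euc d) : ℝ :=
  Filter.limsup (fun t : ℝ => Real.log ‖linFlow A t x‖ / t) atTop

/-- The Lyapunov space `L^Φ(s) = {x : λ_+^Φ(x) ≤ s}` (with `λ_+^Φ(0) = -∞`), as a set. -/
def lyapSet (A : Matrix (Fin d) (Fin d) ℝ) (s : ℝ) : Set (Euc d) :=
  {x | x = 0 ∨ lyap A x ≤ s}

/-- `ℓ^Φ(s) = dim L^Φ(s)` (the Lyapunov set is a subspace, so taking its span is innocuous). -/
def ell (A : Matrix (Fin d) (Fin d) ℝ) (s : ℝ) : ℕ :=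
  Module.finrank ℝ (Submodule.span ℝ (lyapSet A s))

/-- The `(j+1)`-st smallest Lyapunov exponent `λ_{j+1}^Φ`, counted with multiplicity. -/
def lyapExp (A : Matrix (Fin d) (Fin d) ℝ) (j : ℕ) : ℝ :=
  sInf {s : ℝ | j + 1 ≤ ell A s}

/-- The Lyapunov space at `s` of the restriction of the flow to the invariant set `V`. -/
def lyapSetIn (A : Matrix (Fin d) (Fin d) ℝ) (V : Set (Euc d)) (s : ℝ) : Set (Euc d) :=
  {x | x ∈ V ∧ (x = 0 ∨ lyap A x ≤ s)}

def ellIn (A : Matrix (Fin d) (Fin d) ℝ) (V : Set (Euc d)) (s : ℝ) : ℕ :=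
  Module.finrank ℝ (Submodule.span ℝ (lyapSetIn A V s))

/-- The `(j+1)`-st smallest Lyapunov exponent of the flow restricted to `V`. -/
def lyapExpIn (A : Matrix (Fin d) (Fin d) ℝ) (V : Set (Euc d)) (j : ℕ) : ℝ :=
  sInf {s : ℝ | j + 1 ≤ ellIn A V s}

/-- `λ_{j+1}^{Φ_H}`: the `(j+1)`-st smallest Lyapunov exponent of the restriction
of the flow to the hyperbolic subspace. -/
def lyapExpH (A : Matrix (Fin d) (Fin d) ℝ) (j : ℕ) : ℝ :=
  lyapExpIn A (XH A) j

/-- The flow generated by `A` is stable: every orbit tends to `0` as `t → ∞`. -/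
def IsStable (A : Matrix (Fin d) (Fin d) ℝ) : Prop := ∀ x : Euc d, x ∈ stableSet A

/-- The flow generated by `A` is unstable: every orbit tends to `0` as `t → -∞`. -/
def IsUnstable (A : Matrix (Fin d) (Fin d) ℝ) : Prop := ∀ x : Euc d, x ∈ unstableSet A

/-- The flow generated by `A` is hyperbolic: `X = X_S ⊕ X_U`. -/
def IsHyperbolic (A : Matrix (Fin d) (Fin d) ℝ) : Prop := IsCompl (XS A) (XU A)

/-- `ρ_+(Φ,Ψ) = (min_j λ_j^Φ/λ_j^Ψ) / |max_j λ_j^Φ/λ_j^Ψ|`. -/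
def rhoPlus (A B : Matrix (Fin d) (Fin d) ℝ) : ℝ :=
  (⨅ j : Fin d, lyapExp A j / lyapExp B j) / |⨆ j : Fin d, lyapExp A j / lyapExp B j|

/-- The Lyapunov cross ratio `ρ(Φ,Ψ) = max {ρ_+(Φ,Ψ), ρ_+(Φ*,Ψ)}`, where `Φ*` is the
time-reversal of `Φ`, generated by `-A`. -/
def rho (A B : Matrix (Fin d) (Fin d) ℝ) : ℝ := max (rhoPlus A B) (rhoPlus (-A) B)

/-- The minimal period `T_x^Φ = inf {t > 0 : Φ_t x = x} ∈ [0,∞]` (with `inf ∅ = ∞`). -/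
def minPeriod (A : Matrix (Fin d) (Fin d) ℝ) (x : Euc d) : EReal :=
  sInf {T : EReal | ∃ t : ℝ, 0 < t ∧ linFlow A t x = x ∧ T = (t : EReal)}

/-- The set of complex eigenvalues of the real matrix `A`. -/
def cSpec {n : ℕ} (A : Matrix (Fin n) (Fin n) ℝ) : Set ℂ :=
  spectrum ℂ (A.map Complex.ofReal)

/-- `x` is a fixed point of the flow generated by `A`. -/
def IsFixedPt (A : Matrix (Fin d) (Fin d) ℝ) (x : Euc d) : Prop :=
  ∀ t : ℝ, linFlow A t x = x

/-- The nilpotent `m × m` Jordan block `J_m` (ones on the superdiagonal). -/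
def jordanNil (m : ℕ) : Matrix (Fin m) (Fin m) ℝ :=
  Matrix.of fun i j => if (i : ℕ) + 1 = (j : ℕ) then 1 else 0

def sum2Equiv (m : ℕ) : (Fin m ⊕ Fin m) ≃ Fin (2 * m) :=
  finSumFinEquiv.trans (finCongr (two_mul m).symm)

/-- The real Jordan block `J_m(a+ib) = a I_{2m} + [[J_m, -bI_m],[bI_m, J_m]]`,
as a `2m × 2m` real matrix. -/
def jordanC (m : ℕ) (a b : ℝ) : Matrix (Fin (2 * m)) (Fin (2 * m)) ℝ :=
  Matrix.reindex (sum2Equiv m) (sum2Equiv m)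
    (a • (1 : Matrix (Fin m ⊕ Fin m) (Fin m ⊕ Fin m) ℝ) +
      Matrix.fromBlocks (jordanNil m) (-b • (1 : Matrix (Fin m) (Fin m) ℝ))
        (b • (1 : Matrix (Fin m) (Fin m) ℝ)) (jordanNil m))

section AbstractPart

variable {E : Type*} [NormedAddCommGroup E] [NormedSpace ℝ E]

/-- A norm adapted to a group of operators of subexponential growth. -/
lemma exists_adapted (U : ℝ → E →L[ℝ] E) (hU0 : ∀ x, U 0 x = x)
    (hUadd : ∀ s t x, U (s + t) x = U s (U t x))
    (hg : ∀ ε > (0 : ℝ), ∃ C : ℝ, ∀ t x, ‖U t x‖ ≤ C * Real.exp (ε * |t|) * ‖x‖) :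
    ∃ (N : E → ℝ) (C : ℝ), (∀ x, ‖x‖ ≤ N x) ∧ (∀ x, N x ≤ C * ‖x‖) ∧
      (∀ x y, N (x + y) ≤ N x + N y) ∧ (∀ (c : ℝ) x, N (c • x) = |c| * N x) ∧
      (∀ t x, N (U t x) ≤ Real.exp (|t| / 2) * N x) := by
  obtain ⟨C, hC⟩ := hg (1 / 2) (by norm_num)
  have hb : ∀ x t, Real.exp (-(|t| / 2)) * ‖U t x‖ ≤ C * ‖x‖ := by
    intro x t
    calc Real.exp (-(|t| / 2)) * ‖U t x‖
        ≤ Real.exp (-(|t| / 2)) * (C * Real.exp (1 / 2 * |t|) * ‖x‖) := by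
          gcongr; exact hC t x
      _ = (Real.exp (-(|t| / 2)) * Real.exp (1 / 2 * |t|)) * (C * ‖x‖) := by ring
      _ = C * ‖x‖ := by
          rw [← Real.exp_add, show -(|t| / 2) + 1 / 2 * |t| = 0 by ring, Real.exp_zero, one_mul]
  have hbdd : ∀ x, BddAbove (Set.range fun t : ℝ => Real.exp (-(|t| / 2)) * ‖U t x‖) := by
    intro x
    refine ⟨C * ‖x‖, ?_⟩
    rintro _ ⟨t, rfl⟩
    exact hb x t
  have hle : ∀ x t, Real.exp (-(|t| / 2)) * ‖U t x‖ ≤ ⨆ t : ℝ, Real.exp (-(|t| / 2)) * ‖U t x‖ :=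
    fun x t => le_ciSup (hbdd x) t
  refine ⟨fun x => ⨆ t : ℝ, Real.exp (-(|t| / 2)) * ‖U t x‖, C, ?_, ?_, ?_, ?_, ?_⟩
  · intro x
    have := hle x 0
    simpa [hU0] using this
  · intro x
    exact ciSup_le (hb x)
  · intro x y
    refine ciSup_le fun t => ?_
    calc Real.exp (-(|t| / 2)) * ‖U t (x + y)‖
        ≤ Real.exp (-(|t| / 2)) * (‖U t x‖ + ‖U t y‖) := by
          gcongr; rw [map_add]; exact norm_add_le _ _
      _ = Real.exp (-(|t| / 2)) * ‖U t x‖ + Real.exp (-(|t| / 2)) * ‖U t y‖ := by ring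
      _ ≤ _ := add_le_add (hle x t) (hle y t)
  · intro c x
    simp only []
    rw [Real.mul_iSup_of_nonneg (abs_nonneg c)]
    congr 1
    funext t
    rw [map_smul, norm_smul, Real.norm_eq_abs]
    ring
  · intro t x
    refine ciSup_le fun u => ?_
    rw [← hUadd]
    have h1 := hle x (u + t)
    have h2 : |u + t| ≤ |u| + |t| := abs_add_le u t
    calc Real.exp (-(|u| / 2)) * ‖U (u + t) x‖
        ≤ (Real.exp (|t| / 2) * Real.exp (-(|u + t| / 2))) * ‖U (u + t) x‖ := by
          rw [← Real.exp_add]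
          gcongr
          linarith
      _ = Real.exp (|t| / 2) * (Real.exp (-(|u + t| / 2)) * ‖U (u + t) x‖) := by ring
      _ ≤ _ := by gcongr

/-- Quantitative continuity of the group in the adapted norm. -/
lemma key_lip (U : ℝ → E →L[ℝ] E) (N : E → ℝ) (C : ℝ)
    (hN1 : ∀ x, ‖x‖ ≤ N x) (hN2 : ∀ x, N x ≤ C * ‖x‖)
    (hadd : ∀ x y, N (x + y) ≤ N x + N y) (hsm : ∀ (c : ℝ) x, N (c • x) = |c| * N x)
    (hNU : ∀ t x, N (U t x) ≤ Real.exp (|t| / 2) * N x)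
    (hC : 0 ≤ C)
    (hl : ∃ K δ : ℝ, 0 < δ ∧ 0 ≤ K ∧ ∀ t x, |t| ≤ δ → ‖U t x - x‖ ≤ K * |t| * ‖x‖) :
    ∃ K : ℝ, 0 ≤ K ∧ ∀ θ y, 0 ≤ θ →
      N (U (-θ) y - y) ≤ K * (1 - Real.exp (-(θ / 2))) * Real.exp θ * N y := by
  obtain ⟨K0, δ0, hδ0, hK0, hl⟩ := hl
  obtain ⟨δ, hδ, hδle, hδ1⟩ : ∃ δ : ℝ, 0 < δ ∧ δ ≤ δ0 ∧ δ ≤ 1 :=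
    ⟨min δ0 1, by positivity, min_le_left _ _, min_le_right _ _⟩
  have hc : 0 < 1 - Real.exp (-(δ / 2)) := by
    have : Real.exp (-(δ / 2)) < 1 := Real.exp_lt_one_iff.mpr (by linarith)
    linarith
  have hNnn : ∀ x, 0 ≤ N x := fun x => (norm_nonneg x).trans (hN1 x)
  refine ⟨4 * C * K0 + 2 / (1 - Real.exp (-(δ / 2))), by positivity, ?_⟩
  intro θ y hθ
  have hy := hNnn y
  have hexp1 : 1 ≤ Real.exp θ := Real.one_le_exp hθ
  have hom : 0 ≤ 1 - Real.exp (-(θ / 2)) := by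
    have : Real.exp (-(θ / 2)) ≤ 1 := Real.exp_le_one_iff.mpr (by linarith)
    linarith
  rcases le_total θ δ with h | h
  · have h1 : N (U (-θ) y - y) ≤ C * (K0 * θ * N y) := by
      refine (hN2 _).trans ?_
      have := hl (-θ) y (by rw [abs_neg, abs_of_nonneg hθ]; linarith)
      rw [abs_neg, abs_of_nonneg hθ] at this
      refine mul_le_mul_of_nonneg_left (this.trans ?_) hC
      exact mul_le_mul_of_nonneg_left (hN1 y) (by positivity)
    have h2 : θ ≤ 4 * (1 - Real.exp (-(θ / 2))) := by
      have h3 : θ / 2 + 1 ≤ Real.exp (θ / 2) := Real.add_one_le_exp _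
      have h4 : Real.exp (-(θ / 2)) * Real.exp (θ / 2) = 1 := by
        rw [← Real.exp_add]; simp
      have h5 := Real.exp_pos (-(θ / 2))
      have h6 : Real.exp (-(θ / 2)) * (θ / 2 + 1) ≤ 1 := by
        exact (mul_le_mul_of_nonneg_left h3 h5.le).trans h4.le
      nlinarith
    calc N (U (-θ) y - y) ≤ C * (K0 * θ * N y) := h1
      _ ≤ C * (K0 * (4 * (1 - Real.exp (-(θ / 2)))) * N y) := by gcongr
      _ = (4 * C * K0) * (1 - Real.exp (-(θ / 2))) * 1 * N y := by ring
      _ ≤ _ := by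
        gcongr
        have : 0 ≤ 2 / (1 - Real.exp (-(δ / 2))) := by positivity
        linarith
  · have h1 : N (U (-θ) y - y) ≤ 2 * Real.exp θ * N y := by
      have e1 : U (-θ) y - y = U (-θ) y + (-1 : ℝ) • y := by simp [sub_eq_add_neg]
      rw [e1]
      refine (hadd _ _).trans ?_
      rw [hsm]
      have := hNU (-θ) y
      rw [abs_neg, abs_of_nonneg hθ] at this
      have h3 : Real.exp (θ / 2) ≤ Real.exp θ := Real.exp_le_exp.mpr (by linarith)
      have h4 : Real.exp (θ / 2) * N y ≤ Real.exp θ * N y := by gcongr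
      have h5 : 1 * N y ≤ Real.exp θ * N y := by gcongr
      norm_num
      linarith
    have h2 : 2 ≤ 2 / (1 - Real.exp (-(δ / 2))) * (1 - Real.exp (-(θ / 2))) := by
      rw [div_mul_eq_mul_div, le_div_iff₀ hc]
      have : Real.exp (-(θ / 2)) ≤ Real.exp (-(δ / 2)) := Real.exp_le_exp.mpr (by linarith)
      linarith
    refine h1.trans ?_
    gcongr
    refine h2.trans ?_
    gcongr
    have : 0 ≤ 4 * C * K0 := by positivity
    linarith

lemma core_est (U : ℝ → E →L[ℝ] E) (hU0 : ∀ x, U 0 x = x)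
    (hUadd : ∀ s t x, U (s + t) x = U s (U t x)) (N : E → ℝ)
    (hN1 : ∀ x, ‖x‖ ≤ N x) (hN0 : N 0 = 0)
    (hadd : ∀ x y, N (x + y) ≤ N x + N y) (hsm : ∀ (c : ℝ) x, N (c • x) = |c| * N x)
    (hNU : ∀ t x, N (U t x) ≤ Real.exp (|t| / 2) * N x)
    (K : ℝ) (hK : 0 ≤ K) (hkey : ∀ θ y, 0 ≤ θ →
      N (U (-θ) y - y) ≤ K * (1 - Real.exp (-(θ / 2))) * Real.exp θ * N y)
    (y y' : E) (hy : y ≠ 0) (hyy : N y' ≤ N y) :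
    ∃ w, U (Real.log (N y)) y - U (Real.log (N y')) y' = U (Real.log (N y)) w ∧
      N w ≤ (1 + K) * N (y - y') ∧ N (y - y') ≤ (1 + K) * N w := by
  have hNnn : ∀ x, 0 ≤ N x := fun x => (norm_nonneg x).trans (hN1 x)
  have hpos : ∀ x, x ≠ 0 → 0 < N x := fun x hx => (norm_pos_iff.mpr hx).trans_le (hN1 x)
  by_cases h0 : y' = 0
  · subst h0
    refine ⟨y, by simp, ?_, ?_⟩ <;> · rw [sub_zero]; nlinarith [hNnn y]
  have hs := Real.exp_log (hpos y hy)
  have hs' := Real.exp_log (hpos y' h0)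
  have hss : Real.log (N y') ≤ Real.log (N y) := Real.log_le_log (hpos y' h0) hyy
  set s := Real.log (N y)
  set s' := Real.log (N y')
  obtain ⟨θ, hθ⟩ : ∃ θ, θ = s - s' := ⟨_, rfl⟩
  have hθ0 : 0 ≤ θ := by linarith
  have hsub : ∀ a b, N (a - b) ≤ N a + N b := by
    intro a b
    have e1 : a - b = a + (-1 : ℝ) • b := by simp [sub_eq_add_neg]
    rw [e1]
    refine (hadd _ _).trans ?_
    rw [hsm]; norm_num
  have htri : ∀ a b, N a - N b ≤ N (a - b) := by
    intro a b
    have := hadd (a - b) b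
    rw [sub_add_cancel] at this
    linarith
  have hP : N (U (-θ) y' - y') ≤ K * ((1 - Real.exp (-(θ / 2))) * Real.exp s) := by
    refine (hkey θ y' hθ0).trans (le_of_eq ?_)
    rw [← hs', show s = θ + s' by linarith, Real.exp_add]
    ring
  refine ⟨y - U (-θ) y', ?_, ?_, ?_⟩
  · rw [map_sub, ← hUadd]
    congr 3
    linarith
  · have e : y - U (-θ) y' = (y - y') - (U (-θ) y' - y') := by abel
    rw [e]
    refine (hsub _ _).trans ?_
    have h1 : (1 - Real.exp (-(θ / 2))) * Real.exp s ≤ N (y - y') := by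
      refine le_trans ?_ (htri y y')
      have h2 : Real.exp (-θ) * Real.exp s = Real.exp s' := by
        rw [← Real.exp_add]; congr 1; linarith
      have h3 : Real.exp (-θ) ≤ Real.exp (-(θ / 2)) := Real.exp_le_exp.mpr (by linarith)
      have h4 := Real.exp_pos s
      rw [← hs, ← hs', ← h2]
      nlinarith
    have h2 := mul_le_mul_of_nonneg_left h1 hK
    linarith
  · have e : y - y' = (y - U (-θ) y') + (U (-θ) y' - y') := by abel
    rw [e]
    refine (hadd _ _).trans ?_
    have h1 : (1 - Real.exp (-(θ / 2))) * Real.exp s ≤ N (y - U (-θ) y') := by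
      refine le_trans ?_ (htri y _)
      have h2 := hNU (-θ) y'
      rw [abs_neg, abs_of_nonneg hθ0, ← hs', ← Real.exp_add] at h2
      have h3 : Real.exp (-(θ / 2)) * Real.exp s = Real.exp (θ / 2 + s') := by
        rw [← Real.exp_add]; congr 1; linarith
      rw [← hs]
      linarith
    have h2 := mul_le_mul_of_nonneg_left h1 hK
    linarith

lemma real_est1 {δ r X C ε : ℝ} (hδ : 0 < δ) (hδr : δ ≤ 2 * r) (hε : 0 < ε) (hC : 0 ≤ C)
    (h : X ≤ C * r ^ (-ε) * δ) : X ≤ C * 2 ^ ε * δ ^ (1 - ε) := by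
  have hr : 0 < r := by linarith
  refine h.trans ?_
  have h1 : r ^ (-ε) ≤ 2 ^ ε * δ ^ (-ε) := by
    have h2 : (δ / 2) ^ ε ≤ r ^ ε := Real.rpow_le_rpow (by positivity) (by linarith) hε.le
    rw [Real.rpow_neg hr.le, Real.rpow_neg hδ.le]
    rw [Real.div_rpow hδ.le (by norm_num)] at h2
    rw [← div_eq_mul_inv, ← inv_div]
    exact inv_anti₀ (by positivity) h2
  calc C * r ^ (-ε) * δ ≤ C * (2 ^ ε * δ ^ (-ε)) * δ := by gcongr
    _ = C * 2 ^ ε * (δ ^ (-ε) * δ ^ (1 : ℝ)) := by rw [Real.rpow_one]; ring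
    _ = _ := by rw [← Real.rpow_add hδ]; congr 2; ring

lemma real_est2 {δ r X C ε γ : ℝ} (hδ : 0 < δ) (hδr : δ ≤ 2 * r) (hε : 0 < ε) (hC : 0 ≤ C)
    (hX : 0 ≤ X) (hγ : 0 < γ) (hγε : (1 + ε) * γ = 1)
    (h : δ ≤ C * r ^ (-ε) * X) : δ ≤ (C * 2 ^ ε) ^ γ * X ^ γ := by
  have hr : 0 < r := by linarith
  have h1 : δ ^ (1 + ε) ≤ C * 2 ^ ε * X := by
    have h2 : δ ^ ε ≤ 2 ^ ε * r ^ ε := by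
      rw [← Real.mul_rpow (by norm_num) hr.le]
      exact Real.rpow_le_rpow hδ.le hδr hε.le
    rw [Real.rpow_add hδ, Real.rpow_one]
    calc δ * δ ^ ε ≤ (C * r ^ (-ε) * X) * (2 ^ ε * r ^ ε) := by gcongr
      _ = C * 2 ^ ε * X * (r ^ (-ε) * r ^ ε) := by ring
      _ = _ := by rw [← Real.rpow_add hr]; simp
  calc δ = (δ ^ (1 + ε)) ^ γ := by rw [← Real.rpow_mul hδ.le, hγε, Real.rpow_one]
    _ ≤ (C * 2 ^ ε * X) ^ γ := Real.rpow_le_rpow (by positivity) h1 hγ.le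
    _ = _ := Real.mul_rpow (by positivity) hX

lemma exp_abs_log_le {r R ε : ℝ} (hr : 0 < r) (hrR : r ≤ R) (hR : 1 ≤ R) (hε : 0 < ε) :
    Real.exp (ε * |Real.log r|) ≤ Real.exp (ε * (2 * Real.log R)) * r ^ (-ε) := by
  rw [Real.rpow_def_of_pos hr, ← Real.exp_add]
  apply Real.exp_le_exp.mpr
  have h1 : Real.log r ≤ Real.log R := Real.log_le_log hr hrR
  have h2 : 0 ≤ Real.log R := Real.log_nonneg hR
  have h3 : |Real.log r| ≤ 2 * Real.log R - Real.log r := by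
    rw [abs_le]; constructor <;> linarith
  nlinarith

lemma holder_est (U : ℝ → E →L[ℝ] E) (hU0 : ∀ x, U 0 x = x)
    (hUadd : ∀ s t x, U (s + t) x = U s (U t x))
    (hg : ∀ ε > (0 : ℝ), ∃ C : ℝ, ∀ t x, ‖U t x‖ ≤ C * Real.exp (ε * |t|) * ‖x‖)
    (N : E → ℝ) (C : ℝ) (hC : 0 ≤ C)
    (hN1 : ∀ x, ‖x‖ ≤ N x) (hN2 : ∀ x, N x ≤ C * ‖x‖)
    (hadd : ∀ x y, N (x + y) ≤ N x + N y) (hsm : ∀ (c : ℝ) x, N (c • x) = |c| * N x)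
    (K : ℝ) (hK : 0 ≤ K)
    (hcore : ∀ y y' : E, y ≠ 0 → N y' ≤ N y →
      ∃ w, U (Real.log (N y)) y - U (Real.log (N y')) y' = U (Real.log (N y)) w ∧
      N w ≤ (1 + K) * N (y - y') ∧ N (y - y') ≤ (1 + K) * N w)
    (γ : ℝ) (hγ0 : 0 < γ) (hγ1 : γ < 1) (R : ℝ) (hR : 1 ≤ R) :
    ∃ L : ℝ, 0 ≤ L ∧ ∀ y y' : E, N y ≤ R → N y' ≤ R →
      ‖U (Real.log (N y)) y - U (Real.log (N y')) y'‖ ≤ L * ‖y - y'‖ ^ γ ∧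
      ‖y - y'‖ ≤ L * ‖U (Real.log (N y)) y - U (Real.log (N y')) y'‖ ^ γ := by
  have hNnn : ∀ x, 0 ≤ N x := fun x => (norm_nonneg x).trans (hN1 x)
  have hpos : ∀ x, x ≠ 0 → 0 < N x := fun x hx => (norm_pos_iff.mpr hx).trans_le (hN1 x)
  have hN0 : N 0 = 0 := by
    have := hsm 0 0
    simpa using this
  have hsub : ∀ a b, N (a - b) ≤ N a + N b := by
    intro a b
    have e1 : a - b = a + (-1 : ℝ) • b := by simp [sub_eq_add_neg]
    rw [e1]
    refine (hadd _ _).trans ?_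
    rw [hsm]; norm_num
  have hg' : ∀ ε > (0 : ℝ), ∃ C : ℝ, 0 ≤ C ∧ ∀ t x, ‖U t x‖ ≤ C * Real.exp (ε * |t|) * ‖x‖ := by
    intro ε hε
    obtain ⟨C, hC⟩ := hg ε hε
    refine ⟨|C|, abs_nonneg _, fun t x => (hC t x).trans ?_⟩
    gcongr
    exact le_abs_self C
  obtain ⟨C1, hC1, hg1⟩ := hg' (1 - γ) (by linarith)
  have hε2 : 0 < 1 / γ - 1 := by
    have : 1 < 1 / γ := by rw [lt_div_iff₀ hγ0]; linarith
    linarith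
  obtain ⟨C2, hC2, hg2⟩ := hg' (1 / γ - 1) hε2
  obtain ⟨ε2, hε2e⟩ : ∃ ε2, ε2 = 1 / γ - 1 := ⟨_, rfl⟩
  rw [← hε2e] at hε2 hg2
  have hγε : (1 + ε2) * γ = 1 := by rw [hε2e]; field_simp; ring
  obtain ⟨ε1, hε1e⟩ : ∃ ε1, ε1 = 1 - γ := ⟨_, rfl⟩
  rw [← hε1e] at hg1
  have hε1 : 0 < ε1 := by linarith
  obtain ⟨D1, hD1⟩ : ∃ D, D = Real.exp (ε1 * (2 * Real.log R)) := ⟨_, rfl⟩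
  obtain ⟨D2, hD2⟩ : ∃ D, D = Real.exp (ε2 * (2 * Real.log R)) := ⟨_, rfl⟩
  have hD1p : 0 < D1 := hD1 ▸ Real.exp_pos _
  have hD2p : 0 < D2 := hD2 ▸ Real.exp_pos _
  obtain ⟨L1, hL1⟩ : ∃ L, L = C1 * D1 * (1 + K) * 2 ^ ε1 * C ^ γ := ⟨_, rfl⟩
  obtain ⟨L2, hL2⟩ : ∃ L, L = ((1 + K) * C * C2 * D2 * 2 ^ ε2) ^ γ := ⟨_, rfl⟩
  have hL1p : 0 ≤ L1 := by rw [hL1]; positivity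
  have hL2p : 0 ≤ L2 := by rw [hL2]; positivity
  have main : ∀ y y' : E, N y ≤ R → N y' ≤ N y →
      ‖U (Real.log (N y)) y - U (Real.log (N y')) y'‖ ≤ (L1 + L2) * ‖y - y'‖ ^ γ ∧
      ‖y - y'‖ ≤ (L1 + L2) * ‖U (Real.log (N y)) y - U (Real.log (N y')) y'‖ ^ γ := by
    intro y y' hyR hyy
    by_cases heq : y = y'
    · subst heq
      simp [Real.zero_rpow hγ0.ne']
    have hy : y ≠ 0 := by
      rintro rfl
      apply heq
      by_contra h
      have := hpos y' (fun h' => h h'.symm)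
      linarith
    obtain ⟨w, hw, hw1, hw2⟩ := hcore y y' hy hyy
    rw [hw]
    have hr := hpos y hy
    have hδ : 0 < N (y - y') := hpos _ (sub_ne_zero.mpr heq)
    have hδr : N (y - y') ≤ 2 * N y := by
      have := hsub y y'
      linarith
    constructor
    · have h1 : ‖U (Real.log (N y)) w‖ ≤ C1 * D1 * (1 + K) * (N y) ^ (-ε1) * N (y - y') := by
        calc ‖U (Real.log (N y)) w‖ ≤ C1 * Real.exp (ε1 * |Real.log (N y)|) * ‖w‖ := hg1 _ _
          _ ≤ C1 * (D1 * N y ^ (-ε1)) * ((1 + K) * N (y - y')) := by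
            have e1 := exp_abs_log_le hr hyR hR hε1
            rw [← hD1] at e1
            have e2 := (hN1 w).trans hw1
            gcongr
          _ = _ := by ring
      have h2 := real_est1 hδ hδr hε1 (by positivity) h1
      rw [show 1 - ε1 = γ by linarith] at h2
      refine h2.trans ?_
      have h3 : N (y - y') ^ γ ≤ C ^ γ * ‖y - y'‖ ^ γ := by
        rw [← Real.mul_rpow hC (norm_nonneg _)]
        exact Real.rpow_le_rpow hδ.le (hN2 _) hγ0.le
      calc C1 * D1 * (1 + K) * 2 ^ ε1 * N (y - y') ^ γ
          ≤ C1 * D1 * (1 + K) * 2 ^ ε1 * (C ^ γ * ‖y - y'‖ ^ γ) := by gcongr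
        _ = L1 * ‖y - y'‖ ^ γ := by rw [hL1]; ring
        _ ≤ _ := by gcongr; linarith
    · set X := U (Real.log (N y)) w
      have hwX : w = U (-Real.log (N y)) X := by
        rw [← hUadd, neg_add_cancel, hU0]
      have h1 : N (y - y') ≤ (1 + K) * C * C2 * D2 * (N y) ^ (-ε2) * ‖X‖ := by
        calc N (y - y') ≤ (1 + K) * N w := hw2
          _ ≤ (1 + K) * (C * ‖w‖) := by gcongr; exact hN2 w
          _ ≤ (1 + K) * (C * (C2 * Real.exp (ε2 * |Real.log (N y)|) * ‖X‖)) := by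
            have := hg2 (-Real.log (N y)) X
            rw [← hwX, abs_neg] at this
            gcongr
          _ ≤ (1 + K) * (C * (C2 * (D2 * N y ^ (-ε2)) * ‖X‖)) := by
            have e1 := exp_abs_log_le hr hyR hR hε2
            rw [← hD2] at e1
            gcongr
          _ = _ := by ring
      have h2 := real_est2 hδ hδr hε2 (by positivity) (norm_nonneg _) hγ0 hγε h1
      rw [← hL2] at h2
      refine (hN1 _).trans (h2.trans ?_)
      gcongr
      linarith
  refine ⟨L1 + L2, by positivity, ?_⟩
  intro y y' hy hy'
  rcases le_total (N y') (N y) with h | h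
  · exact main y y' hy h
  · rw [norm_sub_rev y y', norm_sub_rev (U (Real.log (N y)) y)]
    exact main y' y hy' h

lemma continuous_of_holder (f : E → E)
    (h : ∀ R : ℝ, ∃ L : ℝ, ∀ x y : E, ‖x‖ ≤ R → ‖y‖ ≤ R →
      ‖f x - f y‖ ≤ L * ‖x - y‖ ^ (1 / 2 : ℝ)) : Continuous f := by
  rw [continuous_iff_continuousAt]
  intro x
  obtain ⟨L, hL⟩ := h (‖x‖ + 1)
  rw [ContinuousAt, tendsto_iff_norm_sub_tendsto_zero]
  have h1 : Tendsto (fun y : E => L * ‖y - x‖ ^ (1 / 2 : ℝ)) (𝓝 x) (𝓝 0) := by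
    have hc : Continuous (fun y : E => L * ‖y - x‖ ^ (1 / 2 : ℝ)) :=
      continuous_const.mul ((continuous_id.sub continuous_const).norm.rpow_const
        (fun _ => Or.inr (by norm_num)))
    have := hc.tendsto x
    simpa using this
  refine squeeze_zero' (Eventually.of_forall fun _ => norm_nonneg _) ?_ h1
  filter_upwards [Metric.ball_mem_nhds x one_pos] with y hy
  refine hL y x ?_ (by linarith)
  rw [Metric.mem_ball, dist_eq_norm] at hy
  have := norm_add_le (y - x) x
  rw [sub_add_cancel] at this
  linarith

theorem abstract_main (U : ℝ → E →L[ℝ] E) (hU0 : ∀ x, U 0 x = x)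
    (hUadd : ∀ s t x, U (s + t) x = U s (U t x))
    (hUc : ∀ x, Continuous fun t => U t x)
    (hg : ∀ ε > (0 : ℝ), ∃ C : ℝ, ∀ t x, ‖U t x‖ ≤ C * Real.exp (ε * |t|) * ‖x‖)
    (hl : ∃ K δ : ℝ, 0 < δ ∧ 0 ≤ K ∧ ∀ t x, |t| ≤ δ → ‖U t x - x‖ ≤ K * |t| * ‖x‖) :
    ∃ h : E ≃ₜ E, h 0 = 0 ∧
      (∀ γ : ℝ, 0 < γ → γ < 1 → ∃ L : ℝ, ∀ x y : E, ‖x‖ ≤ 1 → ‖y‖ ≤ 1 →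
        ‖h x - h y‖ ≤ L * ‖x - y‖ ^ γ ∧ ‖h.symm x - h.symm y‖ ≤ L * ‖x - y‖ ^ γ) ∧
      ∀ t x, h (Real.exp t • U t x) = Real.exp t • h x := by
  obtain ⟨N, C0, hN1, hN2', hadd, hsm, hNU⟩ := exists_adapted U hU0 hUadd hg
  obtain ⟨C, hC, hN2⟩ : ∃ C : ℝ, 0 ≤ C ∧ ∀ x, N x ≤ C * ‖x‖ :=
    ⟨|C0|, abs_nonneg _, fun x => (hN2' x).trans (by gcongr; exact le_abs_self _)⟩
  obtain ⟨K, hK, hkey⟩ := key_lip U N C hN1 hN2 hadd hsm hNU hC hl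
  have hN0 : N 0 = 0 := by
    have := hsm 0 0
    simpa using this
  have hcore := core_est U hU0 hUadd N hN1 hN0 hadd hsm hNU K hK hkey
  have hH := holder_est U hU0 hUadd hg N C hC hN1 hN2 hadd hsm K hK hcore
  have hNnn : ∀ x, 0 ≤ N x := fun x => (norm_nonneg x).trans (hN1 x)
  have hpos : ∀ x, x ≠ 0 → 0 < N x := fun x hx => (norm_pos_iff.mpr hx).trans_le (hN1 x)
  have hNc : Continuous N := by
    have hL : ∀ x y, |N x - N y| ≤ C * ‖x - y‖ := by
      intro x y
      have h1 := hadd (x - y) y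
      have h2 := hadd (y - x) x
      have h3 := hN2 (x - y)
      have h4 := hN2 (y - x)
      rw [sub_add_cancel] at h1 h2
      rw [norm_sub_rev y x] at h4
      rw [abs_le]; constructor <;> linarith
    refine (LipschitzWith.of_dist_le_mul (K := ⟨C, hC⟩) fun x y => ?_).continuous
    rw [Real.dist_eq, dist_eq_norm]
    exact hL x y
  set g : E → E := fun y => U (Real.log (N y)) y with hgdef
  have hinv : ∀ t x, U (-t) (U t x) = x := fun t x => by rw [← hUadd, neg_add_cancel, hU0]
  have hinv' : ∀ t x, U t (U (-t) x) = x := fun t x => by rw [← hUadd, add_neg_cancel, hU0]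
  have hg0 : g 0 = 0 := by simp [hgdef]
  -- bound for the preimage
  have hbd : ∀ y, N y ≤ max 1 (N (g y) ^ 2) := by
    intro y
    by_cases hy1 : N y ≤ 1
    · exact le_max_of_le_left hy1
    push Not at hy1
    refine le_max_of_le_right ?_
    have hs0 : 0 ≤ Real.log (N y) := Real.log_nonneg hy1.le
    have hs := Real.exp_log (zero_lt_one.trans hy1)
    have h1 := hNU (-Real.log (N y)) (g y)
    rw [hgdef] at h1
    simp only [] at h1
    rw [hinv, abs_neg, abs_of_nonneg hs0] at h1
    change N y ≤ _ * N (g y) at h1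
    set e := Real.exp (Real.log (N y) / 2) with he
    have hee : e * e = N y := by
      rw [he, ← Real.exp_add, add_halves, hs]
    have hep : 0 < e := Real.exp_pos _
    have h2 : e ≤ N (g y) := by
      rw [← hee] at h1
      exact le_of_mul_le_mul_left h1 hep
    nlinarith
  have hequi : ∀ t y, g (Real.exp t • y) = Real.exp t • U t (g y) := by
    intro t y
    by_cases hy : y = 0
    · subst hy; simp [hgdef]
    simp only [hgdef]
    rw [hsm, abs_of_pos (Real.exp_pos t), Real.log_mul (Real.exp_pos t).ne' (hpos y hy).ne',
      Real.log_exp, map_smul, hUadd]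
  have hinj : Function.Injective g := by
    intro y y' hyy
    obtain ⟨L, -, hL⟩ := hH (1 / 2) (by norm_num) (by norm_num)
      (max 1 (max (N y) (N y'))) (le_max_left _ _)
    have h1 := (hL y y' ((le_max_left _ _).trans (le_max_right _ _))
      ((le_max_right _ _).trans (le_max_right _ _))).2
    change _ ≤ L * ‖g y - g y'‖ ^ _ at h1
    rw [hyy, sub_self, norm_zero, Real.zero_rpow (by norm_num), mul_zero] at h1
    exact sub_eq_zero.mp (norm_le_zero_iff.mp h1)
  have hsurj : Function.Surjective g := by
    intro x
    by_cases hx : x = 0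
    · exact ⟨0, by rw [hg0, hx]⟩
    have hxp := hpos x hx
    let f : ℝ → ℝ := fun s => Real.exp (-s) * N (U (-s) x)
    have hf : Continuous f :=
      (Real.continuous_exp.comp continuous_neg).mul
        (hNc.comp ((hUc x).comp continuous_neg))
    obtain ⟨T, hT⟩ : ∃ T, T = 2 * |Real.log (N x)| := ⟨_, rfl⟩
    have hT0 : 0 ≤ T := by rw [hT]; positivity
    have hlx := Real.exp_log hxp
    have hup : f T ≤ 1 := by
      have h1 := hNU (-T) x
      rw [abs_neg, abs_of_nonneg hT0] at h1
      calc f T ≤ Real.exp (-T) * (Real.exp (T / 2) * N x) := by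
            simp only [f]; gcongr
        _ = Real.exp (-T + T / 2 + Real.log (N x)) := by
            rw [Real.exp_add, Real.exp_add, hlx]; ring
        _ ≤ 1 := Real.exp_le_one_iff.mpr (by
            have := le_abs_self (Real.log (N x))
            linarith)
    have hdown : 1 ≤ f (-T) := by
      have h1 := hNU (-T) (U T x)
      rw [hinv, abs_neg, abs_of_nonneg hT0] at h1
      have h2 : Real.exp (-(T / 2)) * N x ≤ N (U T x) := by
        rw [Real.exp_neg, inv_mul_le_iff₀ (Real.exp_pos _)]
        exact h1
      calc (1 : ℝ) ≤ Real.exp (T + -(T / 2) + Real.log (N x)) := Real.one_le_exp (by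
            have := neg_abs_le (Real.log (N x))
            linarith)
        _ = Real.exp T * (Real.exp (-(T / 2)) * N x) := by
            rw [Real.exp_add, Real.exp_add, hlx]; ring
        _ ≤ Real.exp T * N (U T x) := by gcongr
        _ = f (-T) := by simp only [f, neg_neg]
    obtain ⟨s, -, hs⟩ : (1 : ℝ) ∈ f '' Set.Icc (-T) T :=
      intermediate_value_Icc' (by linarith) hf.continuousOn ⟨hup, hdown⟩
    have hNs : N (U (-s) x) = Real.exp s := by
      simp only [f] at hs
      rw [Real.exp_neg, inv_mul_eq_one₀ (Real.exp_pos _).ne'] at hs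
      exact hs.symm
    refine ⟨U (-s) x, ?_⟩
    simp only [hgdef]
    rw [hNs, Real.log_exp, hinv']
  let e : E ≃ E := Equiv.ofBijective g ⟨hinj, hsurj⟩
  have heg : ∀ y, e y = g y := fun y => rfl
  have hge : ∀ x, g (e.symm x) = x := fun x => e.apply_symm_apply x
  have hHg : ∀ γ : ℝ, 0 < γ → γ < 1 → ∀ R : ℝ, ∃ L : ℝ, ∀ x y : E, ‖x‖ ≤ R → ‖y‖ ≤ R →
      ‖g x - g y‖ ≤ L * ‖x - y‖ ^ γ ∧ ‖e.symm x - e.symm y‖ ≤ L * ‖x - y‖ ^ γ := by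
    intro γ h0 h1 R
    obtain ⟨L1, hL1p, hL1⟩ := hH γ h0 h1 (max 1 (C * R)) (le_max_left _ _)
    obtain ⟨L2, hL2p, hL2⟩ := hH γ h0 h1 (max 1 ((C * R) ^ 2)) (le_max_left _ _)
    have hN2R : ∀ x, ‖x‖ ≤ R → N x ≤ C * R := fun x hx => (hN2 x).trans (by gcongr)
    have hb1 : ∀ x, ‖x‖ ≤ R → N x ≤ max 1 (C * R) := fun x hx => le_max_of_le_right (hN2R x hx)
    have hb2 : ∀ x, ‖x‖ ≤ R → N (e.symm x) ≤ max 1 ((C * R) ^ 2) := by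
      intro x hx
      refine (hbd (e.symm x)).trans ?_
      rw [hge]
      exact max_le_max le_rfl (pow_le_pow_left₀ (hNnn x) (hN2R x hx) 2)
    refine ⟨L1 + L2, fun x y hx hy => ⟨?_, ?_⟩⟩
    · refine ((hL1 x y (hb1 x hx) (hb1 y hy)).1).trans ?_
      gcongr; linarith
    · have h3 := (hL2 (e.symm x) (e.symm y) (hb2 x hx) (hb2 y hy)).2
      change _ ≤ L2 * ‖g (e.symm x) - g (e.symm y)‖ ^ γ at h3
      rw [hge, hge] at h3
      refine h3.trans ?_
      gcongr; linarith
  have hcg : Continuous g := continuous_of_holder g fun R => by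
    obtain ⟨L, hL⟩ := hHg (1 / 2) (by norm_num) (by norm_num) R
    exact ⟨L, fun x y hx hy => (hL x y hx hy).1⟩
  have hce : Continuous e.symm := continuous_of_holder _ fun R => by
    obtain ⟨L, hL⟩ := hHg (1 / 2) (by norm_num) (by norm_num) R
    exact ⟨L, fun x y hx hy => (hL x y hx hy).2⟩
  let H : E ≃ₜ E := ⟨e, hcg, hce⟩
  refine ⟨H.symm, ?_, ?_, ?_⟩
  · change e.symm 0 = 0
    rw [Equiv.symm_apply_eq, heg, hg0]
  · intro γ h0 h1
    obtain ⟨L, hL⟩ := hHg γ h0 h1 1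
    exact ⟨L, fun x y hx hy => ⟨(hL x y hx hy).2, (hL x y hx hy).1⟩⟩
  · intro t x
    change e.symm _ = Real.exp t • e.symm x
    rw [Equiv.symm_apply_eq, heg, hequi, hge]

end AbstractPart

section MatrixPart

open scoped Matrix.Norms.L2Operator Matrix

lemma jordanNil_pow (m k : ℕ) (i j : Fin m) (h : (j : ℕ) < i + k) : (jordanNil m ^ k) i j = 0 := by
  induction k generalizing i j with
  | zero =>
    rw [pow_zero, Matrix.one_apply_ne]
    rintro rfl
    omega
  | succ k ih =>
    rw [pow_succ, Matrix.mul_apply]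
    refine Finset.sum_eq_zero fun l _ => ?_
    by_cases hl : (l : ℕ) < i + k
    · rw [ih i l hl, zero_mul]
    · have : jordanNil m l j = 0 := by
        simp only [jordanNil, Matrix.of_apply]
        rw [if_neg]
        omega
      rw [this, mul_zero]

lemma jordanNil_nilp (m : ℕ) : jordanNil m ^ m = 0 := by
  ext i j
  rw [jordanNil_pow m m i j (by omega)]
  rfl

/-- The decomposition of the Jordan block. -/
lemma jordanC_decomp (m : ℕ) (a b : ℝ) :
    ∃ S Nn : Matrix (Fin (2 * m)) (Fin (2 * m)) ℝ,
      jordanC m a b = a • (1 : Matrix (Fin (2 * m)) (Fin (2 * m)) ℝ) + (S + Nn) ∧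
      Commute S Nn ∧ Sᴴ = -S ∧ ∃ k, Nn ^ k = 0 := by
  let e := Matrix.reindexAlgEquiv ℝ ℝ (sum2Equiv m)
  let S0 : Matrix (Fin m ⊕ Fin m) (Fin m ⊕ Fin m) ℝ :=
    Matrix.fromBlocks 0 (-b • (1 : Matrix (Fin m) (Fin m) ℝ)) (b • 1) 0
  let N0 : Matrix (Fin m ⊕ Fin m) (Fin m ⊕ Fin m) ℝ :=
    Matrix.fromBlocks (jordanNil m) 0 0 (jordanNil m)
  refine ⟨e S0, e N0, ?_, ?_, ?_, m, ?_⟩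
  · have : jordanC m a b = e (a • 1 + (S0 + N0)) := by
      simp only [jordanC, S0, N0, e, Matrix.fromBlocks_add, Matrix.coe_reindexAlgEquiv, zero_add, add_zero]
    rw [this, map_add, map_add, map_smul, map_one]
  · have : Commute S0 N0 := by
      simp only [Commute, SemiconjBy, S0, N0, Matrix.fromBlocks_multiply]
      simp
    exact this.map e
  · have : S0ᴴ = -S0 := by
      simp [S0, Matrix.fromBlocks_transpose, Matrix.fromBlocks_neg]
    have h2 : (e S0)ᴴ = e (S0ᴴ) := by
      simp [e]
    rw [h2, this, map_neg]
  · rw [← map_pow]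
    have : ∀ k, N0 ^ k = Matrix.fromBlocks (jordanNil m ^ k) 0 0 (jordanNil m ^ k) := by
      intro k
      induction k with
      | zero => simp [Matrix.fromBlocks_one]
      | succ k ih =>
        rw [pow_succ, ih]
        simp [N0, Matrix.fromBlocks_multiply, pow_succ]
    rw [this, jordanNil_nilp, Matrix.fromBlocks_zero, map_zero]

lemma growth_nilp {d : ℕ} (Nn : Matrix (Fin d) (Fin d) ℝ) (k : ℕ) (hk : Nn ^ k = 0)
    (ε : ℝ) (hε : 0 < ε) :
    ∃ C : ℝ, 0 ≤ C ∧ ∀ t : ℝ, ‖NormedSpace.exp (t • Nn)‖ ≤ C * Real.exp (ε * |t|) := by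
  refine ⟨∑ n ∈ Finset.range k, ε⁻¹ ^ n * ‖Nn ^ n‖,
    Finset.sum_nonneg fun n _ => by positivity, fun t => ?_⟩
  rw [NormedSpace.exp_eq_tsum ℝ]
  simp only []
  rw [tsum_eq_sum (s := Finset.range k)]
  · rw [Finset.sum_mul]
    refine (norm_sum_le _ _).trans (Finset.sum_le_sum fun n _ => ?_)
    rw [smul_pow, smul_smul, norm_smul]
    have h1 := Real.pow_div_factorial_le_exp (ε * |t|) (by positivity) n
    have h2 : ‖((n.factorial : ℝ)⁻¹ * t ^ n)‖ ≤ ε⁻¹ ^ n * Real.exp (ε * |t|) := by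
      calc ‖((n.factorial : ℝ)⁻¹ * t ^ n)‖ = ε⁻¹ ^ n * ((ε * |t|) ^ n / n.factorial) := by
            rw [norm_mul, norm_inv, norm_pow, Real.norm_eq_abs, Real.norm_eq_abs,
              Nat.abs_cast, mul_pow, inv_pow]
            field_simp
        _ ≤ _ := by gcongr
    calc _ ≤ (ε⁻¹ ^ n * Real.exp (ε * |t|)) * ‖Nn ^ n‖ := by gcongr
      _ = _ := by ring
  · intro n hn
    rw [Finset.mem_range, not_lt] at hn
    rw [smul_pow, pow_eq_zero_of_le hn hk, smul_zero, smul_zero]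

lemma growth_skew {d : ℕ} (S : Matrix (Fin d) (Fin d) ℝ) (hS : Sᴴ = -S) (t : ℝ) :
    ‖NormedSpace.exp (t • S)‖ ≤ 1 := by
  have hcm : Commute (-(t • S)) (t • S) := (Commute.refl (t • S)).neg_left
  have h : ‖NormedSpace.exp (t • S)‖ * ‖NormedSpace.exp (t • S)‖ ≤ 1 := by
    rw [← Matrix.l2_opNorm_conjTranspose_mul_self, ← Matrix.exp_conjTranspose,
      Matrix.conjTranspose_smul, hS, star_trivial, smul_neg,
      ← Matrix.exp_add_of_commute _ _ hcm, neg_add_cancel,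
      NormedSpace.exp_zero, Matrix.cstar_norm_def, map_one]
    exact ContinuousLinearMap.norm_id_le
  nlinarith [norm_nonneg (NormedSpace.exp (t • S))]

lemma growth_sum {d : ℕ} (S Nn : Matrix (Fin d) (Fin d) ℝ) (hS : Sᴴ = -S) (hc : Commute S Nn)
    (k : ℕ) (hk : Nn ^ k = 0) (ε : ℝ) (hε : 0 < ε) :
    ∃ C : ℝ, 0 ≤ C ∧ ∀ t : ℝ, ‖NormedSpace.exp (t • (S + Nn))‖ ≤ C * Real.exp (ε * |t|) := by
  obtain ⟨C, hC, h⟩ := growth_nilp Nn k hk ε hε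
  refine ⟨C, hC, fun t => ?_⟩
  rw [smul_add, Matrix.exp_add_of_commute _ _ ((hc.smul_left t).smul_right t)]
  refine (norm_mul_le _ _).trans ?_
  have := growth_skew S hS t
  have h2 := h t
  calc _ ≤ 1 * (C * Real.exp (ε * |t|)) := by gcongr
    _ = _ := one_mul _

lemma exp_lip {d : ℕ} (B : Matrix (Fin d) (Fin d) ℝ) :
    ∃ K δ : ℝ, 0 < δ ∧ 0 ≤ K ∧ ∀ t : ℝ, |t| ≤ δ →
      ‖NormedSpace.exp (t • B) - 1‖ ≤ K * |t| := by
  have h := (hasDerivAt_exp_smul_const (𝕂 := ℝ) B (0 : ℝ)).isBigO_sub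
  obtain ⟨K, hK, hb⟩ := h.exists_pos
  rw [Asymptotics.isBigOWith_iff, Metric.eventually_nhds_iff] at hb
  obtain ⟨δ, hδ, hb⟩ := hb
  refine ⟨K, δ / 2, by positivity, hK.le, fun t ht => ?_⟩
  have := hb (y := t) (by rw [Real.dist_eq, sub_zero]; linarith)
  simpa [NormedSpace.exp_zero] using this

lemma exp_cont {d : ℕ} (B : Matrix (Fin d) (Fin d) ℝ) :
    Continuous fun t : ℝ => NormedSpace.exp (t • B) :=
  continuous_iff_continuousAt.mpr fun t =>
    (hasDerivAt_exp_smul_const (𝕂 := ℝ) B t).continuousAt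

lemma exp_scalar {d : ℕ} (c : ℝ) (B : Matrix (Fin d) (Fin d) ℝ) :
    NormedSpace.exp (c • (1 : Matrix (Fin d) (Fin d) ℝ) + B) = Real.exp c • NormedSpace.exp B := by
  rw [Matrix.exp_add_of_commute _ _ ((Commute.one_left B).smul_left c)]
  have : NormedSpace.exp (c • (1 : Matrix (Fin d) (Fin d) ℝ)) = Real.exp c • 1 := by
    rw [← Algebra.algebraMap_eq_smul_one, ← Algebra.algebraMap_eq_smul_one, Real.exp_eq_exp_ℝ]
    exact (NormedSpace.algebraMap_exp_comm (𝕂 := ℝ) (𝔸 := Matrix (Fin d) (Fin d) ℝ) c).symm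
  rw [this, smul_mul_assoc, one_mul]

end MatrixPart

open scoped Matrix.Norms.L2Operator in
lemma equiv_of_growth {d : ℕ} (a : ℝ) (ha : a ≠ 0) (B : Matrix (Fin d) (Fin d) ℝ)
    (hgr : ∀ ε > (0 : ℝ), ∃ C : ℝ, 0 ≤ C ∧
      ∀ t : ℝ, ‖NormedSpace.exp (t • B)‖ ≤ C * Real.exp (ε * |t|)) :
    RelEquivWith MemH1minus (a • (1 : Matrix (Fin d) (Fin d) ℝ) + B)
      (a • (1 : Matrix (Fin d) (Fin d) ℝ)) := by
  let M : Matrix (Fin d) (Fin d) ℝ → (Euc d →L[ℝ] Euc d) :=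
    fun A => Matrix.toEuclideanCLM (n := Fin d) (𝕜 := ℝ) A
  have hMn : ∀ A x, ‖M A x‖ ≤ ‖A‖ * ‖x‖ := fun A x => (M A).le_opNorm x
  let U : ℝ → (Euc d →L[ℝ] Euc d) := fun s => M (NormedSpace.exp ((s / a) • B))
  have hU0 : ∀ x, U 0 x = x := by
    intro x
    simp [U, M, NormedSpace.exp_zero]
  have hUadd : ∀ s t x, U (s + t) x = U s (U t x) := by
    intro s t x
    simp only [U, M]
    rw [add_div, add_smul, Matrix.exp_add_of_commute _ _
      (((Commute.refl B).smul_left _).smul_right _), map_mul]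
    rfl
  have hUc : ∀ x, Continuous fun t => U t x := by
    intro x
    have h1 : Continuous fun t : ℝ => NormedSpace.exp ((t / a) • B) :=
      (exp_cont B).comp (continuous_id.div_const a)
    have h2 : Continuous fun A : Matrix (Fin d) (Fin d) ℝ => M A x := by
      let l : Matrix (Fin d) (Fin d) ℝ →ₗ[ℝ] Euc d :=
        { toFun := fun A => M A x
          map_add' := fun A A' => by simp [M]
          map_smul' := fun c A => by simp [M] }
      exact l.continuous_of_finiteDimensional
    exact h2.comp h1
  have hg : ∀ ε > (0 : ℝ), ∃ C : ℝ, ∀ t x, ‖U t x‖ ≤ C * Real.exp (ε * |t|) * ‖x‖ := by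
    intro ε hε
    obtain ⟨C, hC, h⟩ := hgr (ε * |a|) (by positivity)
    refine ⟨C, fun t x => (hMn _ x).trans ?_⟩
    have h1 := h (t / a)
    rw [abs_div, mul_assoc, mul_div_cancel₀ _ (abs_ne_zero.mpr ha)] at h1
    gcongr
  have hl : ∃ K δ : ℝ, 0 < δ ∧ 0 ≤ K ∧ ∀ t x, |t| ≤ δ → ‖U t x - x‖ ≤ K * |t| * ‖x‖ := by
    obtain ⟨K, δ, hδ, hK, h⟩ := exp_lip B
    have ha' : 0 < |a| := abs_pos.mpr ha
    refine ⟨K / |a|, δ * |a|, by positivity, by positivity, fun t x ht => ?_⟩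
    have h1 := h (t / a) (by rw [abs_div, div_le_iff₀ ha']; exact ht)
    have h2 : U t x - x = M (NormedSpace.exp ((t / a) • B) - 1) x := by
      simp [U, M]
    rw [h2]
    refine (hMn _ x).trans ?_
    have h3 : K / |a| * |t| = K * |t / a| := by rw [abs_div]; ring
    rw [h3]
    gcongr
  obtain ⟨h, h0, hHol, heq⟩ := abstract_main U hU0 hUadd hUc hg hl
  refine ⟨h, ?_, ?_⟩
  · intro γ hγ0 hγ1
    obtain ⟨L, hL⟩ := hHol γ hγ0 hγ1
    refine ⟨h0, ⟨1, one_pos, L, fun x hx y hy => ?_⟩, ⟨1, one_pos, L, fun x hx y hy => ?_⟩⟩ <;>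
    · rw [mem_ball_zero_iff] at hx hy
      rw [dist_eq_norm, dist_eq_norm]
      first
        | exact (hL x y hx.le hy.le).1
        | exact (hL x y hx.le hy.le).2
  · have hA : ∀ t x, linFlow (a • (1 : Matrix (Fin d) (Fin d) ℝ) + B) t x
        = Real.exp (t * a) • U (t * a) x := by
      intro t x
      simp only [linFlow, U]
      rw [smul_add, smul_smul, exp_scalar, map_smul, mul_div_cancel_right₀ _ ha]
      rfl
    have hB : ∀ t x, linFlow (a • (1 : Matrix (Fin d) (Fin d) ℝ)) t x
        = Real.exp (t * a) • x := by
      intro t x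
      simp only [linFlow]
      have := exp_scalar (t * a) (0 : Matrix (Fin d) (Fin d) ℝ)
      rw [add_zero, NormedSpace.exp_zero] at this
      rw [smul_smul, this, map_smul]
      have h3 : M 1 x = x := by simp [M]
      exact congrArg (fun z => Real.exp (t * a) • z) h3
    intro x
    simp only [flowOrbit]
    rw [← Set.range_comp]
    congr 1
    funext t
    rw [Function.comp_apply, hA, hB, heq]

/-- **Lemma 4.4**: the flows on `ℝ^{2m}` generated by `J_m(a+ib)` and by `a I_{2m}`
(`a, b ≠ 0`) are all-Hölder equivalent. -/
theorem jordanC_allHolder_equiv_scalar {m : ℕ} (hm : 0 < m) (a b : ℝ)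
    (ha : a ≠ 0) (hb : b ≠ 0) :
    RelEquivWith MemH1minus (jordanC m a b)
      (a • (1 : Matrix (Fin (2 * m)) (Fin (2 * m)) ℝ)) := by
  obtain ⟨S, Nn, hdec, hc, hS, k, hk⟩ := jordanC_decomp m a b
  rw [hdec]
  exact equiv_of_growth a ha _ (growth_sum S Nn hS hc k hk)

end LF
end
end

section
/- Let Φ and Ψ be irreducible linear flows on X = ℝ^d whose spectra satisfy σ(Φ) ⊂ ℂ∖iℝ and σ(Ψ) ⊂ ℂ∖iℝ (i.e. no eigenvalue of either generator is purely imaginary). Then Φ and Ψ are all-Hölder equivalent (Φ ~^{1⁻} Ψ). -/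
noncomputable section
namespace LF

open Filter Topology

variable {d : ℕ}

/-- `Z` is an invariant subspace of the flow generated by `A`. -/
def IsInvariantSub (A : Matrix (Fin d) (Fin d) ℝ) (Z : Submodule ℝ (Euc d)) : Prop :=
  ∀ t : ℝ, ∀ x ∈ Z, linFlow A t x ∈ Z

/-- The linear flow generated by `A` is irreducible: whenever `X = Z ⊕ Z'` with invariant
subspaces `Z`, `Z'`, necessarily `Z = ⊥` or `Z' = ⊥`. -/
def IsIrreducibleFlow (A : Matrix (Fin d) (Fin d) ℝ) : Prop :=
  ∀ Z Z' : Submodule ℝ (Euc d), IsInvariantSub A Z → IsInvariantSub A Z' → IsCompl Z Z' →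
    Z = ⊥ ∨ Z' = ⊥


open Polynomial in
lemma growth_aux {𝔸 : Type*} [NormedRing 𝔸] [NormedAlgebra ℂ 𝔸] [CompleteSpace 𝔸] (M : 𝔸) (a : ℝ)
    (L : Multiset ℂ) : (∀ z ∈ L, z.re = a) → ∀ Y : 𝔸,
    aeval M (L.map (fun z => X - C z)).prod * Y = 0 →
    ∀ ε > (0:ℝ), ∃ K : ℝ, 0 ≤ K ∧ ∀ t : ℝ,
      ‖NormedSpace.exp ((t:ℂ) • M) * Y‖ ≤ K * Real.exp (a * t + ε * |t|) := by
  induction L using Multiset.induction_on with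
  | empty =>
    intro _ Y hY ε hε
    refine ⟨0, le_rfl, fun t => ?_⟩
    simp at hY
    simp [hY]
  | cons z L ih =>
    intro hL Y hY ε hε
    have hz : z.re = a := hL z (by simp)
    have h1 : aeval M (L.map (fun z => X - C z)).prod * ((M - algebraMap ℂ 𝔸 z) * Y) = 0 := by
      rw [← hY, Multiset.map_cons, Multiset.prod_cons, mul_comm (X - C z), map_mul]
      simp [mul_assoc]
    obtain ⟨K, hK0, hK⟩ := ih (fun w hw => hL w (by simp [hw])) _ h1 (ε/2) (by positivity)
    refine ⟨‖Y‖ + K * (2/ε), by positivity, fun t => ?_⟩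
    let f : ℝ → 𝔸 := fun s => Complex.exp (-(z * s)) • (NormedSpace.exp ((s:ℂ) • M) * Y)
    let f' : ℝ → 𝔸 := fun s => Complex.exp (-(z * s)) • (NormedSpace.exp ((s:ℂ) • M) * ((M - algebraMap ℂ 𝔸 z) * Y))
    have hf : ∀ s : ℝ, HasDerivAt f (f' s) s := by
      intro s
      have e1 : HasDerivAt (fun u : ℂ => NormedSpace.exp (u • M) * Y) (NormedSpace.exp ((s:ℂ) • M) * M * Y) (s:ℂ) :=
        (hasDerivAt_exp_smul_const M (s:ℂ)).mul_const Y
      have e2 : HasDerivAt (fun u : ℂ => Complex.exp (-(z * u))) (Complex.exp (-(z*s)) * (-(z * 1))) (s:ℂ) :=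
        (((hasDerivAt_id (s:ℂ)).const_mul z).neg).cexp
      have e3 := (e2.smul e1).scomp s (Complex.ofRealCLM.hasDerivAt (x := s))
      refine e3.congr_deriv ?_
      simp only [Complex.ofRealCLM_apply, Complex.ofReal_one, one_smul, f', sub_mul, mul_sub, mul_assoc, smul_sub, mul_one, Algebra.algebraMap_eq_smul_one, smul_mul_assoc, mul_smul_comm, one_mul, smul_smul, mul_neg, neg_smul]
      abel
    have hn : ∀ s : ℝ, ‖Complex.exp (-(z * s))‖ = Real.exp (-(a * s)) := by
      intro s
      rw [Complex.norm_exp]; simp [hz]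
    have hb : ∀ s ∈ Set.uIcc 0 t, ‖f' s‖ ≤ K * Real.exp (ε/2 * |t|) := by
      intro s hs
      have hst : |s| ≤ |t| := by
        rcases Set.mem_uIcc.1 hs with h | h
        · rw [abs_of_nonneg h.1, abs_of_nonneg (h.1.trans h.2)]; exact h.2
        · rw [abs_of_nonpos h.2, abs_of_nonpos (h.1.trans h.2)]; linarith [h.1]
      simp only [f', norm_smul, hn]
      calc Real.exp (-(a*s)) * _ ≤ Real.exp (-(a*s)) * (K * Real.exp (a * s + ε/2 * |s|)) := by gcongr; exact hK s
        _ = K * Real.exp (ε/2*|s|) := by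
          rw [mul_left_comm, ← Real.exp_add]; congr 2; ring
        _ ≤ _ := by gcongr
    have hmv := (convex_uIcc (0:ℝ) t).norm_image_sub_le_of_norm_hasDerivWithin_le
      (fun s _ => (hf s).hasDerivWithinAt) hb Set.left_mem_uIcc Set.right_mem_uIcc
    have hf0 : f 0 = Y := by simp [f]
    have hft : ‖f t‖ ≤ (‖Y‖ + K * (2/ε)) * Real.exp (ε * |t|) := by
      have h2 : ‖f t‖ ≤ ‖f 0‖ + ‖f t - f 0‖ := norm_le_norm_add_norm_sub' _ _ 
      rw [hf0] at h2 hmv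
      have h3 : (ε/2*|t|) ≤ Real.exp (ε/2*|t|) := by linarith [Real.add_one_le_exp (ε/2*|t|)]
      have h4 : 1 ≤ Real.exp (ε * |t|) := Real.one_le_exp (by positivity)
      have h5 : Real.exp (ε/2*|t|) * Real.exp (ε/2*|t|) = Real.exp (ε * |t|) := by
        rw [← Real.exp_add]; congr 1; ring
      simp only [sub_zero, Real.norm_eq_abs] at hmv
      have h6 : K * Real.exp (ε/2*|t|) * |t| ≤ K * (2/ε) * Real.exp (ε*|t|) := by
        have : |t| = (2/ε) * (ε/2*|t|) := by field_simp
        calc K * Real.exp (ε/2*|t|) * |t| = K * Real.exp (ε/2*|t|) * ((2/ε) * (ε/2*|t|)) := by rw [← this]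
          _ ≤ K * Real.exp (ε/2*|t|) * ((2/ε) * Real.exp (ε/2*|t|)) := by gcongr
          _ = _ := by rw [← h5]; ring
      nlinarith [norm_nonneg Y]
    have h7 : ‖f t‖ = Real.exp (-(a*t)) * ‖NormedSpace.exp ((t:ℂ) • M) * Y‖ := by
      simp only [f, norm_smul, hn]
    rw [Real.exp_add]
    rw [h7] at hft
    have h8 : Real.exp (a*t) * Real.exp (-(a*t)) = 1 := by rw [← Real.exp_add]; simp
    calc _ = Real.exp (a*t) * (Real.exp (-(a*t)) * ‖NormedSpace.exp ((t:ℂ) • M) * Y‖) := by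
            rw [← mul_assoc, h8, one_mul]
      _ ≤ Real.exp (a*t) * ((‖Y‖ + K * (2/ε)) * Real.exp (ε * |t|)) := by gcongr
      _ = _ := by ring
lemma linFlow_eq (A : Matrix (Fin d) (Fin d) ℝ) (t : ℝ) (x : Euc d) :
    linFlow A t x = Matrix.toEuclideanCLM (𝕜 := ℝ) (n := Fin d) (NormedSpace.exp (t • A)) x := rfl

lemma lin_bound {E F : Type*} [NormedAddCommGroup E] [NormedSpace ℝ E] [FiniteDimensional ℝ E]
    [NormedAddCommGroup F] [NormedSpace ℝ F] (T : E →ₗ[ℝ] F) : ∃ K : ℝ, 0 ≤ K ∧ ∀ x, ‖T x‖ ≤ K * ‖x‖ :=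
  ⟨‖LinearMap.toContinuousLinearMap T‖, norm_nonneg _, fun x => (LinearMap.toContinuousLinearMap T).le_opNorm x⟩

section
attribute [local instance] Matrix.linftyOpNormedRing Matrix.linftyOpNormedAlgebra

lemma toCLM_bound (d : ℕ) : ∃ K : ℝ, 0 ≤ K ∧ ∀ M : Matrix (Fin d) (Fin d) ℝ,
    ‖Matrix.toEuclideanCLM (𝕜 := ℝ) (n := Fin d) M‖ ≤ K * ‖M‖ :=
  lin_bound { toFun := fun M => Matrix.toEuclideanCLM (𝕜 := ℝ) (n := Fin d) M
              map_add' := map_add _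
              map_smul' := map_smul _ }

lemma growth (A : Matrix (Fin d) (Fin d) ℝ) (a : ℝ) (ha : ∀ z ∈ cSpec A, z.re = a) :
    ∀ ε > (0:ℝ), ∃ K : ℝ, ∀ t : ℝ,
      ‖Matrix.toEuclideanCLM (𝕜 := ℝ) (n := Fin d) (NormedSpace.exp (t • A))‖ ≤ K * Real.exp (a * t + ε * |t|) := by
  intro ε hε
  let : NormedAlgebra ℚ (Matrix (Fin d) (Fin d) ℝ) := NormedAlgebra.restrictScalars ℚ ℝ _
  let M : Matrix (Fin d) (Fin d) ℂ := A.map Complex.ofReal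
  have hp : Polynomial.aeval M (M.charpoly.roots.map (fun z => Polynomial.X - Polynomial.C z)).prod = 0 := by
    have h := (IsAlgClosed.splits M.charpoly).eq_prod_roots
    rw [M.charpoly_monic.leadingCoeff, map_one, one_mul] at h
    rw [← h, Matrix.aeval_self_charpoly]
  obtain ⟨K, hK0, hK⟩ := growth_aux M a M.charpoly.roots (by
    intro z hz
    apply ha
    exact Matrix.mem_spectrum_iff_isRoot_charpoly.2 (Polynomial.isRoot_of_mem_roots hz)) 1 (by rw [hp, zero_mul]) ε hε
  obtain ⟨K', hK'0, hK'⟩ := toCLM_bound d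
  refine ⟨K' * K, fun t => ?_⟩
  have h1 := hK' (NormedSpace.exp (t • A))
  have h2 : ‖NormedSpace.exp (t • A)‖ = ‖NormedSpace.exp ((t:ℂ) • M) * 1‖ := by
    have e : NormedSpace.exp ((t:ℂ) • M) = (NormedSpace.exp (t • A)).map Complex.ofReal := by
      have := NormedSpace.map_exp (Complex.ofRealHom.mapMatrix (m := Fin d)) (by
        exact Continuous.matrix_map continuous_id Complex.continuous_ofReal) (t • A)
      rw [RingHom.mapMatrix_apply, RingHom.mapMatrix_apply] at this
      refine Eq.trans ?_ this.symm
      congr 1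
      ext i j
      simp [M]
    rw [mul_one, e, Matrix.linfty_opNorm_def, Matrix.linfty_opNorm_def]
    simp
  calc _ ≤ K' * ‖NormedSpace.exp (t • A)‖ := h1
    _ ≤ K' * (K * Real.exp (a * t + ε * |t|)) := by rw [h2]; gcongr; exact hK t
    _ = _ := by ring

end

lemma root_of_aeval_zero (A : Matrix (Fin d) (Fin d) ℝ) (f : Polynomial ℝ) (hf : Polynomial.aeval A f = 0)
    (z : ℂ) (hz : z ∈ cSpec A) : Polynomial.aeval z f = 0 := by
  have h1 : Polynomial.aeval (A.map Complex.ofReal) (f.map Complex.ofRealHom) = 0 := by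
    have : Polynomial.aeval (Complex.ofRealAm.mapMatrix A) f = Complex.ofRealAm.mapMatrix (Polynomial.aeval A f) :=
      Polynomial.aeval_algHom_apply _ _ _
    rw [hf, map_zero] at this
    have e : Complex.ofRealHom = algebraMap ℝ ℂ := rfl
    rw [e, Polynomial.aeval_map_algebraMap]
    exact this
  have h2 := spectrum.subset_polynomial_aeval (A.map Complex.ofReal) (f.map Complex.ofRealHom) ⟨z, hz, rfl⟩
  rw [h1] at h2
  simp only [] at h2
  have : Nontrivial (Matrix (Fin d) (Fin d) ℂ) := by
    by_contra h
    rw [not_nontrivial_iff_subsingleton] at h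
    have : spectrum ℂ (A.map Complex.ofReal) = ∅ := spectrum.of_subsingleton _
    rw [cSpec, this] at hz
    exact hz
  rw [spectrum.zero_eq, Set.mem_singleton_iff] at h2
  rw [← h2, Polynomial.eval_map, Polynomial.aeval_def]; rfl

lemma ker_invariant (A : Matrix (Fin d) (Fin d) ℝ) (f : Polynomial ℝ) :
    IsInvariantSub A (LinearMap.ker (Matrix.toEuclideanLin (Polynomial.aeval A f))) := by
  intro t x hx
  rw [LinearMap.mem_ker] at hx ⊢
  have hc : Commute (Polynomial.aeval A f) (NormedSpace.exp (t • A)) := by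
    apply Commute.exp_right
    apply Commute.smul_right
    have := (Commute.all f Polynomial.X).map (Polynomial.aeval A)
    simpa using this
  unfold linFlow
  have h := congrArg (fun M => Matrix.toEuclideanCLM (𝕜 := ℝ) (n := Fin d) M x) hc.eq
  simp only [map_mul] at h
  change Matrix.toEuclideanLin (Polynomial.aeval A f) (Matrix.toEuclideanLin (NormedSpace.exp (t • A)) x) = Matrix.toEuclideanLin (NormedSpace.exp (t • A)) (Matrix.toEuclideanLin (Polynomial.aeval A f) x) at h
  rw [h, hx, map_zero]

lemma re_eq (A : Matrix (Fin d) (Fin d) ℝ) (hA : IsIrreducibleFlow A)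
    (hs : ∀ z ∈ cSpec A, z.re ≠ 0) : ∃ a : ℝ, a ≠ 0 ∧ ∀ z ∈ cSpec A, z.re = a := by
  by_cases he : ∃ z, z ∈ cSpec A
  swap
  · exact ⟨1, one_ne_zero, fun z hz => (he ⟨z, hz⟩).elim⟩
  obtain ⟨z₀, hz₀⟩ := he
  refine ⟨z₀.re, hs _ hz₀, ?_⟩
  let E := Matrix.toEuclideanCLM (𝕜 := ℝ) (n := Fin d)
  have hint : IsIntegral ℝ z₀ := Algebra.IsIntegral.isIntegral z₀
  set q := minpoly ℝ z₀ with hq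
  have hqi : Irreducible q := minpoly.irreducible hint
  have hp0 : A.charpoly ≠ 0 := A.charpoly_monic.ne_zero
  obtain ⟨g, hg, hqg⟩ := (FiniteMultiplicity.of_not_isUnit hqi.not_isUnit hp0 : FiniteMultiplicity q A.charpoly).exists_eq_pow_mul_and_not_dvd
  set m := multiplicity q A.charpoly
  have hcop : IsCoprime (q ^ m) g := ((hqi.coprime_iff_not_dvd).2 hqg).pow_left
  have hprod : Polynomial.aeval A (q^m) * Polynomial.aeval A g = 0 := by
    rw [← map_mul, ← hg, Matrix.aeval_self_charpoly]
  have hprod' : Polynomial.aeval A g * Polynomial.aeval A (q^m) = 0 := by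
    rw [← map_mul, mul_comm, ← hg, Matrix.aeval_self_charpoly]
  have happ : ∀ M N : Matrix (Fin d) (Fin d) ℝ, ∀ x : Euc d, Matrix.toEuclideanLin (M * N) x = Matrix.toEuclideanLin M (Matrix.toEuclideanLin N x) := by
    intro M N x
    have h := congrArg (fun S => S x) (map_mul E M N)
    exact h
  obtain ⟨u, v, huv⟩ := hcop
  have huv' : Polynomial.aeval A u * Polynomial.aeval A (q^m) + Polynomial.aeval A v * Polynomial.aeval A g = 1 := by
    rw [← map_mul, ← map_mul, ← map_add, huv, map_one]
  have hone : ∀ x : Euc d, Matrix.toEuclideanLin (1 : Matrix (Fin d) (Fin d) ℝ) x = x := by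
    intro x
    exact congrArg (fun S => S x) (map_one E)
  have hx : ∀ x : Euc d, Matrix.toEuclideanLin (Polynomial.aeval A u * Polynomial.aeval A (q^m)) x + Matrix.toEuclideanLin (Polynomial.aeval A v * Polynomial.aeval A g) x = x := by
    intro x
    rw [← LinearMap.add_apply, ← map_add, huv', hone]
  have hc : IsCompl (LinearMap.ker (Matrix.toEuclideanLin (Polynomial.aeval A (q^m)))) (LinearMap.ker (Matrix.toEuclideanLin (Polynomial.aeval A g))) := by
    constructor
    · rw [Submodule.disjoint_def]
      intro x h1 h2
      rw [LinearMap.mem_ker] at h1 h2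
      rw [← hx x, happ, happ, h1, h2]; simp
    · rw [codisjoint_iff, eq_top_iff]
      intro x _
      rw [Submodule.mem_sup]
      refine ⟨_, ?_, _, ?_, (add_comm _ _).trans (hx x)⟩
      · rw [LinearMap.mem_ker, ← happ, ← mul_assoc, ← map_mul (Polynomial.aeval A), mul_comm (q^m), map_mul (Polynomial.aeval A), mul_assoc, hprod]; simp
      · rw [LinearMap.mem_ker, ← happ, ← mul_assoc, ← map_mul (Polynomial.aeval A), mul_comm g, map_mul (Polynomial.aeval A), mul_assoc, hprod']; simp
  rcases hA _ _ (ker_invariant A _) (ker_invariant A _) hc with h | h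
  · exfalso
    have hg0 : Polynomial.aeval A g = 0 := by
      apply Matrix.toEuclideanLin.injective
      ext1 x
      have : Matrix.toEuclideanLin (Polynomial.aeval A g) x ∈ LinearMap.ker (Matrix.toEuclideanLin (Polynomial.aeval A (q^m))) := by
        rw [LinearMap.mem_ker, ← happ, hprod]; simp
      rw [h] at this
      simpa using this
    exact hqg (minpoly.dvd ℝ z₀ (root_of_aeval_zero A g hg0 z₀ hz₀))
  · have hg0 : Polynomial.aeval A (q^m) = 0 := by
      apply Matrix.toEuclideanLin.injective
      ext1 x
      have : Matrix.toEuclideanLin (Polynomial.aeval A (q^m)) x ∈ LinearMap.ker (Matrix.toEuclideanLin (Polynomial.aeval A g)) := by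
        rw [LinearMap.mem_ker, ← happ, hprod']; simp
      rw [h] at this
      simpa using this
    intro z hz
    have h1 := root_of_aeval_zero A _ hg0 z hz
    rw [map_pow] at h1
    have h2 : Polynomial.aeval z q = 0 := eq_zero_of_pow_eq_zero h1
    let r : Polynomial ℝ := Polynomial.X^2 - Polynomial.C (2 * z₀.re) * Polynomial.X + Polynomial.C (z₀.re^2 + z₀.im^2)
    have key : ∀ w : ℂ, Polynomial.aeval w r = (w - z₀) * (w - (starRingEnd ℂ) z₀) := by
      intro w
      simp only [r, map_add, map_sub, map_mul, map_pow, Polynomial.aeval_X, Polynomial.aeval_C]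
      apply Complex.ext <;> simp [pow_two] <;> ring
    obtain ⟨k, hk⟩ : q ∣ r := minpoly.dvd ℝ z₀ (by rw [key]; simp)
    have h3 := key z
    rw [hk, map_mul, h2, zero_mul] at h3
    rcases mul_eq_zero.1 h3.symm with h4 | h4
    · rw [sub_eq_zero.1 h4]
    · rw [sub_eq_zero.1 h4]; simp
/-- Abstract linear flows with all Lyapunov exponents equal to one. -/
structure GF {E : Type*} [NormedAddCommGroup E] [NormedSpace ℝ E] (F : ℝ → E →L[ℝ] E) : Prop where
  zero : ∀ x, F 0 x = x
  add : ∀ s t x, F (s + t) x = F s (F t x)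
  cont : Continuous F
  growth : ∀ ε > (0:ℝ), ∃ K : ℝ, ∀ t : ℝ, ‖F t‖ ≤ K * Real.exp (t + ε * |t|)
  near : ∃ L : ℝ, 0 ≤ L ∧ ∀ t, 0 ≤ t → t ≤ 1 → ∀ x, ‖F t x - x‖ ≤ L * t * ‖x‖

section flows
variable {E : Type*} [NormedAddCommGroup E] [NormedSpace ℝ E]

/-- adapted norm -/
def VV (F : ℝ → E →L[ℝ] E) (x : E) : ℝ := ⨆ t : Set.Iic (0:ℝ), Real.exp (-(t:ℝ)/2) * ‖F t x‖

variable {F G : ℝ → E →L[ℝ] E}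

lemma GF.bdd (hF : GF F) : ∃ M : ℝ, 1 ≤ M ∧ ∀ x, ∀ t ≤ (0:ℝ), Real.exp (-t/2) * ‖F t x‖ ≤ M * ‖x‖ := by
  obtain ⟨K, hK⟩ := hF.growth (1/2) (by norm_num)
  refine ⟨max K 1, le_max_right _ _, fun x t ht => ?_⟩
  have h1 : ‖F t x‖ ≤ K * Real.exp (t/2) * ‖x‖ := by
    refine ((F t).le_opNorm x).trans ?_
    gcongr
    refine (hK t).trans_eq ?_
    rw [abs_of_nonpos ht]; congr 2; ring
  calc Real.exp (-t/2) * ‖F t x‖ ≤ Real.exp (-t/2) * (K * Real.exp (t/2) * ‖x‖) := by gcongr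
    _ = (Real.exp (-t/2) * Real.exp (t/2)) * (K * ‖x‖) := by ring
    _ = K * ‖x‖ := by rw [← Real.exp_add]; ring_nf; simp
    _ ≤ _ := by gcongr; exact le_max_left _ _

lemma GF.le_VV (hF : GF F) (x : E) {t : ℝ} (ht : t ≤ 0) : Real.exp (-t/2) * ‖F t x‖ ≤ VV F x := by
  obtain ⟨M, _, hM⟩ := hF.bdd
  have hb : BddAbove (Set.range fun t : Set.Iic (0:ℝ) => Real.exp (-(t:ℝ)/2) * ‖F t x‖) :=
    ⟨M * ‖x‖, by rintro _ ⟨t, rfl⟩; exact hM x t t.2⟩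
  exact le_ciSup hb ⟨t, ht⟩

lemma VV_le (x : E) {c : ℝ} (h : ∀ t ≤ (0:ℝ), Real.exp (-t/2) * ‖F t x‖ ≤ c) : VV F x ≤ c := by
  have : Nonempty (Set.Iic (0:ℝ)) := ⟨⟨0, Set.mem_Iic.2 le_rfl⟩⟩
  exact ciSup_le fun t => h t t.2

lemma GF.norm_le_VV (hF : GF F) (x : E) : ‖x‖ ≤ VV F x := by
  have := hF.le_VV x le_rfl
  simpa [hF.zero] using this

lemma GF.VV_le_norm (hF : GF F) : ∃ M : ℝ, 1 ≤ M ∧ ∀ x, VV F x ≤ M * ‖x‖ := by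
  obtain ⟨M, h1, hM⟩ := hF.bdd
  exact ⟨M, h1, fun x => VV_le x (hM x)⟩

lemma GF.VV_add (hF : GF F) (x y : E) : VV F (x + y) ≤ VV F x + VV F y := by
  refine VV_le _ fun t ht => ?_
  rw [map_add]
  calc _ ≤ Real.exp (-t/2) * (‖F t x‖ + ‖F t y‖) := by gcongr; exact norm_add_le _ _
    _ ≤ _ := by rw [mul_add]; exact add_le_add (hF.le_VV x ht) (hF.le_VV y ht)

lemma VV_smul (c : ℝ) (hc : 0 ≤ c) (x : E) : VV F (c • x) = c * VV F x := by
  unfold VV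
  rw [Real.mul_iSup_of_nonneg hc]
  congr 1; ext t
  rw [map_smul, norm_smul, Real.norm_of_nonneg hc]; ring

lemma GF.VV_flow (hF : GF F) (x : E) {s : ℝ} (hs : s ≤ 0) : VV F (F s x) ≤ Real.exp (s/2) * VV F x := by
  refine VV_le _ fun t ht => ?_
  rw [← hF.add]
  calc _ = Real.exp (s/2) * (Real.exp (-(t+s)/2) * ‖F (t+s) x‖) := by
        rw [← mul_assoc, ← Real.exp_add]; congr 2; ring
    _ ≤ _ := by gcongr; exact hF.le_VV x (by linarith)

lemma GF.inv (hF : GF F) (t : ℝ) (x : E) : F t (F (-t) x) = x := by rw [← hF.add]; simp [hF.zero]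
lemma GF.inv' (hF : GF F) (t : ℝ) (x : E) : F (-t) (F t x) = x := by rw [← hF.add]; simp [hF.zero]

lemma GF.VV_flow' (hF : GF F) (x : E) {s : ℝ} (hs : 0 ≤ s) : Real.exp (s/2) * VV F x ≤ VV F (F s x) := by
  have h := hF.VV_flow (F s x) (s := -s) (by linarith)
  rw [hF.inv'] at h
  calc _ ≤ Real.exp (s/2) * (Real.exp (-s/2) * VV F (F s x)) := by gcongr
    _ = VV F (F s x) := by rw [← mul_assoc, ← Real.exp_add]; ring_nf; simp

lemma GF.VV_abs (hF : GF F) {M : ℝ} (hM : ∀ x, VV F x ≤ M * ‖x‖) (x y : E) :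
    |VV F x - VV F y| ≤ M * ‖x - y‖ := by
  have h1 := hF.VV_add (x - y) y
  have h2 := hF.VV_add (y - x) x
  rw [sub_add_cancel] at h1 h2
  have h3 := hM (x - y)
  have h4 := hM (y - x)
  rw [norm_sub_rev] at h4
  rw [abs_le]; constructor <;> linarith

lemma GF.VV_cont (hF : GF F) : Continuous (VV F) := by
  obtain ⟨M, h1, hM⟩ := hF.VV_le_norm
  have : LipschitzWith (Real.toNNReal M) (VV F) := LipschitzWith.of_dist_le_mul fun x y => by
    rw [Real.dist_eq, dist_eq_norm, Real.coe_toNNReal _ (by linarith)]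
    exact hF.VV_abs hM x y
  exact this.continuous

lemma GF.VV_pos (hF : GF F) {x : E} (hx : x ≠ 0) : 0 < VV F x :=
  (norm_pos_iff.2 hx).trans_le (hF.norm_le_VV x)

lemma GF.VV_zero (hF : GF F) : VV F 0 = 0 := by
  obtain ⟨M, h1, hM⟩ := hF.VV_le_norm
  have := hM 0
  have h2 := hF.norm_le_VV 0
  simp at this h2; linarith

lemma GF.exists_tau (hF : GF F) {x : E} (hx : x ≠ 0) : ∃ t : ℝ, VV F (F (-t) x) = 1 := by
  have hp := hF.VV_pos hx
  have hc : Continuous fun t : ℝ => VV F (F (-t) x) :=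
    hF.VV_cont.comp ((hF.cont.comp continuous_neg).clm_apply continuous_const)
  set v := VV F x
  have l1 : Real.exp (Real.log v) = v := Real.exp_log hp
  have hlog : Real.log v ≤ |Real.log v| := le_abs_self _
  have hlog' : -|Real.log v| ≤ Real.log v := neg_abs_le _
  let T := 2 * |Real.log v|
  have hT : 0 ≤ T := by positivity
  have h1 : VV F (F (-T) x) ≤ 1 := by
    refine (hF.VV_flow x (by linarith)).trans ?_
    change Real.exp (-T/2) * v ≤ 1
    rw [← l1, ← Real.exp_add, Real.exp_le_one_iff]
    simp only [T]; linarith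
  have h2 : 1 ≤ VV F (F (-(-T)) x) := by
    refine le_trans ?_ (hF.VV_flow' x (by linarith))
    change 1 ≤ Real.exp (-(-T)/2) * v
    rw [← l1, ← Real.exp_add, Real.one_le_exp_iff]
    simp only [T]; linarith
  obtain ⟨t, ht⟩ := mem_range_of_exists_le_of_exists_ge hc ⟨T, h1⟩ ⟨-T, h2⟩
  exact ⟨t, ht⟩

/-- hitting time -/
def tau (F : ℝ → E →L[ℝ] E) (x : E) : ℝ := Classical.epsilon fun t => VV F (F (-t) x) = 1

lemma GF.tau_spec (hF : GF F) {x : E} (hx : x ≠ 0) : VV F (F (-tau F x) x) = 1 :=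
  Classical.epsilon_spec (hF.exists_tau hx)

lemma GF.lt_of_VV (hF : GF F) {x : E} {t s : ℝ} (ht : VV F (F (-t) x) ≤ 1) (hs : 1 < VV F (F (-s) x)) : s < t := by
  by_contra h
  push Not at h
  have h1 := hF.VV_flow (F (-t) x) (s := t - s) (by linarith)
  rw [← hF.add, show t - s + -t = -s by ring] at h1
  have h2 : Real.exp ((t-s)/2) ≤ 1 := Real.exp_le_one_iff.2 (by linarith)
  have h3 : Real.exp ((t-s)/2) * VV F (F (-t) x) ≤ 1 * 1 := by
    gcongr; exact (norm_nonneg _).trans (hF.norm_le_VV _)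
  linarith

lemma GF.tau_eq (hF : GF F) {x : E} {t : ℝ} (h : VV F (F (-t) x) = 1) : tau F x = t := by
  have hx : x ≠ 0 := by rintro rfl; simp [hF.VV_zero] at h
  have key : ∀ a b : ℝ, VV F (F (-a) x) = 1 → VV F (F (-b) x) = 1 → a ≤ b := by
    intro a b ha hb
    by_contra hlt
    push Not at hlt
    have h1 := hF.VV_flow (F (-b) x) (s := b - a) (by linarith)
    rw [← hF.add, show b - a + -b = -a by ring, ha, hb, mul_one] at h1
    have := Real.exp_lt_one_iff.2 (show (b-a)/2 < 0 by linarith)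
    linarith
  exact le_antisymm (key _ _ (hF.tau_spec hx) h) (key _ _ h (hF.tau_spec hx))

lemma GF.tau_flow (hF : GF F) {x : E} (hx : x ≠ 0) (t : ℝ) : tau F (F t x) = tau F x + t := by
  apply hF.tau_eq
  rw [← hF.add, show -(tau F x + t) + t = - tau F x by ring]
  exact hF.tau_spec hx

lemma GF.tau_cont (hF : GF F) {x : E} (hx : x ≠ 0) : ContinuousAt (tau F) x := by
  have hc : ∀ t : ℝ, Continuous fun y : E => VV F (F (-t) y) := fun t => hF.VV_cont.comp (F (-t)).continuous
  have hm : ∀ a b, a < b → VV F (F (-a) x) > 0 → VV F (F (-b) x) < VV F (F (-a) x) := by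
    intro a b hab h0
    have h1 := hF.VV_flow (F (-a) x) (s := a - b) (by linarith)
    rw [← hF.add, show a - b + -a = -b by ring] at h1
    have := Real.exp_lt_one_iff.2 (show (a-b)/2 < 0 by linarith)
    nlinarith
  have hpos : ∀ a, VV F (F (-a) x) > 0 := by
    intro a; apply hF.VV_pos; intro h
    apply hx; rw [← hF.inv a x, h, map_zero]
  rw [Metric.continuousAt_iff']
  intro η hη
  have hs := hF.tau_spec hx
  have e1 : ∀ᶠ y in 𝓝 x, VV F (F (-(tau F x + η)) y) < 1 :=
    (hc _).continuousAt.eventually_lt continuousAt_const (by rw [← hs]; exact hm _ _ (by linarith) (hpos _))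
  have e2 : ∀ᶠ y in 𝓝 x, 1 < VV F (F (-(tau F x - η)) y) :=
    continuousAt_const.eventually_lt (hc _).continuousAt (by nth_rewrite 1 [← hs]; exact hm _ _ (by linarith) (hpos _))
  have e3 : ∀ᶠ y in 𝓝 x, y ≠ 0 := isOpen_ne.mem_nhds hx
  filter_upwards [e1, e2, e3] with y h1 h2 h3
  have hy := hF.tau_spec h3
  have a1 := hF.lt_of_VV hy.le h2
  have a2 : tau F y < tau F x + η := by
    by_contra hcon
    push Not at hcon
    have h5 := hF.VV_flow' (F (-tau F y) y) (s := tau F y - (tau F x + η)) (by linarith)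
    rw [← hF.add, hy, mul_one, show tau F y - (tau F x + η) + -tau F y = -(tau F x + η) by ring] at h5
    have := Real.one_le_exp (x := (tau F y - (tau F x + η))/2) (by linarith)
    linarith
  rw [Real.dist_eq, abs_lt]; constructor <;> linarith

/-- the conjugacy -/
def hh (F G : ℝ → E →L[ℝ] E) (x : E) : E :=
  G (tau F x) ((VV G (F (-tau F x) x))⁻¹ • F (-tau F x) x)

lemma hh_zero : hh F G 0 = 0 := by simp [hh]

lemma GF.F_ne (hF : GF F) {x : E} (hx : x ≠ 0) (t : ℝ) : F t x ≠ 0 := by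
  intro h; apply hx; rw [← hF.inv' t x, h, map_zero]

lemma hh_flow (hF : GF F) (hG : GF G) (t : ℝ) (x : E) : hh F G (F t x) = G t (hh F G x) := by
  by_cases hx : x = 0
  · simp [hx, hh_zero]
  unfold hh
  rw [hF.tau_flow hx, ← hF.add, show -(tau F x + t) + t = - tau F x by ring, ← hG.add, add_comm t]

lemma hh_spec (hF : GF F) (hG : GF G) {x : E} (hx : x ≠ 0) : tau G (hh F G x) = tau F x := by
  apply hG.tau_eq
  have := hG.VV_pos (hF.F_ne hx (-tau F x))
  rw [hh, hG.inv', VV_smul _ (by positivity), inv_mul_cancel₀ this.ne']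

lemma hh_inv (hF : GF F) (hG : GF G) (x : E) : hh G F (hh F G x) = x := by
  by_cases hx : x = 0
  · simp [hx, hh_zero]
  have hp := hG.VV_pos (hF.F_ne hx (-tau F x))
  have h1 : G (-tau F x) (hh F G x) = (VV G (F (-tau F x) x))⁻¹ • F (-tau F x) x := by rw [hh, hG.inv']
  rw [hh, hh_spec hF hG hx, h1, VV_smul _ (by positivity), hF.tau_spec hx, mul_one, inv_inv, smul_smul,
    mul_inv_cancel₀ hp.ne', one_smul, hF.inv]

lemma hh_contAt (hF : GF F) (hG : GF G) {x : E} (hx : x ≠ 0) : ContinuousAt (hh F G) x := by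
  have h1 := hF.tau_cont hx
  have h2 : ContinuousAt (fun x => F (-tau F x) x) x :=
    (hF.cont.continuousAt.comp h1.neg).clm_apply continuousAt_id
  have h3 : ContinuousAt (fun x => VV G (F (-tau F x) x)) x := hG.VV_cont.continuousAt.comp h2
  exact (hG.cont.continuousAt.comp h1).clm_apply ((h3.inv₀ (hG.VV_pos (hF.F_ne hx _)).ne').smul h2)

lemma GF.bounds (hF : GF F) {ε : ℝ} (hε : 0 < ε) : ∃ C : ℝ, 1 ≤ C ∧
    (∀ t ≤ (0:ℝ), ∀ x, ‖F t x‖ ≤ C * Real.exp ((1-ε)*t) * ‖x‖) ∧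
    (∀ t ≤ (0:ℝ), ∀ x, ‖F (-t) x‖ ≤ C * Real.exp (-((1+ε)*t)) * ‖x‖) := by
  obtain ⟨K, hK⟩ := hF.growth ε hε
  refine ⟨max K 1, le_max_right _ _, fun t ht x => ?_, fun t ht x => ?_⟩
  · refine ((F t).le_opNorm x).trans ?_
    gcongr
    refine (hK t).trans ?_
    rw [abs_of_nonpos ht, show t + ε * -t = (1-ε)*t by ring]
    gcongr; exact le_max_left _ _
  · refine ((F (-t)).le_opNorm x).trans ?_
    gcongr
    refine (hK (-t)).trans ?_
    rw [abs_of_nonneg (by linarith), show -t + ε * -t = -((1+ε)*t) by ring]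
    gcongr; exact le_max_left _ _

lemma hh_point (hF : GF F) (hG : GF G) {ε C M : ℝ} (hC : 1 ≤ C) (hM : 1 ≤ M)
    (hFm : ∀ t ≤ (0:ℝ), ∀ x, ‖F t x‖ ≤ C * Real.exp ((1-ε)*t) * ‖x‖)
    (hFp : ∀ t ≤ (0:ℝ), ∀ x, ‖F (-t) x‖ ≤ C * Real.exp (-((1+ε)*t)) * ‖x‖)
    (hGm : ∀ t ≤ (0:ℝ), ∀ x, ‖G t x‖ ≤ C * Real.exp ((1-ε)*t) * ‖x‖)
    (hMF : ∀ x, VV F x ≤ M * ‖x‖) {x : E} (hx : x ≠ 0) (ht : tau F x ≤ 0) :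
    ‖hh F G x‖ ≤ C * Real.exp ((1-ε) * tau F x) ∧ ‖x‖ ≤ C * Real.exp ((1-ε) * tau F x) ∧
    Real.exp ((1+ε) * tau F x) ≤ M * C * ‖x‖ := by
  have hs := hF.tau_spec hx
  have hp := hG.VV_pos (hF.F_ne hx (-tau F x))
  refine ⟨?_, ?_, ?_⟩
  · refine (hGm _ ht _).trans ?_
    refine mul_le_of_le_one_right (by positivity) ?_
    rw [norm_smul, norm_inv, Real.norm_of_nonneg hp.le, inv_mul_le_iff₀ hp, mul_one]
    exact hG.norm_le_VV _
  · have h1 := hFm _ ht (F (-tau F x) x)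
    rw [hF.inv] at h1
    refine h1.trans (mul_le_of_le_one_right (by positivity) ?_)
    rw [← hs]; exact hF.norm_le_VV _
  · have h1 := hMF (F (-tau F x) x)
    rw [hs] at h1
    have h2 := hFp _ ht x
    have h3 : 1 ≤ M * (C * Real.exp (-((1+ε) * tau F x)) * ‖x‖) := h1.trans (by gcongr)
    calc Real.exp ((1+ε) * tau F x) = Real.exp ((1+ε) * tau F x) * 1 := by ring
      _ ≤ Real.exp ((1+ε) * tau F x) * (M * (C * Real.exp (-((1+ε) * tau F x)) * ‖x‖)) := by gcongr
      _ = (Real.exp ((1+ε) * tau F x) * Real.exp (-((1+ε) * tau F x))) * (M * C * ‖x‖) := by ring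
      _ = _ := by rw [← Real.exp_add]; simp

lemma proj_lip (hF : GF F) (hG : GF G) {M : ℝ} (hM : 1 ≤ M)
    (hMF : ∀ x, VV F x ≤ M * ‖x‖) (hMG : ∀ x, VV G x ≤ M * ‖x‖) {s s' : E}
    (hs : VV F s = 1) (hs' : VV F s' = 1) :
    ‖(VV G s)⁻¹ • s - (VV G s')⁻¹ • s'‖ ≤ 2 * M^2 * ‖s - s'‖ := by
  have hne : ∀ z, VV F z = 1 → 1 ≤ M * VV G z := fun z hz => by
    have := hMF z
    rw [hz] at this
    exact this.trans (by gcongr; exact hG.norm_le_VV z)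
  have h1 := hne s hs
  have h2 := hne s' hs'
  have hp : 0 < VV G s := by by_contra h; nlinarith
  have hp' : 0 < VV G s' := by by_contra h; nlinarith
  have hi : (VV G s)⁻¹ ≤ M := by rw [inv_le_iff_one_le_mul₀ hp]; linarith
  have habs := hG.VV_abs hMG s s'
  have e : (VV G s)⁻¹ • s - (VV G s')⁻¹ • s' =
      (VV G s)⁻¹ • (s - s') + ((VV G s)⁻¹ * (VV G s' - VV G s)) • ((VV G s')⁻¹ • s') := by
    rw [smul_sub, smul_smul, mul_sub, inv_mul_cancel₀ hp.ne', sub_mul, mul_assoc, mul_inv_cancel₀ hp'.ne', sub_smul]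
    simp
  have hn : ‖(VV G s')⁻¹ • s'‖ ≤ 1 := by
    rw [norm_smul, norm_inv, Real.norm_of_nonneg hp'.le, inv_mul_le_iff₀ hp', mul_one]
    exact hG.norm_le_VV _
  rw [e]
  calc _ ≤ ‖(VV G s)⁻¹ • (s - s')‖ + ‖((VV G s)⁻¹ * (VV G s' - VV G s)) • ((VV G s')⁻¹ • s')‖ := norm_add_le _ _
    _ = (VV G s)⁻¹ * ‖s - s'‖ + (VV G s)⁻¹ * |VV G s' - VV G s| * ‖(VV G s')⁻¹ • s'‖ := by
      rw [norm_smul, norm_smul, norm_mul, norm_inv, Real.norm_of_nonneg hp.le, Real.norm_eq_abs]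
    _ ≤ M * ‖s - s'‖ + M * (M * ‖s - s'‖) * 1 := by
      rw [abs_sub_comm] at habs
      gcongr
    _ ≤ _ := by nlinarith [mul_nonneg (sub_nonneg.2 hM) (norm_nonneg (s - s')), norm_nonneg (s-s')]

lemma hh_pair (hF : GF F) (hG : GF G) {ε C M L θ : ℝ} (hε : 0 < ε) (hε1 : ε < 1)
    (hθ : θ = (1-ε)/(1+ε)) (hC : 1 ≤ C) (hM : 1 ≤ M) (hL : 0 ≤ L)
    (hFm : ∀ t ≤ (0:ℝ), ∀ x, ‖F t x‖ ≤ C * Real.exp ((1-ε)*t) * ‖x‖)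
    (hFp : ∀ t ≤ (0:ℝ), ∀ x, ‖F (-t) x‖ ≤ C * Real.exp (-((1+ε)*t)) * ‖x‖)
    (hGm : ∀ t ≤ (0:ℝ), ∀ x, ‖G t x‖ ≤ C * Real.exp ((1-ε)*t) * ‖x‖)
    (hMF : ∀ x, VV F x ≤ M * ‖x‖) (hMG : ∀ x, VV G x ≤ M * ‖x‖)
    (hLF : ∀ t, 0 ≤ t → t ≤ 1 → ∀ x, ‖F t x - x‖ ≤ L * t * ‖x‖)
    (hLG : ∀ t, 0 ≤ t → t ≤ 1 → ∀ x, ‖G t x - x‖ ≤ L * t * ‖x‖) :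
    ∃ K : ℝ, 0 ≤ K ∧ ∀ x y : E, x ≠ 0 → y ≠ 0 → x ≠ y → tau F x ≤ 0 → tau F y ≤ tau F x → ‖x - y‖ ≤ 1 →
      ‖hh F G x - hh F G y‖ ≤ K * ‖x - y‖ ^ (θ * θ) := by
  have hθ0 : 0 < θ := by rw [hθ]; apply div_pos <;> linarith
  have hθ1 : θ ≤ 1 := by rw [hθ, div_le_one (by linarith)]; linarith
  let K1 := L * 2 + 2 * M^2 * (L * 2 + 1)
  let N := 2 * (M * C)
  let N2 := M * C * (1 + C * N)
  have hMC : 1 ≤ M * C := one_le_mul_of_one_le_of_one_le hM hC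
  have hN : 1 ≤ N := by simp only [N]; linarith
  have hCN : 1 ≤ C * N := one_le_mul_of_one_le_of_one_le hC hN
  have hN2 : 1 ≤ N2 := one_le_mul_of_one_le_of_one_le hMC (by linarith)
  have hK1 : 0 ≤ K1 := by positivity
  refine ⟨C * K1 * (M * C) + (C * N + C * N2), by positivity, fun x y hx hy hxy htx hts hδ1 => ?_⟩
  have hδ : 0 < ‖x - y‖ := norm_pos_iff.2 (sub_ne_zero.2 hxy)
  have hty : tau F y ≤ 0 := hts.trans htx
  set δ := ‖x - y‖ with hδdef
  set τ := tau F x with hτ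
  set τ' := tau F y with hτ'
  set D := Real.exp ((1+ε)*τ') with hD
  have hDpos : 0 < D := Real.exp_pos _
  have hexp : ∀ t : ℝ, Real.exp ((1-ε)*t) = Real.exp ((1+ε)*t) ^ θ := fun t => by
    rw [← Real.exp_mul, hθ]; congr 1
    have : (1+ε) ≠ 0 := by linarith
    field_simp
  have hDθ : Real.exp ((1-ε)*τ') = D ^ θ := hexp τ'
  have hδθ : δ ^ θ ≤ δ ^ (θ * θ) := Real.rpow_le_rpow_of_exponent_ge hδ hδ1 (by nlinarith)
  set w := M * C * (δ / D) with hw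
  have hw0 : 0 ≤ w := by positivity
  have hsx := hF.tau_spec hx
  have hsy := hF.tau_spec hy
  rw [← hτ] at hsx
  rw [← hτ'] at hsy
  obtain ⟨px1, px2, px3⟩ := hh_point hF hG hC hM hFm hFp hGm hMF hx htx
  obtain ⟨py1, py2, py3⟩ := hh_point hF hG hC hM hFm hFp hGm hMF hy hty
  rw [← hτ, hexp] at px1 px2
  rw [← hτ] at px3
  rw [← hτ', hexp] at py1 py2
  rw [← hτ'] at py3
  -- flowing the difference
  have hdiff : ‖F (-τ') (x - y)‖ ≤ C * (δ / D) := by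
    refine (hFp _ hty _).trans_eq ?_
    rw [Real.exp_neg, ← hD, ← hδdef]; field_simp
  have hfl : F (τ - τ') (F (-τ) x) = F (-τ') x := by
    rw [← hF.add]; congr 2; ring
  have hτw : (τ - τ') / 2 ≤ w := by
    have h1 := hF.VV_flow' (F (-τ) x) (s := τ - τ') (by linarith)
    rw [hfl, hsx, mul_one] at h1
    have h2 := hF.VV_add (F (-τ') (x - y)) (F (-τ') y)
    rw [← map_add, sub_add_cancel, hsy] at h2
    have h3 := hMF (F (-τ') (x - y))
    have h4 : M * ‖F (-τ') (x - y)‖ ≤ w := by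
      rw [hw, mul_assoc]; gcongr
    have := Real.add_one_le_exp ((τ - τ')/2)
    linarith
  by_cases hcase : w ≤ 1/2
  · have ht1 : τ - τ' ≤ 1 := by linarith
    have hs1 : ‖F (-τ) x‖ ≤ 1 := by rw [← hsx]; exact hF.norm_le_VV _
    have hCw : C * (δ / D) ≤ w := by
      rw [hw, mul_assoc]; exact le_mul_of_one_le_left (by positivity) hM
    have hss : ‖F (-τ) x - F (-τ') y‖ ≤ (L * 2 + 1) * w := by
      have e : F (-τ) x - F (-τ') y = -(F (τ - τ') (F (-τ) x) - F (-τ) x) + F (-τ') (x - y) := by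
        rw [hfl, map_sub]; abel
      rw [e]
      refine (norm_add_le _ _).trans ?_
      rw [norm_neg]
      have h1 := hLF (τ - τ') (by linarith) ht1 (F (-τ) x)
      have h2 : L * (τ - τ') * ‖F (-τ) x‖ ≤ L * (2 * w) * 1 := by
        gcongr; linarith
      linarith
    set P := (VV G (F (-τ) x))⁻¹ • F (-τ) x with hP
    set P' := (VV G (F (-τ') y))⁻¹ • F (-τ') y with hP'
    have hPP : ‖P - P'‖ ≤ 2 * M^2 * ((L * 2 + 1) * w) :=
      (proj_lip hF hG hM hMF hMG hsx hsy).trans (by gcongr)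
    have hPn : ‖P‖ ≤ 1 := by
      have hp := hG.VV_pos (hF.F_ne hx (-τ))
      rw [hP, norm_smul, norm_inv, Real.norm_of_nonneg hp.le, inv_mul_le_iff₀ hp, mul_one]
      exact hG.norm_le_VV _
    have e2 : hh F G x - hh F G y = G τ' ((G (τ - τ') P - P) + (P - P')) := by
      rw [sub_add_sub_cancel, map_sub, ← hG.add, show τ' + (τ - τ') = τ by ring]; rfl
    have h3 : ‖(G (τ - τ') P - P) + (P - P')‖ ≤ K1 * w := by
      refine (norm_add_le _ _).trans ?_
      have h1 := hLG (τ - τ') (by linarith) ht1 P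
      have h2 : L * (τ - τ') * ‖P‖ ≤ L * (2 * w) * 1 := by
        gcongr; linarith
      simp only [K1]; linarith
    have hδD : δ / D ≤ 1 := by
      have : δ / D ≤ w := le_mul_of_one_le_left (by positivity) hMC
      linarith
    have h4 : D ^ θ * (δ / D) ≤ δ ^ θ := by
      have h5 : δ / D ≤ (δ / D) ^ θ := by
        have := Real.rpow_le_rpow_of_exponent_ge (by positivity) hδD hθ1
        rwa [Real.rpow_one] at this
      calc _ ≤ D ^ θ * (δ / D) ^ θ := by gcongr
        _ = δ ^ θ := by
          rw [← Real.mul_rpow hDpos.le (by positivity)]; congr 1; field_simp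
    calc _ = ‖G τ' ((G (τ - τ') P - P) + (P - P'))‖ := by rw [e2]
      _ ≤ C * D ^ θ * ‖(G (τ - τ') P - P) + (P - P')‖ := by rw [← hDθ]; exact hGm _ hty _
      _ ≤ C * D ^ θ * (K1 * w) := by gcongr
      _ = C * K1 * (M * C) * (D ^ θ * (δ / D)) := by rw [hw]; ring
      _ ≤ C * K1 * (M * C) * δ ^ (θ * θ) := by gcongr; exact h4.trans hδθ
      _ ≤ _ := by gcongr; have : 0 ≤ C * N + C * N2 := by positivity
                  linarith
  · push Not at hcase
    have hDN : D ≤ N * δ := by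
      have h : 1/2 * D < M * C * (δ / D) * D := by gcongr
      rw [mul_assoc, div_mul_cancel₀ _ hDpos.ne'] at h
      simp only [N]; linarith
    have hpow : ∀ a b c : ℝ, 0 < a → 1 ≤ b → 0 < c → a ≤ b * c → a ^ θ ≤ b * c ^ θ := by
      intro a b c ha hb hc h
      calc a ^ θ ≤ (b * c) ^ θ := by gcongr
        _ = b ^ θ * c ^ θ := Real.mul_rpow (by linarith) hc.le
        _ ≤ b * c ^ θ := by
          gcongr
          have := Real.rpow_le_rpow_of_exponent_le hb hθ1
          rwa [Real.rpow_one] at this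
    have hD2 := hpow D N δ hDpos hN hδ hDN
    have hδ2 : δ ≤ δ ^ θ := by
      have := Real.rpow_le_rpow_of_exponent_ge hδ hδ1 hθ1
      rwa [Real.rpow_one] at this
    have hxn : ‖x‖ ≤ (1 + C * N) * δ ^ θ := by
      have h1 : ‖x‖ ≤ ‖x - y‖ + ‖y‖ := by
        have := norm_add_le (x - y) y
        rwa [sub_add_cancel] at this
      have h2 : C * D ^ θ ≤ C * (N * δ ^ θ) := by gcongr
      have h3 : ‖y‖ ≤ C * D ^ θ := py2
      linarith
    have hDx : Real.exp ((1+ε)*τ) ≤ N2 * δ ^ θ := by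
      refine px3.trans ?_
      simp only [N2]; rw [mul_assoc (M * C) (1 + C * N)]; gcongr
    have hDx2 := hpow _ _ _ (Real.exp_pos _) hN2 (by positivity) hDx
    rw [← Real.rpow_mul hδ.le] at hDx2
    calc _ ≤ ‖hh F G x‖ + ‖hh F G y‖ := norm_sub_le _ _
      _ ≤ C * (N2 * δ ^ (θ * θ)) + C * (N * δ ^ (θ * θ)) := by
        refine add_le_add (px1.trans (by gcongr)) (py1.trans ?_)
        have : D ^ θ ≤ N * δ ^ (θ * θ) := hD2.trans (by gcongr)
        gcongr
      _ = (C * N + C * N2) * δ ^ (θ * θ) := by ring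
      _ ≤ _ := by
        refine mul_le_mul_of_nonneg_right ?_ (by positivity)
        have : 0 ≤ C * K1 * (M * C) := by positivity
        linarith

lemma hh_holder (hF : GF F) (hG : GF G) {γ : ℝ} (hγ : 0 < γ) (hγ1 : γ < 1) :
    ∃ r > (0:ℝ), ∃ K : ℝ, ∀ x ∈ Metric.ball (0:E) r, ∀ y ∈ Metric.ball (0:E) r,
      dist (hh F G x) (hh F G y) ≤ K * dist x y ^ γ := by
  set θ := Real.sqrt γ with hθ
  have hθ0 : 0 < θ := Real.sqrt_pos.2 hγ
  have hθθ : θ * θ = γ := Real.mul_self_sqrt hγ.le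
  have hθ1 : θ < 1 := by nlinarith
  set ε := (1 - θ)/(1 + θ) with hεdef
  have hε : 0 < ε := by apply div_pos <;> linarith
  have hε1 : ε < 1 := by rw [hεdef, div_lt_one (by linarith)]; linarith
  have hθε : θ = (1 - ε)/(1 + ε) := by
    have : 1 + θ ≠ 0 := by linarith
    have h2 : 1 + ε ≠ 0 := by linarith
    rw [eq_div_iff h2, hεdef]; field_simp; ring
  obtain ⟨C1, hC1, hFm, hFp⟩ := hF.bounds hε
  obtain ⟨C2, hC2, hGm, -⟩ := hG.bounds hε
  obtain ⟨M1, hM1, hMF⟩ := hF.VV_le_norm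
  obtain ⟨M2, hM2, hMG⟩ := hG.VV_le_norm
  obtain ⟨L1, hL1, hLF⟩ := hF.near
  obtain ⟨L2, hL2, hLG⟩ := hG.near
  set C := max C1 C2
  set M := max M1 M2
  set L := max L1 L2
  have hC : 1 ≤ C := hC1.trans (le_max_left _ _)
  have hM : 1 ≤ M := hM1.trans (le_max_left _ _)
  have hL : 0 ≤ L := hL1.trans (le_max_left _ _)
  replace hFm : ∀ t ≤ (0:ℝ), ∀ x, ‖F t x‖ ≤ C * Real.exp ((1-ε)*t) * ‖x‖ :=
    fun t ht x => (hFm t ht x).trans (by gcongr; exact le_max_left _ _)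
  replace hFp : ∀ t ≤ (0:ℝ), ∀ x, ‖F (-t) x‖ ≤ C * Real.exp (-((1+ε)*t)) * ‖x‖ :=
    fun t ht x => (hFp t ht x).trans (by gcongr; exact le_max_left _ _)
  replace hGm : ∀ t ≤ (0:ℝ), ∀ x, ‖G t x‖ ≤ C * Real.exp ((1-ε)*t) * ‖x‖ :=
    fun t ht x => (hGm t ht x).trans (by gcongr; exact le_max_right _ _)
  replace hMF : ∀ x, VV F x ≤ M * ‖x‖ := fun x => (hMF x).trans (by gcongr; exact le_max_left _ _)
  replace hMG : ∀ x, VV G x ≤ M * ‖x‖ := fun x => (hMG x).trans (by gcongr; exact le_max_right _ _)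
  replace hLF : ∀ t, 0 ≤ t → t ≤ 1 → ∀ x, ‖F t x - x‖ ≤ L * t * ‖x‖ :=
    fun t h0 h1 x => (hLF t h0 h1 x).trans (by gcongr; exact le_max_left _ _)
  replace hLG : ∀ t, 0 ≤ t → t ≤ 1 → ∀ x, ‖G t x - x‖ ≤ L * t * ‖x‖ :=
    fun t h0 h1 x => (hLG t h0 h1 x).trans (by gcongr; exact le_max_right _ _)
  obtain ⟨K, hK0, hK⟩ := hh_pair hF hG hε hε1 hθε hC hM hL hFm hFp hGm hMF hMG hLF hLG
  rw [hθθ] at hK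
  have htau : ∀ x : E, x ≠ 0 → ‖x‖ < 1 / (2 * M) → tau F x ≤ 0 := by
    intro x hx hr
    by_contra h
    push Not at h
    have h1 := hF.VV_flow x (s := -tau F x) (by linarith)
    rw [hF.tau_spec hx] at h1
    have h2 := hMF x
    have h3 : Real.exp (-tau F x / 2) ≤ 1 := Real.exp_le_one_iff.2 (by linarith)
    rw [lt_div_iff₀ (by positivity)] at hr
    have h4 := hF.VV_pos hx
    nlinarith
  have hone : ∀ x : E, x ≠ 0 → ‖x‖ < 1 / (2 * M) → ‖hh F G x‖ ≤ C * (M * C) * ‖x‖ ^ γ := by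
    intro x hx hr
    obtain ⟨p1, -, p3⟩ := hh_point hF hG hC hM hFm hFp hGm hMF hx (htau x hx hr)
    have hMC : 1 ≤ M * C := one_le_mul_of_one_le_of_one_le hM hC
    have hx1 : ‖x‖ ≤ 1 := by
      refine hr.le.trans ?_
      rw [div_le_one (by positivity)]; linarith
    have e : Real.exp ((1-ε) * tau F x) = Real.exp ((1+ε) * tau F x) ^ θ := by
      rw [← Real.exp_mul, hθε]; congr 1
      have : (1+ε) ≠ 0 := by linarith
      field_simp
    rw [e] at p1
    refine p1.trans ?_
    rw [mul_assoc C]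
    gcongr
    calc _ ≤ (M * C * ‖x‖) ^ θ := by gcongr
      _ = (M * C) ^ θ * ‖x‖ ^ θ := Real.mul_rpow (by positivity) (norm_nonneg _)
      _ ≤ (M * C) * ‖x‖ ^ γ := by
        have h1 := Real.rpow_le_rpow_of_exponent_le hMC hθ1.le
        rw [Real.rpow_one] at h1
        have h2 := Real.rpow_le_rpow_of_exponent_ge (norm_pos_iff.2 hx) hx1 (show γ ≤ θ by nlinarith)
        exact mul_le_mul h1 h2 (by positivity) (by positivity)
  refine ⟨1 / (2 * M), by positivity, max K (C * (M * C)), fun x hx y hy => ?_⟩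
  rw [mem_ball_zero_iff] at hx hy
  rw [dist_eq_norm, dist_eq_norm]
  have hxy1 : ‖x - y‖ ≤ 1 := by
    have h1 : 1 / (2 * M) ≤ 1/2 := by gcongr; linarith
    exact (norm_sub_le _ _).trans (by linarith)
  by_cases hxy : x = y
  · rw [hxy]; simp [Real.zero_rpow hγ.ne']
  by_cases hx0 : x = 0
  · have hy0 : y ≠ 0 := fun h => hxy (hx0.trans h.symm)
    rw [hx0, hh_zero, zero_sub, zero_sub, norm_neg, norm_neg]
    exact (hone y hy0 hy).trans (by gcongr; exact le_max_right _ _)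
  by_cases hy0 : y = 0
  · rw [hy0, hh_zero, sub_zero, sub_zero]
    exact (hone x hx0 hx).trans (by gcongr; exact le_max_right _ _)
  rcases le_total (tau F y) (tau F x) with h | h
  · exact (hK x y hx0 hy0 hxy (htau x hx0 hx) h hxy1).trans (by gcongr; exact le_max_left _ _)
  · rw [norm_sub_rev, norm_sub_rev x y]
    rw [norm_sub_rev] at hxy1
    exact (hK y x hy0 hx0 (Ne.symm hxy) (htau y hy0 hy) h hxy1).trans (by gcongr; exact le_max_left _ _)

lemma hh_cont (hF : GF F) (hG : GF G) : Continuous (hh F G) := by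
  rw [continuous_iff_continuousAt]
  intro x
  by_cases hx : x = 0
  swap
  · exact hh_contAt hF hG hx
  subst hx
  obtain ⟨r, hr, K, hK⟩ := hh_holder hF hG (γ := 1/2) (by norm_num) (by norm_num)
  rw [ContinuousAt, hh_zero, tendsto_iff_dist_tendsto_zero]
  have h1 : Tendsto (fun x : E => K * dist x 0 ^ (1/2:ℝ)) (𝓝 0) (𝓝 0) := by
    have h2 : Continuous fun x : E => K * dist x 0 ^ (1/2:ℝ) :=
      continuous_const.mul ((continuous_id.dist continuous_const).rpow_const (fun _ => Or.inr (by norm_num)))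
    have := h2.tendsto 0
    simpa using this
  refine squeeze_zero' (Eventually.of_forall fun _ => dist_nonneg) ?_ h1
  filter_upwards [Metric.ball_mem_nhds (0:E) hr] with y hy
  have := hK y hy 0 (Metric.mem_ball_self hr)
  rwa [hh_zero] at this

end flows

lemma exp_facts {E : Type*} [NormedAddCommGroup E] [NormedSpace ℝ E] [CompleteSpace E]
    (T : E →L[ℝ] E) :
    (∀ x, NormedSpace.exp ((0:ℝ) • T) x = x) ∧
    (∀ (s t : ℝ) x, NormedSpace.exp ((s + t) • T) x =
      NormedSpace.exp (s • T) (NormedSpace.exp (t • T) x)) ∧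
    (Continuous fun t : ℝ => NormedSpace.exp (t • T)) ∧
    ∃ L : ℝ, 0 ≤ L ∧ ∀ t : ℝ, 0 ≤ t → t ≤ 1 → ∀ x, ‖NormedSpace.exp (t • T) x - x‖ ≤ L * t * ‖x‖ := by
  let : NormedAlgebra ℚ (E →L[ℝ] E) := NormedAlgebra.restrictScalars ℚ ℝ _
  have hder : ∀ t : ℝ, HasDerivAt (fun t : ℝ => NormedSpace.exp (t • T)) (NormedSpace.exp (t • T) * T) t :=
    fun t => hasDerivAt_exp_smul_const T t
  have hcont : Continuous fun t : ℝ => NormedSpace.exp (t • T) :=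
    continuous_iff_continuousAt.2 fun t => (hder t).continuousAt
  refine ⟨?_, ?_, hcont, ?_⟩
  · intro x
    rw [zero_smul, NormedSpace.exp_zero]; rfl
  · intro s t x
    rw [add_smul, NormedSpace.exp_add_of_commute]
    · rfl
    · exact ((Commute.refl T).smul_left s).smul_right t
  · obtain ⟨L, hL⟩ := (isCompact_Icc (a := (0:ℝ)) (b := 1)).exists_bound_of_continuousOn
      (f := fun t : ℝ => NormedSpace.exp (t • T) * T) (hcont.mul continuous_const).continuousOn
    refine ⟨L, (norm_nonneg _).trans (hL 0 (by simp)), fun t h0 h1 x => ?_⟩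
    have h := (convex_Icc (0:ℝ) 1).norm_image_sub_le_of_norm_hasDerivWithin_le
      (fun s _ => (hder s).hasDerivWithinAt) hL (x := 0) (y := t) (by simp) ⟨h0, h1⟩
    simp only [zero_smul, NormedSpace.exp_zero, sub_zero, Real.norm_of_nonneg h0] at h
    have h2 := (NormedSpace.exp (t • T) - 1).le_opNorm x
    calc _ = ‖(NormedSpace.exp (t • T) - 1) x‖ := rfl
      _ ≤ _ := h2.trans (by gcongr)

lemma gf_of_matrix (A : Matrix (Fin d) (Fin d) ℝ) (a : ℝ) (ha0 : a ≠ 0) (ha : ∀ z ∈ cSpec A, z.re = a) :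
    GF (fun t : ℝ => Matrix.toEuclideanCLM (𝕜 := ℝ) (n := Fin d) (NormedSpace.exp ((t / a) • A))) := by
  have hexp : ∀ t : ℝ, Matrix.toEuclideanCLM (𝕜 := ℝ) (n := Fin d) (NormedSpace.exp ((t / a) • A)) =
      NormedSpace.exp (t • Matrix.toEuclideanCLM (𝕜 := ℝ) (n := Fin d) (a⁻¹ • A)) := by
    intro t
    open scoped Matrix.Norms.L2Operator in
    let : NormedAlgebra ℚ (Matrix (Fin d) (Fin d) ℝ) := NormedAlgebra.restrictScalars ℚ ℝ _
    let : NormedAlgebra ℚ (Euc d →L[ℝ] Euc d) := NormedAlgebra.restrictScalars ℚ ℝ _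
    have hc : Continuous (fun M : Matrix (Fin d) (Fin d) ℝ => Matrix.toEuclideanCLM (𝕜 := ℝ) (n := Fin d) M) := by
      let T : Matrix (Fin d) (Fin d) ℝ →ₗ[ℝ] (Euc d →L[ℝ] Euc d) :=
       { toFun := fun M => Matrix.toEuclideanCLM (𝕜 := ℝ) (n := Fin d) M
         map_add' := map_add _
         map_smul' := map_smul _ }
      exact T.continuous_of_finiteDimensional
    rw [NormedSpace.map_exp _ hc, ← map_smul, smul_smul, div_eq_mul_inv]
  obtain ⟨e0, ea, ec, en⟩ := exp_facts (E := Euc d) (Matrix.toEuclideanCLM (𝕜 := ℝ) (n := Fin d) (a⁻¹ • A))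
  refine ⟨?_, ?_, ?_, ?_, ?_⟩
  · intro x; simp only [hexp]; exact e0 x
  · intro s t x
    simp only [hexp]
    exact ea s t x
  · simp only [hexp]; exact ec
  · intro ε hε
    obtain ⟨K, hK⟩ := growth A a ha (ε * |a|) (by positivity)
    refine ⟨K, fun t => (hK (t / a)).trans_eq ?_⟩
    rw [abs_div]
    congr 2
    have : |a| ≠ 0 := abs_ne_zero.2 ha0
    field_simp
  · simp only [hexp]; exact en

/-- **Proposition 4.5**: any two irreducible linear flows on `ℝ^d` whose spectra avoid the
imaginary axis are all-Hölder equivalent. -/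
theorem irreducible_allHolder_equiv {d : ℕ} (A B : Matrix (Fin d) (Fin d) ℝ)
    (hA : IsIrreducibleFlow A) (hB : IsIrreducibleFlow B)
    (hsA : ∀ z ∈ cSpec A, z.re ≠ 0) (hsB : ∀ z ∈ cSpec B, z.re ≠ 0) :
    RelEquivWith MemH1minus A B := by
  obtain ⟨a, ha0, ha⟩ := re_eq A hA hsA
  obtain ⟨b, hb0, hb⟩ := re_eq B hB hsB
  have hF := gf_of_matrix A a ha0 ha
  have hG := gf_of_matrix B b hb0 hb
  set F := fun t : ℝ => Matrix.toEuclideanCLM (𝕜 := ℝ) (n := Fin d) (NormedSpace.exp ((t / a) • A)) with hFdef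
  set G := fun t : ℝ => Matrix.toEuclideanCLM (𝕜 := ℝ) (n := Fin d) (NormedSpace.exp ((t / b) • B)) with hGdef
  have orbA : ∀ x, flowOrbit A x = Set.range fun t => F t x := by
    intro x
    ext z
    constructor
    · rintro ⟨t, rfl⟩
      exact ⟨t * a, by simp only [hFdef, mul_div_cancel_right₀ _ ha0, linFlow_eq]⟩
    · rintro ⟨t, rfl⟩
      exact ⟨t / a, rfl⟩
  have orbB : ∀ x, flowOrbit B x = Set.range fun t => G t x := by
    intro x
    ext z
    constructor
    · rintro ⟨t, rfl⟩
      exact ⟨t * b, by simp only [hGdef, mul_div_cancel_right₀ _ hb0, linFlow_eq]⟩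
    · rintro ⟨t, rfl⟩
      exact ⟨t / b, rfl⟩
  let h : Euc d ≃ₜ Euc d :=
    { toFun := hh F G
      invFun := hh G F
      left_inv := hh_inv hF hG
      right_inv := hh_inv hG hF
      continuous_toFun := hh_cont hF hG
      continuous_invFun := hh_cont hG hF }
  refine ⟨h, fun γ h0 h1 => ⟨(hh_zero : hh F G 0 = 0), hh_holder hF hG h0 h1, hh_holder hG hF h0 h1⟩, fun x => ?_⟩
  rw [orbA, orbB, ← Set.range_comp]
  congr 1
  ext1 t
  exact hh_flow hF hG t x

end LF
end
end

section
/- Let m ∈ ℕ and a, b ∈ ℝ^m with a_1 ≤ … ≤ a_m < 0 and b_1 ≤ … ≤ b_m < 0, and let Φ, Ψ be the linear flows on ℝ^m generated by diag[a_1,…,a_m] and diag[b_1,…,b_m], respectively. For every 0 < β < 1 the following are equivalent: (i) Φ ≃^{β} Ψ, i.e. there exist h ∈ 𝓗_β(ℝ^m) and α ∈ ℝ∖{0} with h(Φ_t x) = Ψ_{αt} h(x) for all t, x; (ii) Φ ~^{β⁻} Ψ, i.e. Φ is h-related to Ψ for some h ∈ 𝓗_{β⁻}(ℝ^m); (iii)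 β² ≤ (min_{1≤j≤m} a_j/b_j) / (max_{1≤j≤m} a_j/b_j). -/
noncomputable section
namespace LF

open Filter Topology

variable {d : ℕ}

section Brouwer
variable {E : Type} [NormedAddCommGroup E] [InnerProductSpace ℝ E] [FiniteDimensional ℝ E]

lemma det_poly (n : ℕ) (hn : Module.finrank ℝ E = n) (M : E →L[ℝ] E) :
    ∃ p : Polynomial ℝ, p.natDegree ≤ n ∧
      ∀ t : ℝ, p.eval t = (ContinuousLinearMap.id ℝ E + t • M).det := by
  let bs := Module.finBasisOfFinrankEq ℝ E hn
  let A := LinearMap.toMatrix bs bs (M : E →ₗ[ℝ] E)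
  refine ⟨(Polynomial.X • A.map Polynomial.C + (1 : Matrix (Fin n) (Fin n) ℝ).map Polynomial.C).det,
    by simpa using Polynomial.natDegree_det_X_add_C_le A 1, fun t => ?_⟩
  rw [← Polynomial.coe_evalRingHom, RingHom.map_det, ContinuousLinearMap.det,
    ← LinearMap.det_toMatrix bs]
  congr 1
  ext i j
  simp [A, Matrix.one_apply, add_comm]
  split_ifs <;> simp [LinearMap.toMatrix_apply, *, mul_comm]

lemma det_interp (n : ℕ) (hn : Module.finrank ℝ E = n) (v : ℕ → ℝ) (hv : Function.Injective v) :
    ∃ c : ℕ → ℝ, (∑ k ∈ Finset.range (n+1), c k = 1) ∧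
     ∀ M : E →L[ℝ] E, (ContinuousLinearMap.id ℝ E + M).det =
      ∑ k ∈ Finset.range (n+1), c k * (ContinuousLinearMap.id ℝ E + v k • M).det := by
  have key : ∀ p : Polynomial ℝ, p.natDegree ≤ n → p.eval 1 = ∑ k ∈ Finset.range (n+1),
      (Lagrange.basis (Finset.range (n+1)) v k).eval 1 * p.eval (v k) := by
    intro p hp
    conv_lhs => rw [Lagrange.eq_interpolate (s := Finset.range (n+1)) (v := v) (f := p) hv.injOn
      (by
        rw [Finset.card_range]
        exact lt_of_le_of_lt Polynomial.degree_le_natDegree (by exact_mod_cast Nat.lt_succ_of_le hp))]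
    rw [Lagrange.interpolate_apply, Polynomial.eval_finsetSum]
    simp [mul_comm]
  refine ⟨fun k => (Lagrange.basis (Finset.range (n+1)) v k).eval 1, ?_, fun M => ?_⟩
  · have := key 1 (by simp)
    simpa using this.symm
  · obtain ⟨p, hp, hpe⟩ := det_poly n hn M
    have := key p hp
    simpa [hpe] using this

set_option maxHeartbeats 1000000 in
lemma no_retraction (r : E → E) (hr : ContDiff ℝ 1 r) (h1 : ∀ x, ‖r x‖ = 1)
    (h2 : ∀ x, ‖x‖ = 1 → r x = x) : False := by
  classical
  have hnt : Nontrivial E := ⟨⟨r 0, 0, by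
    intro h; have := h1 0; rw [h, norm_zero] at this; norm_num at this⟩⟩
  let _ : MeasurableSpace E := borel E
  have : BorelSpace E := ⟨rfl⟩
  let C : Set E := Metric.closedBall 0 1
  have hCm : MeasurableSet C := Metric.isClosed_closedBall.measurableSet
  have hCc : IsCompact C := isCompact_closedBall 0 1
  let G0 : E → E := fun x => r x - x
  have hG0 : ContDiff ℝ 1 G0 := hr.sub contDiff_id
  obtain ⟨L, hL⟩ := LocallyLipschitzOn.exists_lipschitzOnWith_of_compact hCc
    (hG0.locallyLipschitz.locallyLipschitzOn)
  let G : E → E := fun x => if ‖x‖ ≤ 1 then G0 x else 0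
  have hmix : ∀ x y : E, ‖x‖ ≤ 1 → ¬ ‖y‖ ≤ 1 → ‖G0 x‖ ≤ 2 * L * ‖x - y‖ := by
    intro x y hx hy
    push Not at hy
    have hy0 : 0 < ‖y‖ := by linarith
    let z := (‖y‖⁻¹) • y
    have hz : ‖z‖ = 1 := by
      simp only [z, norm_smul, norm_inv, norm_norm]; field_simp
    have hGz : G0 z = 0 := by simp [G0, h2 z hz]
    have h3 : ‖G0 x - G0 z‖ ≤ L * ‖x - z‖ := hL.norm_sub_le (by simpa [C] using hx) (by simp [C, hz])
    rw [hGz, sub_zero] at h3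
    have h4 : ‖y - z‖ = ‖y‖ - 1 := by
      have : y - z = (1 - ‖y‖⁻¹) • y := by simp [z, sub_smul]
      rw [this, norm_smul, Real.norm_of_nonneg]
      · field_simp
      · have : ‖y‖⁻¹ ≤ 1 := inv_le_one_of_one_le₀ hy.le
        linarith
    have h5 : ‖y‖ - ‖x‖ ≤ ‖x - y‖ := by rw [norm_sub_rev]; exact norm_sub_norm_le y x
    have h6 : ‖x - z‖ ≤ ‖x - y‖ + ‖y - z‖ := norm_sub_le_norm_sub_add_norm_sub x y z
    have : ‖x - z‖ ≤ 2 * ‖x - y‖ := by linarith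
    calc _ ≤ _ := h3
      _ ≤ L * (2 * ‖x - y‖) := by gcongr
      _ = _ := by ring
  have hGL : ∀ x y, ‖G x - G y‖ ≤ 2 * L * ‖x - y‖ := by
    intro x y
    by_cases hx : ‖x‖ ≤ 1 <;> by_cases hy : ‖y‖ ≤ 1
    · simp only [G, hx, hy, if_true]
      have := hL.norm_sub_le (show x ∈ C by simpa [C] using hx) (show y ∈ C by simpa [C] using hy)
      have h0 : 0 ≤ L * ‖x - y‖ := by positivity
      linarith
    · simp only [G, hx, hy, if_true, if_false, sub_zero]
      exact hmix x y hx hy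
    · simp only [G, hx, hy, if_true, if_false, zero_sub, norm_neg]
      rw [norm_sub_rev x y]
      exact hmix y x hy hx
    · simp only [G, hx, hy, if_false, sub_self, norm_zero]; positivity
  -- bound on derivative
  have hdc : Continuous (fderiv ℝ G0) := hG0.continuous_fderiv (by norm_num)
  obtain ⟨B, hB⟩ := hCc.exists_bound_of_continuousOn hdc.continuousOn
  -- det positive near identity
  have hc : Continuous fun A : E →L[ℝ] E => (ContinuousLinearMap.id ℝ E + A).det :=
      ContinuousLinearMap.continuous_det.comp (continuous_const.add continuous_id)
  have hdet : ∃ ε > 0, ∀ A : E →L[ℝ] E, ‖A‖ < ε → 0 < (ContinuousLinearMap.id ℝ E + A).det := by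
    have h0 : 0 < (ContinuousLinearMap.id ℝ E + 0).det := by
      simp [ContinuousLinearMap.det]
    have := (hc.tendsto 0).eventually (lt_mem_nhds h0)
    obtain ⟨ε, hε, h⟩ := Metric.eventually_nhds_iff.1 this
    exact ⟨ε, hε, fun A hA => h (by simpa using hA)⟩
  obtain ⟨ε, hε, hdet⟩ := hdet
  have hB0 : 0 ≤ B := le_trans (norm_nonneg _) (hB 0 (by simp [C]))
  -- small time
  let δ : ℝ := min (1 / (2 * (L:ℝ) + 1)) (ε / (B + 1)) / 2
  have hL0 : (0:ℝ) ≤ L := L.2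
  have hδ : 0 < δ := by positivity
  let v : ℕ → ℝ := fun k => δ / (k + 1)
  have hv0 : ∀ k, 0 < v k := fun k => by positivity
  have hvδ : ∀ k, v k ≤ δ := fun k => div_le_self hδ.le (by linarith [Nat.cast_nonneg (α := ℝ) k])
  have hvinj : Function.Injective v := by
    intro k l hkl
    simp only [v] at hkl
    have hk : (0:ℝ) < k + 1 := by positivity
    have hl : (0:ℝ) < l + 1 := by positivity
    rw [div_eq_div_iff hk.ne' hl.ne'] at hkl
    have := mul_left_cancel₀ hδ.ne' hkl
    have : (l:ℝ) = k := by linarith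
    exact_mod_cast this.symm
  have hδ1 : δ * (2 * L) < 1 := by
    have : δ < 1 / (2 * L + 1) := by
      have h := min_le_left (1 / (2 * (L:ℝ) + 1)) (ε / (B + 1))
      have : 0 < 1 / (2 * (L:ℝ) + 1) := by positivity
      simp only [δ]; linarith
    rw [lt_div_iff₀ (by positivity)] at this
    linarith
  have hδ2 : δ * B < ε := by
    have : δ < ε / (B + 1) := by
      have h := min_le_right (1 / (2 * (L:ℝ) + 1)) (ε / (B + 1))
      have : 0 < ε / (B + 1) := by positivity
      simp only [δ]; linarith
    rw [lt_div_iff₀ (by positivity)] at this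
    linarith
  let μ : MeasureTheory.Measure E := MeasureTheory.Measure.addHaar
  have hvol : ∀ k, ∫ x in C, (ContinuousLinearMap.id ℝ E + v k • fderiv ℝ G0 x).det ∂μ
      = μ.real C := by
    intro k
    let t := v k
    let φ : E → E := fun x => x + t • G x
    have ht0 : 0 < t := hv0 k
    have htδ : t ≤ δ := hvδ k
    have happ : ApproximatesLinearOn φ ((ContinuousLinearEquiv.refl ℝ E : E ≃L[ℝ] E) : E →L[ℝ] E)
        Set.univ (Real.toNNReal t * (2 * L)) := by
      intro x _ y _
      have : φ x - φ y - (x - y) = t • (G x - G y) := by simp only [φ, smul_sub]; abel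
      simp only [ContinuousLinearEquiv.coe_refl, ContinuousLinearMap.coe_id', id]
      rw [this, norm_smul, Real.norm_of_nonneg ht0.le]
      push_cast
      calc _ ≤ t * (2 * L * ‖x - y‖) := by gcongr; exact hGL x y
        _ = _ := by rw [Real.coe_toNNReal _ ht0.le]; ring
    have hc : Subsingleton E ∨ (Real.toNNReal t * (2 * L) : NNReal) <
        ‖((ContinuousLinearEquiv.refl ℝ E : E ≃L[ℝ] E).symm : E →L[ℝ] E)‖₊⁻¹ := by
      right
      have h1 : ‖((ContinuousLinearEquiv.refl ℝ E : E ≃L[ℝ] E).symm : E →L[ℝ] E)‖₊ = 1 := by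
        simp 
      rw [h1, inv_one, ← NNReal.coe_lt_coe]
      push_cast
      calc _ ≤ δ * (2 * L) := by rw [Real.coe_toNNReal _ ht0.le]; gcongr
        _ < 1 := hδ1
    have hsurj : Function.Surjective φ := happ.surjective hc
    have hinj : Function.Injective φ := by
      have := happ.injective hc
      intro x y hxy
      have h := @this ⟨x, trivial⟩ ⟨y, trivial⟩ hxy
      exact congrArg Subtype.val h
    have hout : ∀ x, x ∉ C → φ x = x := by
      intro x hx
      have : ¬ ‖x‖ ≤ 1 := by simpa [C] using hx
      simp [φ, G, this]
    have himg : φ '' C = C := by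
      ext y
      constructor
      · rintro ⟨x, hx, rfl⟩
        by_contra h
        have := hinj (hout _ h)
        rw [this] at h
        exact h hx
      · intro hy
        obtain ⟨x, rfl⟩ := hsurj y
        refine ⟨x, ?_, rfl⟩
        by_contra h
        rw [hout x h] at hy
        exact h hy
    have hder : ∀ x ∈ C, HasFDerivWithinAt φ (ContinuousLinearMap.id ℝ E + t • fderiv ℝ G0 x) C x := by
      intro x hx
      have h3 : HasFDerivAt (fun x => x + t • G0 x) (ContinuousLinearMap.id ℝ E + t • fderiv ℝ G0 x) x :=
        (hasFDerivAt_id x).add ((hG0.differentiable (by norm_num) x).hasFDerivAt.const_smul t)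
      refine h3.hasFDerivWithinAt.congr (fun y hy => ?_) ?_
      · have : ‖y‖ ≤ 1 := by simpa [C] using hy
        simp [φ, G, this]
      · have : ‖x‖ ≤ 1 := by simpa [C] using hx
        simp [φ, G, this]
    have hmain := MeasureTheory.integral_image_eq_integral_abs_det_fderiv_smul μ hCm hder hinj.injOn
      (fun _ => (1:ℝ))
    rw [himg] at hmain
    have h7 : ∫ x in C, |(ContinuousLinearMap.id ℝ E + t • fderiv ℝ G0 x).det| • (1:ℝ) ∂μ =
       ∫ x in C, (ContinuousLinearMap.id ℝ E + t • fderiv ℝ G0 x).det ∂μ := by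
      refine MeasureTheory.setIntegral_congr_fun hCm (fun x hx => ?_)
      have : 0 < (ContinuousLinearMap.id ℝ E + t • fderiv ℝ G0 x).det := by
        apply hdet
        rw [norm_smul, Real.norm_of_nonneg ht0.le]
        calc t * ‖fderiv ℝ G0 x‖ ≤ δ * B := by gcongr; exact hB x hx
          _ < ε := hδ2
      simp [abs_of_pos this]
    rw [h7] at hmain
    rw [← hmain]
    simp
  obtain ⟨c, hc1, hc2⟩ := det_interp (E := E) _ rfl v hvinj
  have hzero : ∀ x, (ContinuousLinearMap.id ℝ E + fderiv ℝ G0 x).det = 0 := by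
    intro x
    have hrd := (hr.differentiable (by norm_num) x).hasFDerivAt
    have h8 : ContinuousLinearMap.id ℝ E + fderiv ℝ G0 x = fderiv ℝ r x := by
      have : HasFDerivAt G0 (fderiv ℝ r x - ContinuousLinearMap.id ℝ E) x :=
        hrd.sub (hasFDerivAt_id x)
      rw [this.fderiv]; abel
    rw [h8]
    by_contra hne
    have h9 : Function.Surjective (fderiv ℝ r x) := by
      have := LinearMap.equivOfDetNeZero (fderiv ℝ r x : E →ₗ[ℝ] E) hne
      have hu : IsUnit (fderiv ℝ r x : E →ₗ[ℝ] E) := by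
        rw [LinearMap.isUnit_iff_isUnit_det]; exact isUnit_iff_ne_zero.2 hne
      exact ((Module.End.isUnit_iff _).1 hu).2
    obtain ⟨w, hw⟩ := h9 (r x)
    have h10 := hrd.norm_sq
    have h11 : HasFDerivAt (fun x => ‖r x‖^2) (0 : E →L[ℝ] ℝ) x := by
      simp only [h1]; exact hasFDerivAt_const _ _
    have h12 := h10.unique h11
    have h13 := congrArg (fun T : E →L[ℝ] ℝ => T w) h12
    simp [hw, h1] at h13
  have hintg : ∀ k, MeasureTheory.IntegrableOn
      (fun x => (ContinuousLinearMap.id ℝ E + v k • fderiv ℝ G0 x).det) C μ := by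
    intro k
    apply ContinuousOn.integrableOn_compact hCc
    have h20 : Continuous fun x => v k • fderiv ℝ G0 x := hdc.const_smul (v k)
    exact (hc.comp h20).continuousOn
  have hfin : ∫ x in C, (ContinuousLinearMap.id ℝ E + fderiv ℝ G0 x).det ∂μ = μ.real C := by
    have h21 : (fun x => (ContinuousLinearMap.id ℝ E + fderiv ℝ G0 x).det) = fun x =>
        ∑ k ∈ Finset.range (Module.finrank ℝ E + 1),
          c k * (ContinuousLinearMap.id ℝ E + v k • fderiv ℝ G0 x).det :=
      funext fun x => hc2 _
    rw [h21, MeasureTheory.integral_finsetSum _ (fun k _ => (hintg k).const_mul _)]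
    simp only [MeasureTheory.integral_const_mul, hvol]
    rw [← Finset.sum_mul, hc1, one_mul]
  simp only [hzero, MeasureTheory.integral_zero] at hfin
  have : 0 < μ.real C := by
    apply ENNReal.toReal_pos
    · exact (Metric.measure_closedBall_pos μ 0 one_pos).ne'
    · exact hCc.measure_lt_top.ne
  linarith

lemma brouwer_zero (u : E → E) (hu : Continuous u) (hne : ∀ x, u x ≠ 0)
    (hclose : ∀ x, ‖x‖ ≤ 1 → ‖u x - x‖ ≤ 1 / 2) : False := by
  obtain ⟨w, hw, hwd, -⟩ := hu.exists_contDiff_approx (ε := fun x => min ‖u x‖ (1/4)) 1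
    (by fun_prop) (fun x => lt_min (norm_pos_iff.2 (hne x)) (by norm_num))
  have hw0 : ∀ x, w x ≠ 0 := by
    intro x h
    have := (hwd x).trans_le (min_le_left _ _)
    rw [h, dist_zero_left] at this
    exact lt_irrefl _ this
  have hwc : ∀ x, ‖x‖ ≤ 1 → ‖w x - x‖ < 3 / 4 := by
    intro x hx
    have h1 := (hwd x).trans_le (min_le_right _ _)
    rw [dist_eq_norm] at h1
    have h2 := norm_sub_le_norm_sub_add_norm_sub (w x) (u x) x
    linarith [hclose x hx]
  let χ : ContDiffBump (0 : E) := ⟨3/4, 1, by norm_num, by norm_num⟩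
  let F : E → E := fun x => x + χ x • (w x - x)
  have hF : ContDiff ℝ 1 F := contDiff_id.add (χ.contDiff.smul (hw.sub contDiff_id))
  have hout : ∀ x, 1 ≤ ‖x‖ → F x = x := by
    intro x hx
    have : χ x = 0 := χ.zero_of_le_dist (by simpa [χ] using hx)
    simp [F, this]
  have hF0 : ∀ x, F x ≠ 0 := by
    intro x
    rcases le_total ‖x‖ (3/4) with h | h
    · have : χ x = 1 := χ.one_of_mem_closedBall (by simpa [χ] using h)
      simpa [F, this] using hw0 x
    · rcases le_total ‖x‖ 1 with h' | h'
      · intro h0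
        have h3 : ‖x‖ = ‖χ x • (w x - x)‖ := by
          rw [← norm_neg]; congr 1
          exact neg_eq_of_add_eq_zero_right h0
        rw [norm_smul, Real.norm_of_nonneg χ.nonneg] at h3
        have h4 := hwc x h'
        have h5 : χ x * ‖w x - x‖ ≤ 1 * ‖w x - x‖ := by gcongr; exact χ.le_one
        linarith
      · rw [hout x h']
        rintro rfl
        norm_num at h'
  refine no_retraction (fun x => ‖F x‖⁻¹ • F x) ?_ ?_ ?_
  · exact ((hF.norm ℝ hF0).inv (fun x => norm_ne_zero_iff.2 (hF0 x))).smul hF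
  · intro x
    have := norm_ne_zero_iff.2 (hF0 x)
    simp only [norm_smul, norm_inv, norm_norm]
    field_simp
  · intro x hx
    simp [hout x hx.ge, hx]

lemma no_injection {F : Type} [NormedAddCommGroup F] [NormedSpace ℝ F] [FiniteDimensional ℝ F]
    (hd : Module.finrank ℝ F < Module.finrank ℝ E) (f : E → F) (hf : Continuous f)
    (hinj : Function.Injective f) : False := by
  let C : Set E := Metric.closedBall 0 1
  have hCc : IsCompact C := isCompact_closedBall 0 1
  have : CompactSpace C := isCompact_iff_compactSpace.1 hCc
  have hemb : IsClosedEmbedding (fun x : C => f x) :=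
    (hf.comp continuous_subtype_val).isClosedEmbedding
      (fun x y h => Subtype.ext (hinj h))
  have : TietzeExtension.{0} E := TietzeExtension.of_tvs ℝ
  obtain ⟨G, hG⟩ := ContinuousMap.exists_extension hemb
    (⟨Subtype.val, continuous_subtype_val⟩ : C(C, E))
  have hG' : ∀ x, ‖x‖ ≤ 1 → G (f x) = x := by
    intro x hx
    exact congrArg (fun g : C(C, E) => g ⟨x, by simpa [C] using hx⟩) hG
  obtain ⟨P, hP, hPd, -⟩ := G.continuous.exists_contDiff_approx (ε := fun x => 1/4) 1
    continuous_const (fun x => by norm_num)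
  obtain ⟨v, hv, hv2⟩ := (hP.dense_compl_range_of_finrank_lt_finrank hd).exists_dist_lt 0
    (show (0:ℝ) < 1/4 by norm_num)
  rw [dist_zero_left] at hv2
  refine brouwer_zero (fun x => P (f x) - v) ((hP.continuous.comp hf).sub continuous_const) ?_ ?_
  · intro x h
    exact hv ⟨f x, sub_eq_zero.1 h⟩
  · intro x hx
    have h1 := hPd (f x)
    rw [hG' x hx, dist_eq_norm] at h1
    have h2 : P (f x) - v - x = (P (f x) - x) - v := by abel
    rw [h2]
    linarith [norm_sub_le (P (f x) - x) v]
end Brouwer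

lemma no_injection_pi {α β : Type} [Fintype α] [Fintype β] (hd : Fintype.card β < Fintype.card α)
    (f : (α → ℝ) → (β → ℝ)) (hf : Continuous f) (hinj : Function.Injective f) : False := by
  refine no_injection (E := EuclideanSpace ℝ α) (F := β → ℝ) (by simpa using hd)
    (fun x => f (WithLp.ofLp x)) (hf.comp (PiLp.continuous_ofLp 2 _)) ?_
  intro x y h
  exact WithLp.ofLp_injective 2 (hinj h)


section Dyn
variable {m : ℕ}

lemma linFlow_apply (a : Fin m → ℝ) (t : ℝ) (x : Euc m) (k : Fin m) :
    linFlow (Matrix.diagonal a) t x k = Real.exp (t * a k) * x k := by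
  have h1 : t • Matrix.diagonal a = Matrix.diagonal (t • a) := by
    rw [← Matrix.diagonal_smul]
  unfold linFlow
  rw [h1, Matrix.exp_diagonal]
  simp [Matrix.toLpLin_apply, Matrix.mulVec_diagonal, Pi.coe_exp, Real.exp_eq_exp_ℝ]

lemma coord_le_norm (x : Euc m) (k : Fin m) : |x k| ≤ ‖x‖ := by
  simpa using PiLp.norm_apply_le x k

lemma norm_le_of_coord (M : ℝ) (hM : 0 ≤ M) (u v : Euc m) (h : ∀ k, |u k| ≤ M * |v k|) :
    ‖u‖ ≤ M * ‖v‖ := by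
  have h1 : M * ‖v‖ = ‖M • v‖ := by rw [norm_smul, Real.norm_of_nonneg hM]
  rw [h1, EuclideanSpace.norm_eq, EuclideanSpace.norm_eq]
  apply Real.sqrt_le_sqrt
  apply Finset.sum_le_sum
  intro k _
  have : ‖u k‖ ≤ ‖(M • v) k‖ := by
    simpa [abs_mul, abs_of_nonneg hM] using h k
  gcongr

lemma linFlow_continuous (a : Fin m → ℝ) :
    Continuous fun p : ℝ × Euc m => linFlow (Matrix.diagonal a) p.1 p.2 := by
  have : (fun p : ℝ × Euc m => linFlow (Matrix.diagonal a) p.1 p.2) =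
      fun p => WithLp.toLp 2 (fun k => Real.exp (p.1 * a k) * p.2 k) := by
    funext p; ext k; simp [linFlow_apply]
  rw [this]
  refine (PiLp.continuous_toLp 2 _).comp ?_
  fun_prop

lemma linFlow_tendsto (a : Fin m → ℝ) (ha : ∀ j, a j < 0) (x : Euc m) :
    Tendsto (fun t => linFlow (Matrix.diagonal a) t x) atTop (𝓝 0) := by
  have : (fun t => linFlow (Matrix.diagonal a) t x) =
      fun t => WithLp.toLp 2 (fun k => Real.exp (t * a k) * x k) := by
    funext p; ext k; simp [linFlow_apply]
  rw [this]
  have h0 : (0 : Euc m) = WithLp.toLp 2 (fun k => 0) := rfl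
  rw [h0]
  refine ((PiLp.continuous_toLp 2 _).tendsto _).comp ?_
  rw [tendsto_pi_nhds]
  intro k
  have h1 : Tendsto (fun t : ℝ => t * a k) atTop atBot :=
    tendsto_id.atTop_mul_const_of_neg (ha k)
  simpa using (Real.tendsto_exp_atBot.comp h1).mul_const (x k)

lemma orbit_pt {A B : Matrix (Fin m) (Fin m) ℝ} {h : Euc m ≃ₜ Euc m} (ho : IsOrbitEquiv A B h)
    (t : ℝ) (x : Euc m) : ∃ s, h (linFlow A t x) = linFlow B s (h x) := by
  have : h (linFlow A t x) ∈ flowOrbit B (h x) := by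
    rw [← ho x]; exact ⟨_, ⟨t, rfl⟩, rfl⟩
  obtain ⟨s, hs⟩ := this
  exact ⟨s, hs.symm⟩

lemma orbit_symm {a b : Fin m → ℝ} {h : Euc m ≃ₜ Euc m}
    (ho : IsOrbitEquiv (Matrix.diagonal a) (Matrix.diagonal b) h) :
    IsOrbitEquiv (Matrix.diagonal b) (Matrix.diagonal a) h.symm := by
  intro y
  have := ho (h.symm y)
  rw [h.apply_symm_apply] at this
  rw [← this, ← Set.image_comp]
  simp

lemma step1 (h : Euc m ≃ₜ Euc m) (i j : Fin m) (hij : i < j) :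
    ∃ x : Euc m, (∀ k, j < k → h x k = 0) ∧ h x i ≠ 0 ∧ ∃ p, j ≤ p ∧ x p ≠ 0 := by
  by_contra hcon
  have H : ∀ y : Euc m, (∀ k, j < k → y k = 0) → y i ≠ 0 → ∀ p, j ≤ p → h.symm y p = 0 := by
    intro y h1 h2 p hp
    by_contra h3
    exact hcon ⟨h.symm y, by simpa using h1, by simpa using h2, p, hp, h3⟩
  have H2 : ∀ y : Euc m, (∀ k, j < k → y k = 0) → ∀ p, j ≤ p → h.symm y p = 0 := by
    intro y h1 p hp
    let g : ℝ → ℝ := fun e => h.symm (y + e • EuclideanSpace.single i 1) p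
    have hg : Continuous g := by
      have h2 : Continuous fun e : ℝ => h.symm (y + e • EuclideanSpace.single i 1) :=
        h.symm.continuous.comp (by fun_prop)
      fun_prop
    have hd : Dense ({-y i}ᶜ : Set ℝ) := dense_compl_singleton _
    have : g = fun _ => 0 := by
      refine Continuous.ext_on hd hg continuous_const ?_
      intro e he
      refine H _ ?_ ?_ p hp
      · intro k hk
        have : k ≠ i := (hij.trans hk).ne'
        simp [h1 k hk, this]
      · simp
        intro h3
        exact he (by simp; linarith)
    have := congrFun this 0
    simpa [g] using this
  refine no_injection_pi (α := {k : Fin m // k ≤ j}) (β := {k : Fin m // k < j}) ?_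
    (fun w k => h.symm (WithLp.toLp 2 (fun k => if hk : k ≤ j then w ⟨k, hk⟩ else 0)) k) ?_ ?_
  · rw [Fintype.card_subtype, Fintype.card_subtype]
    apply Finset.card_lt_card
    rw [Finset.ssubset_iff_of_subset (fun k hk => by simp at hk ⊢; exact hk.le)]
    exact ⟨j, by simp⟩
  · have h2 : Continuous fun w : {k : Fin m // k ≤ j} → ℝ =>
        h.symm (WithLp.toLp 2 (fun k => if hk : k ≤ j then w ⟨k, hk⟩ else 0)) := by
      refine h.symm.continuous.comp ((PiLp.continuous_toLp 2 _).comp ?_)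
      refine continuous_pi fun k => ?_
      by_cases hk : k ≤ j
      · simp only [hk, dif_pos]; fun_prop
      · simp only [hk, dif_neg, not_false_eq_true]; fun_prop
    fun_prop
  · intro w w' hw
    have h3 : h.symm (WithLp.toLp 2 (fun k => if hk : k ≤ j then w ⟨k, hk⟩ else 0)) =
        h.symm (WithLp.toLp 2 (fun k => if hk : k ≤ j then w' ⟨k, hk⟩ else 0)) := by
      ext k
      by_cases hk : k < j
      · exact congrFun hw ⟨k, hk⟩
      · rw [H2 _ _ k (not_lt.1 hk), H2 _ _ k (not_lt.1 hk)]
        · intro k hk; simp [not_le.2 hk]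
        · intro k hk; simp [not_le.2 hk]
    have h4 := h.symm.injective h3
    funext k
    have h5 := congrArg (fun z : Euc m => z k) h4
    simpa [k.2] using h5

lemma step2 {a b : Fin m → ℝ} (haneg : ∀ j, a j < 0) (hbneg : ∀ j, b j < 0)
    {h : Euc m ≃ₜ Euc m} (ho : IsOrbitEquiv (Matrix.diagonal a) (Matrix.diagonal b) h)
    (i p l : Fin m) (hip : i < p) (hil : i ≤ l) (x : Euc m) (hx : x p ≠ 0) (hy : h x l ≠ 0) :
    ∃ x' : Euc m, (∀ k, i < k → x' k = x k) ∧
      ∀ u : ℝ, ∃ l', i ≤ l' ∧ h x l' ≠ Real.exp (u * b l') * h x' l' := by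
  by_contra hcon
  have H : ∀ x' : Euc m, (∀ k, i < k → x' k = x k) →
      ∃ u : ℝ, ∀ l', i ≤ l' → h x l' = Real.exp (u * b l') * h x' l' := by
    intro x' h1
    by_contra h2
    push Not at h2
    exact hcon ⟨x', h1, h2⟩
  let V : (Option {k : Fin m // k ≤ i} → ℝ) → Euc m := fun w =>
    WithLp.toLp 2 (fun k => if hk : k ≤ i then w (some ⟨k, hk⟩) else x k)
  have hVc : Continuous V := by
    refine (PiLp.continuous_toLp 2 _).comp ?_
    refine continuous_pi fun k => ?_
    by_cases hk : k ≤ i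
    · simp only [hk, dif_pos]; fun_prop
    · simp only [hk, dif_neg, not_false_eq_true]; fun_prop
  have hV : ∀ w k, i < k → V w k = x k := by
    intro w k hk; simp [V, not_le.2 hk]
  let Z : (Option {k : Fin m // k ≤ i} → ℝ) → Euc m := fun w =>
    h (linFlow (Matrix.diagonal a) (w none) (V w))
  have hZc : Continuous Z := by
    have h3 : Continuous fun w => ((w none, V w) : ℝ × Euc m) :=
      (continuous_apply none).prodMk hVc
    have h4 := (linFlow_continuous a).comp h3
    exact h.continuous.comp h4
  have hZ : ∀ w, ∃ s : ℝ, ∀ l', i ≤ l' → Z w l' = Real.exp (s * b l') * h x l' := by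
    intro w
    obtain ⟨u, hu⟩ := H (V w) (hV w)
    obtain ⟨s, hs⟩ := orbit_pt ho (w none) (V w)
    refine ⟨s - u, fun l' hl' => ?_⟩
    simp only [Z]
    rw [hs, linFlow_apply, hu l' hl', ← mul_assoc, ← Real.exp_add]
    congr 2; ring
  refine no_injection_pi (α := Option {k : Fin m // k ≤ i}) (β := Option {k : Fin m // k < i}) ?_
    (fun w k => match k with
      | none => Z w l
      | some k => Z w k) ?_ ?_
  · rw [Fintype.card_option, Fintype.card_option, Fintype.card_subtype, Fintype.card_subtype]
    apply Nat.succ_lt_succ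
    apply Finset.card_lt_card
    rw [Finset.ssubset_iff_of_subset (fun k hk => by simp at hk ⊢; exact hk.le)]
    exact ⟨i, by simp⟩
  · refine continuous_pi fun k => ?_
    cases k <;> fun_prop
  · intro w w' hw
    have hl : Z w l = Z w' l := congrFun hw none
    have hlt : ∀ k, k < i → Z w k = Z w' k := fun k hk => congrFun hw (some ⟨k, hk⟩)
    obtain ⟨s, hs⟩ := hZ w
    obtain ⟨s', hs'⟩ := hZ w'
    have hss : s = s' := by
      rw [hs l hil, hs' l hil] at hl
      have := Real.exp_injective (mul_right_cancel₀ hy hl)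
      exact mul_right_cancel₀ (hbneg l).ne this
    have hZZ : Z w = Z w' := by
      ext k
      rcases lt_or_ge k i with hk | hk
      · exact hlt k hk
      · rw [hs k hk, hs' k hk, hss]
    have hXX := h.injective hZZ
    have ht : w none = w' none := by
      have := congrArg (fun z : Euc m => z p) hXX
      simp only [linFlow_apply, hV _ p hip] at this
      have := Real.exp_injective (mul_right_cancel₀ hx this)
      exact mul_right_cancel₀ (haneg p).ne this
    funext k
    cases k with
    | none => exact ht
    | some k =>
      have := congrArg (fun z : Euc m => z k) hXX
      simp only [linFlow_apply, ht] at this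
      have := mul_left_cancel₀ (Real.exp_pos _).ne' this
      simpa [V, k.2] using this

lemma step3 {b : Fin m → ℝ} (hbneg : ∀ j, b j < 0) (i l : Fin m) (hil : i ≤ l) (y y' : Euc m)
    (hy : y l ≠ 0) (H : ∀ u : ℝ, ∃ l', i ≤ l' ∧ y l' ≠ Real.exp (u * b l') * y' l') :
    ∃ c > 0, ∀ u : ℝ, ∃ l', i ≤ l' ∧ c ≤ |y l' - Real.exp (u * b l') * y' l'| := by
  have hyp : 0 < |y l| := abs_pos.2 hy
  by_cases hpos : 0 < y l / y' l
  · have hy' : y' l ≠ 0 := by rintro h; simp [h] at hpos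
    set u0 := Real.log (y l / y' l) / b l with hu0
    have hb := hbneg l
    have h0 : Real.exp (u0 * b l) = y l / y' l := by
      rw [hu0, div_mul_cancel₀ _ hb.ne, Real.exp_log hpos]
    obtain ⟨l', hl', hne⟩ := H u0
    have hη : 0 < |y l' - Real.exp (u0 * b l') * y' l'| := abs_pos.2 (sub_ne_zero.2 hne)
    have hc : Continuous fun u : ℝ => |y l' - Real.exp (u * b l') * y' l'| := by fun_prop
    obtain ⟨δ, hδ, hδ2⟩ := Metric.eventually_nhds_iff.1
      ((hc.tendsto u0).eventually (lt_mem_nhds (half_lt_self hη)))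
    set σ := δ * |b l| with hσ
    have hσ0 : 0 < σ := mul_pos hδ (abs_pos.2 hb.ne)
    have hσ1 : 0 < 1 - Real.exp (-σ) := by
      have : Real.exp (-σ) < 1 := by rw [Real.exp_lt_one_iff]; linarith
      linarith
    refine ⟨min (|y l' - Real.exp (u0 * b l') * y' l'| / 2) (|y l| * (1 - Real.exp (-σ))),
      lt_min (by linarith) (mul_pos hyp hσ1), fun u => ?_⟩
    by_cases hu : dist u u0 < δ
    · exact ⟨l', hl', (min_le_left _ _).trans (hδ2 hu).le⟩
    · refine ⟨l, hil, (min_le_right _ _).trans ?_⟩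
      have h1 : y l - Real.exp (u * b l) * y' l = y l * (1 - Real.exp ((u - u0) * b l)) := by
        have h2 : Real.exp (u * b l) = Real.exp ((u - u0) * b l) * (y l / y' l) := by
          rw [← h0, ← Real.exp_add]; congr 1; ring
        rw [h2]; field_simp
      rw [h1, abs_mul]
      gcongr
      have h3 : σ ≤ |(u - u0) * b l| := by
        rw [abs_mul, hσ]
        rw [Real.dist_eq] at hu
        gcongr; exact not_lt.1 hu
      set z := (u - u0) * b l
      rcases le_total 0 z with hz | hz
      · rw [abs_of_nonneg hz] at h3
        have h4 := Real.add_one_le_exp z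
        have h5 := Real.add_one_le_exp (-σ)
        have h6 := neg_abs_le (1 - Real.exp z)
        linarith
      · rw [abs_of_nonpos hz] at h3
        have h4 : Real.exp z ≤ Real.exp (-σ) := Real.exp_le_exp.2 (by linarith)
        exact le_trans (by linarith) (le_abs_self _)
  · refine ⟨|y l|, hyp, fun u => ⟨l, hil, ?_⟩⟩
    have he := Real.exp_pos (u * b l)
    rcases lt_or_gt_of_ne hy with h1 | h1
    · have : 0 ≤ y' l := by
        by_contra h2
        exact hpos (div_pos_of_neg_of_neg h1 (not_le.1 h2))
      have := mul_nonneg he.le this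
      rw [abs_of_neg h1, abs_of_nonpos] <;> linarith
    · have : y' l ≤ 0 := by
        by_contra h2
        exact hpos (div_pos h1 (not_le.1 h2))
      have := mul_nonpos_of_nonneg_of_nonpos he.le this
      rw [abs_of_pos h1, abs_of_nonneg] <;> linarith

lemma key {a b : Fin m → ℝ} (hamono : Monotone a) (haneg : ∀ j, a j < 0)
    (hbmono : Monotone b) (hbneg : ∀ j, b j < 0) {h : Euc m ≃ₜ Euc m}
    (ho : IsOrbitEquiv (Matrix.diagonal a) (Matrix.diagonal b) h) (γ : ℝ) (hγ : 0 < γ)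
    (h0 : h 0 = 0) (hH : HolderNearZero γ h) (hH' : HolderNearZero γ h.symm)
    (i j : Fin m) (hij : i < j) : γ ^ 2 * (a i / b i) ≤ a j / b j := by
  obtain ⟨x, hxF, hxi, p, hjp, hxp⟩ := step1 h i j hij
  obtain ⟨x', hx', hsep⟩ := step2 haneg hbneg ho i p i (hij.trans_le hjp) le_rfl x hxp hxi
  obtain ⟨c, hc, hcl⟩ := step3 hbneg i i le_rfl (h x) (h x') hxi hsep
  obtain ⟨r, hr, K, hK⟩ := hH
  obtain ⟨r', hr', K', hK'⟩ := hH'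
  have t1 := linFlow_tendsto a haneg x
  have t2 := linFlow_tendsto a haneg x'
  have t3 : Tendsto (fun t => h (linFlow (Matrix.diagonal a) t x)) atTop (𝓝 0) := by
    have := (h.continuous.tendsto 0).comp t1
    rwa [h0] at this
  have t4 : Tendsto (fun t => |h (linFlow (Matrix.diagonal a) t x) i|) atTop (𝓝 0) := by
    have h1 : Continuous fun z : Euc m => |z i| := by fun_prop
    have := (h1.tendsto 0).comp t3
    simpa [Function.comp_def] using this
  set D := dist x x' with hD
  set C1 := Real.log (K * D ^ γ / c)
  set C2 := Real.log (K' * ‖h x‖ ^ γ / |x p|)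
  have hmain : ∀ᶠ t : ℝ in atTop, ∃ s : ℝ, s * b i ≤ C1 + γ * (t * a i) ∧
      t * a j ≤ C2 + γ * (s * b j) := by
    filter_upwards [eventually_ge_atTop 0, t1.eventually (Metric.ball_mem_nhds 0 hr),
      t2.eventually (Metric.ball_mem_nhds 0 hr), t3.eventually (Metric.ball_mem_nhds 0 hr'),
      t4.eventually (gt_mem_nhds (abs_pos.2 hxi))] with t ht e1 e2 e3 e4
    obtain ⟨s, hs⟩ := orbit_pt ho t x
    obtain ⟨s', hs'⟩ := orbit_pt ho t x'
    have hs0 : 0 < s := by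
      rw [hs, linFlow_apply, abs_mul, Real.abs_exp] at e4
      have : Real.exp (s * b i) < 1 := by
        have hp := abs_pos.2 hxi
        by_contra hcon
        have := mul_le_mul_of_nonneg_right (not_lt.1 hcon) hp.le
        linarith
      rw [Real.exp_lt_one_iff] at this
      exact pos_of_mul_neg_left this (hbneg i).le
    refine ⟨s, ?_, ?_⟩
    · have h1 := hK _ e1 _ e2
      have h2 : dist (linFlow (Matrix.diagonal a) t x) (linFlow (Matrix.diagonal a) t x') ≤
          Real.exp (t * a i) * D := by
        rw [hD, dist_eq_norm, dist_eq_norm]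
        refine norm_le_of_coord _ (Real.exp_pos _).le _ _ (fun k => ?_)
        simp only [PiLp.sub_apply, linFlow_apply]
        rw [← mul_sub, abs_mul, Real.abs_exp]
        rcases le_or_gt k i with hk | hk
        · gcongr
          exact hamono hk
        · simp [hx' k hk]
      obtain ⟨l', hl', hcl'⟩ := hcl (s' - s)
      have h3 : c * Real.exp (s * b i) ≤
          dist (h (linFlow (Matrix.diagonal a) t x)) (h (linFlow (Matrix.diagonal a) t x')) := by
        rw [hs, hs', dist_eq_norm]
        refine le_trans ?_ (coord_le_norm _ l')
        simp only [PiLp.sub_apply, linFlow_apply]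
        have h4 : Real.exp (s * b l') * h x l' - Real.exp (s' * b l') * h x' l' =
            (h x l' - Real.exp ((s' - s) * b l') * h x' l') * Real.exp (s * b l') := by
          have : Real.exp (s' * b l') = Real.exp ((s' - s) * b l') * Real.exp (s * b l') := by
            rw [← Real.exp_add]; congr 1; ring
          rw [this]; ring
        rw [h4, abs_mul, Real.abs_exp]
        gcongr
        exact hbmono hl'
      have hd0 : 0 ≤ dist (linFlow (Matrix.diagonal a) t x) (linFlow (Matrix.diagonal a) t x') :=
        dist_nonneg
      have h5 : 0 < c * Real.exp (s * b i) := by positivity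
      have hKpos : 0 < K := by
        by_contra hcon
        have := mul_nonpos_of_nonpos_of_nonneg (not_lt.1 hcon) (Real.rpow_nonneg hd0 γ)
        linarith
      have h6 : c * Real.exp (s * b i) ≤ K * (Real.exp (t * a i) * D) ^ γ :=
        h3.trans (h1.trans (by gcongr))
      rw [Real.mul_rpow (Real.exp_pos _).le dist_nonneg, ← Real.exp_mul] at h6
      have h7 : Real.exp (s * b i) ≤ K * D ^ γ / c * Real.exp (γ * (t * a i)) := by
        rw [div_mul_eq_mul_div, le_div_iff₀ hc]
        calc _ = c * Real.exp (s * b i) := by ring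
          _ ≤ _ := h6
          _ = _ := by rw [mul_comm (t * a i) γ]; ring
      have h8 : 0 < K * D ^ γ / c := by
        by_contra hcon
        have := mul_nonpos_of_nonpos_of_nonneg (not_lt.1 hcon) (Real.exp_pos (γ * (t * a i))).le
        linarith [Real.exp_pos (s * b i)]
      have h9 := Real.log_le_log (Real.exp_pos _) h7
      rwa [Real.log_exp, Real.log_mul h8.ne' (Real.exp_pos _).ne', Real.log_exp] at h9
    · have h1 := hK' _ e3 0 (Metric.mem_ball_self hr')
      have h00 : h.symm 0 = 0 := by rw [h.symm_apply_eq, h0]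
      rw [h00, h.symm_apply_apply, dist_zero_right, dist_zero_right] at h1
      have h2 : ‖h (linFlow (Matrix.diagonal a) t x)‖ ≤ Real.exp (s * b j) * ‖h x‖ := by
        rw [hs]
        refine norm_le_of_coord _ (Real.exp_pos _).le _ _ (fun k => ?_)
        rw [linFlow_apply, abs_mul, Real.abs_exp]
        rcases le_or_gt k j with hk | hk
        · gcongr
          exact hbmono hk
        · simp [hxF k hk]
      have hxpp := abs_pos.2 hxp
      have h3 : |x p| * Real.exp (t * a j) ≤ ‖linFlow (Matrix.diagonal a) t x‖ := by
        refine le_trans ?_ (coord_le_norm _ p)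
        rw [linFlow_apply, abs_mul, Real.abs_exp, mul_comm]
        gcongr
        exact hamono hjp
      have h5 : 0 < |x p| * Real.exp (t * a j) := by positivity
      have hKpos : 0 < K' := by
        by_contra hcon
        have := mul_nonpos_of_nonpos_of_nonneg (not_lt.1 hcon)
          (Real.rpow_nonneg (norm_nonneg (h (linFlow (Matrix.diagonal a) t x))) γ)
        linarith
      have h6 : |x p| * Real.exp (t * a j) ≤ K' * (Real.exp (s * b j) * ‖h x‖) ^ γ :=
        h3.trans (h1.trans (by gcongr))
      rw [Real.mul_rpow (Real.exp_pos _).le (norm_nonneg _), ← Real.exp_mul] at h6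
      have h7 : Real.exp (t * a j) ≤ K' * ‖h x‖ ^ γ / |x p| * Real.exp (γ * (s * b j)) := by
        rw [div_mul_eq_mul_div, le_div_iff₀ hxpp]
        calc _ = |x p| * Real.exp (t * a j) := by ring
          _ ≤ _ := h6
          _ = _ := by rw [mul_comm (s * b j) γ]; ring
      have h8 : 0 < K' * ‖h x‖ ^ γ / |x p| := by
        by_contra hcon
        have := mul_nonpos_of_nonpos_of_nonneg (not_lt.1 hcon) (Real.exp_pos (γ * (s * b j))).le
        linarith [Real.exp_pos (t * a j)]
      have h9 := Real.log_le_log (Real.exp_pos _) h7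
      rwa [Real.log_exp, Real.log_mul h8.ne' (Real.exp_pos _).ne', Real.log_exp] at h9
  have hbi := hbneg i
  have hbj := hbneg j
  by_contra hcon
  push Not at hcon
  have hκ : 0 < γ ^ 2 * (a i * b j) - a j * b i := by
    have h1 : a j / b j * (b i * b j) < γ ^ 2 * (a i / b i) * (b i * b j) :=
      mul_lt_mul_of_pos_right hcon (mul_pos_of_neg_of_neg hbi hbj)
    have h2 : a j / b j * (b i * b j) = a j * b i := by have := hbj.ne; field_simp
    have h3 : γ ^ 2 * (a i / b i) * (b i * b j) = γ ^ 2 * (a i * b j) := by have := hbi.ne; field_simp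
    linarith
  set κ := γ ^ 2 * (a i * b j) - a j * b i with hκd
  obtain ⟨t, ⟨s, hs1, hs2⟩, ht⟩ :=
    (hmain.and (eventually_gt_atTop ((-(C2 * b i) - γ * b j * C1) / κ))).exists
  rw [div_lt_iff₀ hκ] at ht
  -- multiply the two inequalities by negative numbers
  have m1 : γ * b j * (C1 + γ * (t * a i)) ≤ γ * b j * (s * b i) :=
    mul_le_mul_of_nonpos_left hs1 (mul_nonpos_of_nonneg_of_nonpos hγ.le hbj.le)
  have m2 : b i * (C2 + γ * (s * b j)) ≤ b i * (t * a j) :=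
    mul_le_mul_of_nonpos_left hs2 hbi.le
  rw [hκd] at ht
  nlinarith

end Dyn

section Pow

/-- The signed power `x ↦ sign(x) |x|^p`. -/
def spow (p x : ℝ) : ℝ := (max x 0) ^ p - (max (-x) 0) ^ p

lemma spow_nonneg_eq {p x : ℝ} (hp : 0 < p) (hx : 0 ≤ x) : spow p x = x ^ p := by
  simp [spow, max_eq_left hx, max_eq_right (neg_nonpos.2 hx), Real.zero_rpow hp.ne']

lemma spow_neg (p x : ℝ) : spow p (-x) = - spow p x := by
  simp [spow]

lemma spow_continuous {p : ℝ} (hp : 0 < p) : Continuous (spow p) := by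
  unfold spow
  exact ((continuous_id.max continuous_const).rpow_const (fun _ => Or.inr hp.le)).sub
    ((continuous_neg.max continuous_const).rpow_const (fun _ => Or.inr hp.le))

lemma spow_inv {p q : ℝ} (hp : 0 < p) (hq : 0 < q) (hpq : p * q = 1) (x : ℝ) :
    spow q (spow p x) = x := by
  have key : ∀ x, 0 ≤ x → spow q (spow p x) = x := by
    intro x hx
    rw [spow_nonneg_eq hp hx, spow_nonneg_eq hq (Real.rpow_nonneg hx _), ← Real.rpow_mul hx, hpq,
      Real.rpow_one]
  rcases le_total 0 x with h | h
  · exact key x h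
  · have := key (-x) (neg_nonneg.2 h)
    rw [spow_neg, spow_neg] at this
    linarith

lemma spow_mul {p e : ℝ} (hp : 0 < p) (he : 0 ≤ e) (x : ℝ) :
    spow p (e * x) = e ^ p * spow p x := by
  have key : ∀ x, 0 ≤ x → spow p (e * x) = e ^ p * spow p x := by
    intro x hx
    rw [spow_nonneg_eq hp hx, spow_nonneg_eq hp (mul_nonneg he hx), Real.mul_rpow he hx]
  rcases le_total 0 x with h | h
  · exact key x h
  · have := key (-x) (neg_nonneg.2 h)
    rw [mul_neg, spow_neg, spow_neg] at this
    linarith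

lemma rpow_holder {β : ℝ} (hβ : 0 < β) (hβ1 : β < 1) {x y : ℝ} (hx : 0 ≤ x) (hy : 0 ≤ y) :
    |x ^ β - y ^ β| ≤ |x - y| ^ β := by
  have key : ∀ x y : ℝ, 0 ≤ y → y ≤ x → |x ^ β - y ^ β| ≤ |x - y| ^ β := by
    intro x y hy hxy
    have h1 : y ^ β ≤ x ^ β := Real.rpow_le_rpow hy hxy hβ.le
    rw [abs_of_nonneg (sub_nonneg.2 h1), abs_of_nonneg (sub_nonneg.2 hxy)]
    have := Real.rpow_add_le_add_rpow hy (sub_nonneg.2 hxy) hβ.le hβ1.le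
    rw [add_sub_cancel] at this
    linarith
  rcases le_total y x with h | h
  · exact key x y hy h
  · rw [abs_sub_comm, abs_sub_comm x y]; exact key y x hx h

lemma rpow_lip {q : ℝ} (hq : 1 ≤ q) {x y : ℝ} (hx : 0 ≤ x) (hx1 : x ≤ 1) (hy : 0 ≤ y)
    (hy1 : y ≤ 1) : |x ^ q - y ^ q| ≤ q * |x - y| := by
  have := Convex.norm_image_sub_le_of_norm_hasDerivWithin_le (f := fun x : ℝ => x ^ q)
    (f' := fun x => q * x ^ (q - 1)) (C := q) (s := Set.Icc (0:ℝ) 1) (x := y) (y := x)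
    (fun z _ => (Real.hasDerivAt_rpow_const (Or.inr hq)).hasDerivWithinAt)
    (fun z hz => by
      have h1 : z ^ (q - 1) ≤ 1 := Real.rpow_le_one hz.1 hz.2 (by linarith)
      have h2 : 0 ≤ z ^ (q - 1) := Real.rpow_nonneg hz.1 _
      rw [Real.norm_of_nonneg (by positivity)]
      nlinarith) (convex_Icc 0 1) ⟨hy, hy1⟩ ⟨hx, hx1⟩
  simpa using this

lemma spow_holder {p β : ℝ} (hβ : 0 < β) (hβ1 : β < 1) (hp : β ≤ p) {x y : ℝ} (hx : |x| ≤ 1)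
    (hy : |y| ≤ 1) : |spow p x - spow p y| ≤ 2 * (p / β) * |x - y| ^ β := by
  have hp0 : 0 < p := hβ.trans_le hp
  have hq : 1 ≤ p / β := by rwa [le_div_iff₀ hβ, one_mul]
  have k1 : ∀ x y : ℝ, 0 ≤ x → x ≤ 1 → 0 ≤ y → y ≤ 1 →
      |spow p x - spow p y| ≤ (p / β) * |x - y| ^ β := by
    intro x y hx hx1 hy hy1
    rw [spow_nonneg_eq hp0 hx, spow_nonneg_eq hp0 hy]
    have e : β * (p / β) = p := by field_simp
    have h1 := rpow_lip hq (Real.rpow_nonneg hx β) (Real.rpow_le_one hx hx1 hβ.le)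
      (Real.rpow_nonneg hy β) (Real.rpow_le_one hy hy1 hβ.le)
    rw [← Real.rpow_mul hx, ← Real.rpow_mul hy, e] at h1
    refine h1.trans ?_
    gcongr
    exact rpow_holder hβ hβ1 hx hy
  have hz : spow p 0 = 0 := by rw [spow_nonneg_eq hp0 le_rfl, Real.zero_rpow hp0.ne']
  have k2 : ∀ x y : ℝ, 0 ≤ x → x ≤ 1 → y ≤ 0 → -1 ≤ y →
      |spow p x - spow p y| ≤ 2 * (p / β) * |x - y| ^ β := by
    intro x y hx hx1 hy hy1
    have a1 := k1 x 0 hx hx1 le_rfl zero_le_one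
    have a2 := k1 (-y) 0 (by linarith) (by linarith) le_rfl zero_le_one
    rw [hz, sub_zero, sub_zero] at a1 a2
    rw [spow_neg, abs_neg, abs_neg] at a2
    have b1 : |x| ^ β ≤ |x - y| ^ β := by
      apply Real.rpow_le_rpow (abs_nonneg _) _ hβ.le
      rw [abs_of_nonneg hx, abs_of_nonneg] <;> linarith
    have b2 : |y| ^ β ≤ |x - y| ^ β := by
      apply Real.rpow_le_rpow (abs_nonneg _) _ hβ.le
      rw [abs_of_nonpos hy, abs_of_nonneg] <;> linarith
    have hpb : 0 ≤ p / β := by positivity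
    have c1 := mul_le_mul_of_nonneg_left b1 hpb
    have c2 := mul_le_mul_of_nonneg_left b2 hpb
    have := abs_sub (spow p x) (spow p y)
    linarith
  rw [abs_le] at hx hy
  have hnn : 0 ≤ (p / β) * |x - y| ^ β := by positivity
  rcases le_total 0 x with h | h <;> rcases le_total 0 y with h' | h'
  · linarith [k1 x y h hx.2 h' hy.2]
  · exact k2 x y h hx.2 h' hy.1
  · rw [abs_sub_comm, abs_sub_comm x y]
    exact k2 y x h' hy.2 h hx.1
  · have := k1 (-x) (-y) (by linarith) (by linarith) (by linarith) (by linarith)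
    rw [spow_neg, spow_neg] at this
    have e1 : -spow p x - -spow p y = -(spow p x - spow p y) := by ring
    have e2 : -x - -y = -(x - y) := by ring
    rw [e1, e2, abs_neg, abs_neg] at this
    linarith

variable {m : ℕ}

/-- Coordinatewise signed powers. -/
def spowMap (p : Fin m → ℝ) (x : Euc m) : Euc m := WithLp.toLp 2 (fun k => spow (p k) (x k))

lemma spowMap_continuous (p : Fin m → ℝ) (hp : ∀ k, 0 < p k) : Continuous (spowMap p) := by
  refine (PiLp.continuous_toLp 2 _).comp (continuous_pi fun k => (spow_continuous (hp k)).comp ?_)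
  fun_prop

/-- Coordinatewise signed powers as a homeomorphism. -/
def spowHomeo (p : Fin m → ℝ) (hp : ∀ k, 0 < p k) : Euc m ≃ₜ Euc m where
  toFun := spowMap p
  invFun := spowMap (fun k => (p k)⁻¹)
  left_inv x := by
    ext k
    exact spow_inv (hp k) (inv_pos.2 (hp k)) (mul_inv_cancel₀ (hp k).ne') _
  right_inv x := by
    ext k
    exact spow_inv (inv_pos.2 (hp k)) (hp k) (inv_mul_cancel₀ (hp k).ne') _
  continuous_toFun := spowMap_continuous p hp
  continuous_invFun := spowMap_continuous _ (fun k => inv_pos.2 (hp k))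

lemma norm_le_sum_coord (u : Euc m) : ‖u‖ ≤ ∑ k, |u k| := by
  rw [EuclideanSpace.norm_eq, Real.sqrt_le_left (Finset.sum_nonneg fun k _ => abs_nonneg _)]
  simp only [Real.norm_eq_abs]
  calc ∑ k, |u k| ^ 2 ≤ ∑ k, |u k| * ∑ l, |u l| := by
        refine Finset.sum_le_sum fun k _ => ?_
        rw [sq]
        exact mul_le_mul_of_nonneg_left
          (Finset.single_le_sum (f := fun l => |u l|) (fun l _ => abs_nonneg _)
            (Finset.mem_univ k)) (abs_nonneg _)
    _ = (∑ k, |u k|) ^ 2 := by rw [← Finset.sum_mul, sq]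

lemma spowMap_holder {β : ℝ} (hβ : 0 < β) (hβ1 : β < 1) (p : Fin m → ℝ) (hp : ∀ k, β ≤ p k) :
    HolderNearZero β (spowMap p) := by
  refine ⟨1, one_pos, ∑ k, 2 * (p k / β), fun x hx y hy => ?_⟩
  rw [mem_ball_zero_iff] at hx hy
  rw [dist_eq_norm, Finset.sum_mul]
  refine (norm_le_sum_coord _).trans (Finset.sum_le_sum fun k _ => ?_)
  have h1 := spow_holder hβ hβ1 (hp k) ((coord_le_norm x k).trans hx.le)
    ((coord_le_norm y k).trans hy.le)
  refine h1.trans ?_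
  have h2 : |x k - y k| ≤ dist x y := by
    rw [dist_eq_norm]; exact coord_le_norm (x - y) k
  have : 0 ≤ p k / β := div_nonneg (hβ.le.trans (hp k)) hβ.le
  gcongr

lemma holder_mono {β γ : ℝ} (hγ : 0 < γ) (hγβ : γ < β) {f : Euc m → Euc m}
    (hf : HolderNearZero β f) : HolderNearZero γ f := by
  obtain ⟨r, hr, K, hK⟩ := hf
  refine ⟨min r (1/2), by positivity, |K|, fun x hx y hy => ?_⟩
  have hx1 := Metric.ball_subset_ball (min_le_left r (1/2)) hx
  have hy1 := Metric.ball_subset_ball (min_le_left r (1/2)) hy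
  have hx2 := Metric.ball_subset_ball (min_le_right r (1/2)) hx
  have hy2 := Metric.ball_subset_ball (min_le_right r (1/2)) hy
  rw [Metric.mem_ball] at hx2 hy2
  have hd : dist x y ≤ 1 := by
    have := dist_triangle_right x y 0
    linarith
  calc dist (f x) (f y) ≤ K * dist x y ^ β := hK x hx1 y hy1
    _ ≤ |K| * dist x y ^ β := by gcongr; exact le_abs_self K
    _ ≤ |K| * dist x y ^ γ := 
      mul_le_mul_of_nonneg_left
        (Real.rpow_le_rpow_of_exponent_ge' dist_nonneg hd hγ.le hγβ.le) (abs_nonneg K)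

end Pow

lemma holderClass_zero_pos {m : ℕ} {β : ℝ} (hβ0 : 0 < β) {h : Euc m ≃ₜ Euc m}
    (hB : MemHBelow β h) : h 0 = 0 :=
  (hB (β / 2) (by linarith) (by linarith)).1

lemma sim_to_rel {m : ℕ} {A B : Matrix (Fin m) (Fin m) ℝ} {β : ℝ}
    (H : ∃ (h : Euc m ≃ₜ Euc m) (α : ℝ), α ≠ 0 ∧ MemHolderClass β h ∧
        ∀ (t : ℝ) (x : Euc m), h (linFlow A t x) = linFlow B (α * t) (h x)) :
    RelEquivWith (MemHBelow β) A B := by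
  obtain ⟨h, α, hα, ⟨h0, h1, h2⟩, heq⟩ := H
  refine ⟨h, fun γ hγ hγβ => ⟨h0, holder_mono hγ hγβ h1, holder_mono hγ hγβ h2⟩, fun x => ?_⟩
  ext y
  constructor
  · rintro ⟨_, ⟨t, rfl⟩, rfl⟩
    exact ⟨α * t, (heq t x).symm⟩
  · rintro ⟨s, rfl⟩
    refine ⟨_, ⟨s / α, rfl⟩, ?_⟩
    simp only [heq]
    rw [mul_div_cancel₀ _ hα]

lemma rel_to_ineq {m : ℕ} {a b : Fin m → ℝ}
    (hamono : Monotone a) (haneg : ∀ j, a j < 0)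
    (hbmono : Monotone b) (hbneg : ∀ j, b j < 0)
    {β : ℝ} (hβ0 : 0 < β) (hβ1 : β < 1)
    (H : RelEquivWith (MemHBelow β) (Matrix.diagonal a) (Matrix.diagonal b)) (i j : Fin m) :
    β ^ 2 * (a i / b i) ≤ a j / b j := by
  obtain ⟨h, hB, ho⟩ := H
  have hpos : ∀ k, 0 < a k / b k := fun k => div_pos_of_neg_of_neg (haneg k) (hbneg k)
  have main : ∀ γ, 0 < γ → γ < β → γ ^ 2 * (a i / b i) ≤ a j / b j := by
    intro γ hγ hγβ
    obtain ⟨h0, h1, h2⟩ := hB γ hγ hγβ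
    have h00 : h.symm 0 = 0 := by rw [h.symm_apply_eq, h0]
    rcases lt_trichotomy i j with hij | hij | hij
    · exact key hamono haneg hbmono hbneg ho γ hγ h0 h1 h2 i j hij
    · subst hij
      have h3 : γ ^ 2 ≤ 1 := by nlinarith
      have := mul_le_mul_of_nonneg_right h3 (hpos i).le
      linarith
    · have := key hbmono hbneg hamono haneg (orbit_symm ho) γ hγ h00 h2
        (by simpa using h1) j i hij
      have e1 : b j / a j = (a j / b j)⁻¹ := (inv_div _ _).symm
      have e2 : b i / a i = (a i / b i)⁻¹ := (inv_div _ _).symm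
      rw [e1, e2] at this
      have hi := hpos i
      have hj := hpos j
      rw [← div_eq_mul_inv, ← one_div, div_le_div_iff₀ hj hi] at this
      linarith
  have hlim : Tendsto (fun γ : ℝ => γ ^ 2 * (a i / b i)) (𝓝[<] β) (𝓝 (β ^ 2 * (a i / b i))) :=
    ((by fun_prop : Continuous fun γ : ℝ => γ ^ 2 * (a i / b i)).tendsto β).mono_left
      nhdsWithin_le_nhds
  refine le_of_tendsto hlim ?_
  filter_upwards [Ioo_mem_nhdsLT hβ0] with γ hγ
  exact main γ hγ.1 hγ.2

lemma ineq_to_sim {m : ℕ} {a b : Fin m → ℝ}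
    (haneg : ∀ j, a j < 0) (hbneg : ∀ j, b j < 0)
    {β : ℝ} (hβ0 : 0 < β) (hβ1 : β < 1) (i : Fin m) (hmax : ∀ k, a k / b k ≤ a i / b i)
    (H : ∀ k, β ^ 2 * (a i / b i) ≤ a k / b k) :
    ∃ (h : Euc m ≃ₜ Euc m) (α : ℝ), α ≠ 0 ∧ MemHolderClass β h ∧
        ∀ (t : ℝ) (x : Euc m),
          h (linFlow (Matrix.diagonal a) t x) = linFlow (Matrix.diagonal b) (α * t) (h x) := by
  have hpos : ∀ k, 0 < a k / b k := fun k => div_pos_of_neg_of_neg (haneg k) (hbneg k)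
  let α := β * (a i / b i)
  have hα : 0 < α := mul_pos hβ0 (hpos i)
  let p : Fin m → ℝ := fun k => α / (a k / b k)
  have hp : ∀ k, 0 < p k := fun k => div_pos hα (hpos k)
  refine ⟨spowHomeo p hp, α, hα.ne', ⟨?_, ?_, ?_⟩, fun t x => ?_⟩
  · ext k
    show spow (p k) 0 = 0
    rw [spow_nonneg_eq (hp k) le_rfl, Real.zero_rpow (hp k).ne']
  · refine spowMap_holder hβ0 hβ1 p (fun k => ?_)
    rw [le_div_iff₀ (hpos k)]
    exact mul_le_mul_of_nonneg_left (hmax k) hβ0.le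
  · refine spowMap_holder hβ0 hβ1 (fun k => (p k)⁻¹) (fun k => ?_)
    simp only [p, inv_div]
    rw [le_div_iff₀ hα]
    calc _ = β ^ 2 * (a i / b i) := by simp only [α]; ring
      _ ≤ _ := H k
  · ext k
    rw [linFlow_apply]
    show spow (p k) (linFlow (Matrix.diagonal a) t x k) = _ * spow (p k) (x k)
    rw [linFlow_apply, spow_mul (hp k) (Real.exp_pos _).le, ← Real.exp_mul]
    congr 2
    have h1 := (haneg k).ne
    have h2 := (hbneg k).ne
    simp only [p]
    field_simp

/-- **Theorem 4.6**: for the stable diagonal flows generated by `diag a` and `diag b`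
(`a_1 ≤ … ≤ a_m < 0`, `b_1 ≤ … ≤ b_m < 0`) and `0 < β < 1`, the following are equivalent:
(i) `Φ ≃^β Ψ`; (ii) `Φ ~^{β⁻} Ψ`; (iii) `β² ≤ (min_j a_j/b_j) / (max_j a_j/b_j)`. -/
theorem diagonal_betaHolder_classification {m : ℕ} (hm : 0 < m) (a b : Fin m → ℝ)
    (hamono : Monotone a) (haneg : ∀ j, a j < 0)
    (hbmono : Monotone b) (hbneg : ∀ j, b j < 0)
    (β : ℝ) (hβ0 : 0 < β) (hβ1 : β < 1) :
    ((∃ (h : Euc m ≃ₜ Euc m) (α : ℝ), α ≠ 0 ∧ MemHolderClass β h ∧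
        ∀ (t : ℝ) (x : Euc m),
          h (linFlow (Matrix.diagonal a) t x) = linFlow (Matrix.diagonal b) (α * t) (h x)) ↔
      RelEquivWith (MemHBelow β) (Matrix.diagonal a) (Matrix.diagonal b)) ∧
    (RelEquivWith (MemHBelow β) (Matrix.diagonal a) (Matrix.diagonal b) ↔
      β ^ 2 ≤ (⨅ j : Fin m, a j / b j) / (⨆ j : Fin m, a j / b j)) := by
  have : Nonempty (Fin m) := ⟨⟨0, hm⟩⟩
  have hpos : ∀ k, 0 < a k / b k := fun k => div_pos_of_neg_of_neg (haneg k) (hbneg k)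
  obtain ⟨i, hi⟩ := exists_eq_ciSup_of_finite (f := fun j : Fin m => a j / b j)
  obtain ⟨j, hj⟩ := exists_eq_ciInf_of_finite (f := fun j : Fin m => a j / b j)
  have hmax : ∀ k, a k / b k ≤ a i / b i := fun k => by
    have := le_ciSup (Set.finite_range fun j : Fin m => a j / b j).bddAbove k
    linarith
  have hmin : ∀ k, a j / b j ≤ a k / b k := fun k => by
    have := ciInf_le (Set.finite_range fun j : Fin m => a j / b j).bddBelow k
    linarith
  have h12 := sim_to_rel (A := Matrix.diagonal a) (B := Matrix.diagonal b) (β := β)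
  have h23 : RelEquivWith (MemHBelow β) (Matrix.diagonal a) (Matrix.diagonal b) →
      β ^ 2 ≤ (⨅ j : Fin m, a j / b j) / (⨆ j : Fin m, a j / b j) := by
    intro H
    rw [← hi, ← hj, le_div_iff₀ (hpos i)]
    exact rel_to_ineq hamono haneg hbmono hbneg hβ0 hβ1 H i j
  have h31 : β ^ 2 ≤ (⨅ j : Fin m, a j / b j) / (⨆ j : Fin m, a j / b j) →
      ∃ (h : Euc m ≃ₜ Euc m) (α : ℝ), α ≠ 0 ∧ MemHolderClass β h ∧
        ∀ (t : ℝ) (x : Euc m),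
          h (linFlow (Matrix.diagonal a) t x) = linFlow (Matrix.diagonal b) (α * t) (h x) := by
    intro H
    rw [← hi, ← hj, le_div_iff₀ (hpos i)] at H
    exact ineq_to_sim haneg hbneg hβ0 hβ1 i hmax (fun k => H.trans (hmin k))
  exact ⟨⟨h12, fun H => h31 (h23 H)⟩, ⟨h23, fun H => h12 (h31 H)⟩⟩

end LF
end
end
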